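/- arXiv:2405.20002 — 10 statements merged into one kernel-verified Lean document; each statement's English description precedes it below -/
import Mathlib

section
/- Let k ≥ 7 and l > 2 be integers with l = qk + r where r = ±1. Then the minimum over all (k,l)-intersection matrices N of |K_N| · ∏_{i,j} N_{i,j}! equals (q−r)!^{⌈k/2⌉} · q!^{k²−k−2⌈k/2⌉} · (q+r)!^{k+⌈k/2⌉}; that is, χ(k,l) = (q−r)!^{⌈k/2⌉} q!^{k²−k−2⌈k/2⌉} (q+r)!^{k+⌈k/2⌉}. Moreover, every (k,l)-intersection matrix N attaining this minimum satisfies one of: (a) K_N is trivial and the multiset of entries of N consists of ⌈k/2⌉ entries equal to q−r, k²−k−2⌈k/2⌉ entries equal to q, and k+⌈k/2⌉ entries equal to q+r; or (b) l = k + r (i.e., q = 1), |K_N| = 2, and the multiset of entries of N consists of ⌈k/2⌉−1 entries equal to 1−r, k²−k−2⌈k/2⌉+2 entries equal to 1, and k+⌈k/2⌉−1 entries equal to 1+r. -/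
/-- A `(k,l)`-intersection matrix: a `k × k` matrix of nonnegative integers all of whose
row sums and column sums equal `l`. -/
def IsInterMatrix (k l : ℕ) (N : Fin k → Fin k → ℕ) : Prop :=
  (∀ i, ∑ j, N i j = l) ∧ ∀ j, ∑ i, N i j = l

/-- `|K_N|`: the order of the stabilizer of `N` under the action of `S_k × S_k`
simultaneously permuting rows and columns. -/
noncomputable def stabCard {k : ℕ} (N : Fin k → Fin k → ℕ) : ℕ :=
  Nat.card {p : Equiv.Perm (Fin k) × Equiv.Perm (Fin k) // ∀ i j, N (p.1 i) (p.2 j) = N i j}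

/-- `|K_N| · ∏_{i,j} N_{i,j}!`, the order of the automorphism group of the `(k,l)`-bipartite
graph with bipartite adjacency matrix `N`. -/
noncomputable def autCard {k : ℕ} (N : Fin k → Fin k → ℕ) : ℕ :=
  stabCard N * ∏ i, ∏ j, (N i j).factorial

/-- The multiset of entries of a `k × k` matrix. -/
def entries {k : ℕ} (N : Fin k → Fin k → ℕ) : Multiset ℕ :=
  (Finset.univ : Finset (Fin k × Fin k)).val.map fun p => N p.1 p.2

section Symmetries

variable {ι : Type*} [Fintype ι] [DecidableEq ι]

/-- The stabilizer of an integer matrix under independent row and column permutations. -/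
abbrev MatrixStab (D : ι → ι → ℤ) : Type _ :=
  {p : Equiv.Perm ι × Equiv.Perm ι // ∀ i j, D (p.1 i) (p.2 j) = D i j}

/-- The rows that are not standard unit vectors. -/
def nonunitRows (D : ι → ι → ℤ) : Finset ι :=
  Finset.univ.filter fun i => ∀ j, D i ≠ Pi.single j 1

/-- The positions `(i, j)` such that row `i` and column `j` are unit vectors supported there. -/
def isolatedPairs (D : ι → ι → ℤ) : Finset (ι × ι) :=
  Finset.univ.filter fun p => D p.1 = Pi.single p.2 1 ∧ flip D p.2 = Pi.single p.1 1

/-- The total of the negative parts of the entries. -/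
def negTotal (D : ι → ι → ℤ) : ℕ := ∑ i, ∑ j, (-D i j).toNat

lemma mem_nonunitRows {D : ι → ι → ℤ} {i : ι} :
    i ∈ nonunitRows D ↔ ∀ j, D i ≠ Pi.single j 1 := by
  simp [nonunitRows]

lemma notMem_nonunitRows {D : ι → ι → ℤ} {i : ι} :
    i ∉ nonunitRows D ↔ ∃ j, D i = Pi.single j 1 := by
  simp [nonunitRows]

lemma mem_isolatedPairs {D : ι → ι → ℤ} {p : ι × ι} :
    p ∈ isolatedPairs D ↔ D p.1 = Pi.single p.2 1 ∧ flip D p.2 = Pi.single p.1 1 := by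
  simp [isolatedPairs]

lemma negTotal_flip {α : Type*} [Fintype α] (D : α → α → ℤ) : negTotal (flip D) = negTotal D :=
  Finset.sum_comm

lemma card_isolatedPairs_flip (D : ι → ι → ℤ) :
    (isolatedPairs (flip D)).card = (isolatedPairs D).card := by
  refine Finset.card_bij (fun p _ => p.swap) ?_ ?_ ?_
  · rintro ⟨i, j⟩ h
    rw [mem_isolatedPairs] at h ⊢
    exact ⟨h.2, h.1⟩
  · rintro p - p' - h
    exact Prod.swap_injective h
  · rintro ⟨i, j⟩ h
    refine ⟨(j, i), ?_, rfl⟩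
    rw [mem_isolatedPairs] at h ⊢
    exact ⟨h.2, h.1⟩

/-- A nonnegative integer vector with sum `1` is a unit vector. -/
lemma exists_eq_single_of_nonneg {f : ι → ℤ} (h0 : ∀ j, 0 ≤ f j) (h1 : ∑ j, f j = 1) :
    ∃ j, f = Pi.single j 1 := by
  obtain ⟨j, hj⟩ : ∃ j, 0 < f j := by
    by_contra! h
    have : ∑ j, f j ≤ 0 := Finset.sum_nonpos fun j _ => h j
    omega
  refine ⟨j, ?_⟩
  have hsum := Finset.add_sum_erase Finset.univ f (Finset.mem_univ j)
  have hrest : ∑ x ∈ Finset.univ.erase j, f x = 0 := by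
    have : 0 ≤ ∑ x ∈ Finset.univ.erase j, f x := Finset.sum_nonneg fun x _ => h0 x
    omega
  have hzero := (Finset.sum_eq_zero_iff_of_nonneg fun x _ => h0 x).1 hrest
  funext x
  by_cases hx : x = j
  · subst hx
    rw [Pi.single_eq_same]
    omega
  · rw [Pi.single_eq_of_ne hx]
    exact hzero x (by simp [hx])

lemma one_le_sum_neg {D : ι → ι → ℤ} (hD : ∀ i, ∑ j, D i j = 1) {i : ι}
    (hi : i ∈ nonunitRows D) : 1 ≤ ∑ j, (-D i j).toNat := by
  by_contra! h
  have h0 : ∑ j, (-D i j).toNat = 0 := by omega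
  rw [Finset.sum_eq_zero_iff] at h0
  obtain ⟨j, hj⟩ := exists_eq_single_of_nonneg
    (fun j => by have := h0 j (Finset.mem_univ j); omega) (hD i)
  exact mem_nonunitRows.1 hi j hj

lemma card_nonunitRows_le {D : ι → ι → ℤ} (hD : ∀ i, ∑ j, D i j = 1) :
    (nonunitRows D).card ≤ negTotal D :=
  calc (nonunitRows D).card = ∑ i ∈ nonunitRows D, 1 := by simp
    _ ≤ ∑ i ∈ nonunitRows D, ∑ j, (-D i j).toNat :=
      Finset.sum_le_sum fun _ hi => one_le_sum_neg hD hi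
    _ ≤ negTotal D := Finset.sum_le_univ_sum_of_nonneg fun _ => Nat.zero_le _

/-- Every row is a non-unit row, the unit vector of an isolated pair, or the unit vector of a
non-unit column. -/
lemma image_rows_subset (D : ι → ι → ℤ) :
    Finset.univ.image D ⊆ ((nonunitRows D).image D ∪
      (nonunitRows (flip D)).image fun j => (Pi.single j 1 : ι → ℤ)) ∪
      (isolatedPairs D).image fun p => (Pi.single p.2 1 : ι → ℤ) := by
  intro v hv
  obtain ⟨i, -, rfl⟩ := Finset.mem_image.1 hv
  by_cases hi : i ∈ nonunitRows D
  · exact Finset.mem_union_left _ (Finset.mem_union_left _ (Finset.mem_image_of_mem _ hi))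
  obtain ⟨j, hj⟩ := notMem_nonunitRows.1 hi
  by_cases hc : j ∈ nonunitRows (flip D)
  · exact Finset.mem_union_left _ (Finset.mem_union_right _
      (Finset.mem_image.2 ⟨j, hc, hj.symm⟩))
  obtain ⟨i', hi'⟩ := notMem_nonunitRows.1 hc
  have hii : i = i' := by
    by_contra hne
    have h1 : D i j = 1 := by rw [hj, Pi.single_eq_same]
    have h2 : D i j = 0 := by
      have := congrFun hi' i
      rwa [Pi.single_eq_of_ne hne] at this
    omega
  subst hii
  exact Finset.mem_union_right _ (Finset.mem_image.2
    ⟨(i, j), mem_isolatedPairs.2 ⟨hj, hi'⟩, hj.symm⟩)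

lemma card_union_images_le (D : ι → ι → ℤ) :
    (((nonunitRows D).image D ∪
      (nonunitRows (flip D)).image fun j => (Pi.single j 1 : ι → ℤ)) ∪
      (isolatedPairs D).image fun p => (Pi.single p.2 1 : ι → ℤ)).card ≤
    (nonunitRows D).card + (nonunitRows (flip D)).card + (isolatedPairs D).card :=
  (Finset.card_union_le _ _).trans (add_le_add ((Finset.card_union_le _ _).trans
    (add_le_add Finset.card_image_le Finset.card_image_le)) Finset.card_image_le)

lemma two_pow_pred_le_factorial (n : ℕ) : 2 ^ (n - 1) ≤ n.factorial := by
  cases n with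
  | zero => simp
  | succ n =>
    have := @Nat.factorial_mul_pow_le_factorial 1 n
    simpa [add_comm] using this

lemma two_pow_le_card_perm {β : Type*} [DecidableEq β] (f : ι → β) :
    2 ^ (Fintype.card ι - (Finset.univ.image f).card) ≤
      Nat.card {g : Equiv.Perm ι // f ∘ g = f} := by
  rw [Nat.card_eq_fintype_card, DomMulAct.stabilizer_card']
  have hsum : Fintype.card ι - (Finset.univ.image f).card =
      ∑ v ∈ Finset.univ.image f, (Fintype.card {a // f a = v} - 1) := by
    rw [Finset.sum_tsub_distrib]
    · simp only [Finset.sum_const, smul_eq_mul, mul_one, Fintype.card_subtype]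
      rw [← Finset.card_eq_sum_card_image, Finset.card_univ]
    · intro v hv
      obtain ⟨a, -, rfl⟩ := Finset.mem_image.1 hv
      exact Fintype.card_pos_iff.2 ⟨⟨a, rfl⟩⟩
  rw [hsum, ← Finset.prod_pow_eq_pow_sum]
  exact Finset.prod_le_prod' fun v _ => two_pow_pred_le_factorial _

lemma isolatedPairs_fst_injective (D : ι → ι → ℤ) :
    Function.Injective fun p : isolatedPairs D => p.1.1 := by
  rintro ⟨⟨i, j⟩, hp⟩ ⟨⟨i', j'⟩, hp'⟩ h
  obtain rfl : i = i' := h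
  have h1 := (mem_isolatedPairs.1 hp).1
  have h2 := (mem_isolatedPairs.1 hp').1
  dsimp only at h1 h2
  rw [h1] at h2
  have : j = j' := by
    by_contra hne
    have := congrFun h2 j
    rw [Pi.single_eq_same, Pi.single_eq_of_ne hne] at this
    omega
  subst this
  rfl

lemma isolatedPairs_snd_injective (D : ι → ι → ℤ) :
    Function.Injective fun p : isolatedPairs D => p.1.2 := by
  rintro ⟨⟨i, j⟩, hp⟩ ⟨⟨i', j'⟩, hp'⟩ h
  have := @isolatedPairs_fst_injective _ _ _ (flip D)
    ⟨(j, i), mem_isolatedPairs.2 (mem_isolatedPairs.1 hp).symm⟩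
    ⟨(j', i'), mem_isolatedPairs.2 (mem_isolatedPairs.1 hp').symm⟩ h
  simp only [Subtype.mk.injEq, Prod.mk.injEq] at this ⊢
  exact this.symm

/-- Permutations of isolated pairs, of equal rows and of equal columns embed jointly into the
stabilizer. -/
lemma factorial_mul_card_mul_card_le (D : ι → ι → ℤ) :
    (isolatedPairs D).card.factorial * Nat.card {g : Equiv.Perm ι // D ∘ g = D} *
      Nat.card {g : Equiv.Perm ι // flip D ∘ g = flip D} ≤ Nat.card (MatrixStab D) := by
  classical
  let ρ : isolatedPairs D ↪ ι := ⟨_, isolatedPairs_fst_injective D⟩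
  let κ : isolatedPairs D ↪ ι := ⟨_, isolatedPairs_snd_injective D⟩
  have hρ : ∀ x j, D (ρ x) j = if j = κ x then 1 else 0 := fun x j => by
    rw [show D (ρ x) = _ from (mem_isolatedPairs.1 x.2).1, Pi.single_apply]; rfl
  have hκ : ∀ x i, D i (κ x) = if i = ρ x then 1 else 0 := fun x i => by
    have := congrFun (mem_isolatedPairs.1 x.2).2 i
    rw [Pi.single_apply] at this
    exact this
  have hinv : ∀ (π : Equiv.Perm (isolatedPairs D)) i j,
      D (π.viaFintypeEmbedding ρ i) (π.viaFintypeEmbedding κ j) = D i j := by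
    intro π i j
    by_cases hi : i ∈ Set.range ρ
    · obtain ⟨x, rfl⟩ := hi
      rw [Equiv.Perm.viaFintypeEmbedding_apply_image, hρ, hρ]
      congr 1
      rw [← Equiv.Perm.viaFintypeEmbedding_apply_image (e := π) (f := κ)]
      simp only [EmbeddingLike.apply_eq_iff_eq]
    · rw [Equiv.Perm.viaFintypeEmbedding_apply_notMem_range _ _ hi]
      by_cases hj : j ∈ Set.range κ
      · obtain ⟨x, rfl⟩ := hj
        rw [Equiv.Perm.viaFintypeEmbedding_apply_image, hκ, hκ, if_neg, if_neg]
        · rintro rfl; exact hi ⟨_, rfl⟩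
        · rintro rfl; exact hi ⟨_, rfl⟩
      · rw [Equiv.Perm.viaFintypeEmbedding_apply_notMem_range _ _ hj]
  have hrow : ∀ g : Equiv.Perm ι, D ∘ g = D → ∀ x, g (ρ x) = ρ x := by
    intro g hg x
    have h1 : D (g (ρ x)) (κ x) = D (ρ x) (κ x) := congrFun (congrFun hg (ρ x)) (κ x)
    by_contra hne
    rw [hκ, hκ, if_neg hne, if_pos rfl] at h1
    omega
  let Φ : Equiv.Perm (isolatedPairs D) × {g : Equiv.Perm ι // D ∘ g = D} ×
      {g : Equiv.Perm ι // flip D ∘ g = flip D} → MatrixStab D := fun x =>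
    ⟨(x.2.1.1.trans (x.1.viaFintypeEmbedding ρ), x.2.2.1.trans (x.1.viaFintypeEmbedding κ)), by
      intro i j
      simp only [Equiv.trans_apply]
      rw [hinv]
      exact (congrFun (congrFun x.2.1.2 i) _).trans (congrFun (congrFun x.2.2.2 j) i)⟩
  have hΦ : Function.Injective Φ := by
    rintro ⟨π, ⟨g, hg⟩, ⟨h, hh⟩⟩ ⟨π', ⟨g', hg'⟩, ⟨h', hh'⟩⟩ he
    simp only [Φ, Subtype.mk.injEq, Prod.mk.injEq] at he
    obtain ⟨he1, he2⟩ := he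
    have hπ : π = π' := by
      ext1 x
      have := Equiv.congr_fun he1 (ρ x)
      simp only [Equiv.trans_apply, hrow g hg, hrow g' hg',
        Equiv.Perm.viaFintypeEmbedding_apply_image] at this
      exact ρ.injective this
    subst hπ
    have hg : g = g' := by
      ext1 x
      exact (π.viaFintypeEmbedding ρ).injective (Equiv.congr_fun he1 x)
    have hh : h = h' := by
      ext1 x
      exact (π.viaFintypeEmbedding κ).injective (Equiv.congr_fun he2 x)
    subst hg hh
    rfl
  have := Nat.card_le_card_of_injective Φ hΦ
  rwa [Nat.card_prod, Nat.card_prod, Nat.card_perm, Nat.card_eq_fintype_card,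
    Fintype.card_coe, ← mul_assoc] at this

/-- The stabilizer bound coming from isolated pairs and repeated rows and columns. -/
lemma factorial_mul_two_pow_le {D : ι → ι → ℤ} (hr : ∀ i, ∑ j, D i j = 1)
    (hc : ∀ j, ∑ i, D i j = 1) :
    (isolatedPairs D).card.factorial *
      2 ^ (2 * (Fintype.card ι - 2 * negTotal D - (isolatedPairs D).card)) ≤
      Nat.card (MatrixStab D) := by
  have hA : (nonunitRows D).card ≤ negTotal D := card_nonunitRows_le hr
  have hB : (nonunitRows (flip D)).card ≤ negTotal D := by
    rw [← negTotal_flip]; exact card_nonunitRows_le hc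
  have h1 := (Finset.card_le_card (image_rows_subset D)).trans (card_union_images_le D)
  have h2 := (Finset.card_le_card (image_rows_subset (flip D))).trans
    (card_union_images_le (flip D))
  rw [card_isolatedPairs_flip, show flip (flip D) = D from rfl] at h2
  refine le_trans ?_ (factorial_mul_card_mul_card_le D)
  rw [mul_assoc]
  refine Nat.mul_le_mul_left _ ?_
  rw [two_mul, pow_add]
  refine Nat.mul_le_mul (le_trans ?_ (two_pow_le_card_perm D))
    (le_trans ?_ (two_pow_le_card_perm (flip D)))
  · exact Nat.pow_le_pow_right two_pos (by omega)
  · exact Nat.pow_le_pow_right two_pos (by omega)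

/-- A vector with sum `1`, negative total `1` and an entry `1` at `c` has one further entry `1`,
one entry `-1`, and zeros elsewhere. -/
lemma exists_eq_single_add_single_sub_single {f : ι → ℤ} (h1 : ∑ j, f j = 1)
    (hneg : ∑ j, (-f j).toNat = 1) {c : ι} (hc : f c = 1) :
    ∃ p n, p ≠ c ∧ n ≠ c ∧ p ≠ n ∧
      ∀ j, f j = (if j = p then 1 else 0) + (if j = c then 1 else 0) - if j = n then 1 else 0 := by
  obtain ⟨n, hn⟩ := exists_eq_single_of_nonneg (f := fun j => ((-f j).toNat : ℤ))
    (fun j => Int.natCast_nonneg _) (by exact_mod_cast hneg)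
  have hn' : ∀ j, ((-f j).toNat : ℤ) = if j = n then 1 else 0 := fun j => by
    rw [← Pi.single_apply n (1 : ℤ) j]; exact congrFun hn j
  have hnc : c ≠ n := by
    intro h
    have := hn' c
    rw [if_pos h] at this
    omega
  obtain ⟨p, hp⟩ := exists_eq_single_of_nonneg
    (f := fun j => f j + (if j = n then 1 else 0) - if j = c then 1 else 0) (fun j => by
      have := hn' j
      by_cases hj : j = c
      · subst hj
        simp [hnc, hc]
      · simp only [hj, if_false]
        split_ifs at this ⊢ <;> omega)
    (by simp [Finset.sum_add_distrib, h1])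
  have hp' : ∀ j, f j + (if j = n then 1 else 0) - (if j = c then 1 else 0) =
      if j = p then 1 else 0 := fun j => by
    rw [← Pi.single_apply p (1 : ℤ) j]; exact congrFun hp j
  refine ⟨p, n, ?_, hnc.symm, ?_, fun j => by have := hp' j; omega⟩
  · rintro rfl
    have := hp' p
    simp [hnc, hc] at this
  · rintro rfl
    have h2 := hp' p
    have h3 := hn' p
    simp only [if_true, hnc.symm, if_false] at h2 h3
    omega

lemma row_injective_of_subsingleton {α : Type*} [DecidableEq α] {D : α → α → ℤ}
    [Subsingleton (MatrixStab D)] : Function.Injective D := by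
  intro i i' h
  let x : MatrixStab D := ⟨(Equiv.swap i i', 1), fun a b => by
    simp only [Equiv.Perm.coe_one, id_eq]
    rw [Equiv.swap_apply_def]
    split_ifs with h1 h2
    · rw [h1, h]
    · rw [h2, h]
    · rfl⟩
  have hx : x = ⟨1, fun _ _ => rfl⟩ := Subsingleton.elim _ _
  have := Equiv.congr_fun (congrArg (fun y : MatrixStab D => y.1.1) hx) i
  simpa [x] using this.symm

lemma subsingleton_matrixStab_flip {α : Type*} {D : α → α → ℤ}
    [Subsingleton (MatrixStab D)] : Subsingleton (MatrixStab (flip D)) := by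
  refine ⟨fun x y => ?_⟩
  have h := Subsingleton.elim (α := MatrixStab D) ⟨x.1.swap, fun i j => x.2 j i⟩
    ⟨y.1.swap, fun i j => y.2 j i⟩
  exact Subtype.ext (Prod.swap_injective (congrArg Subtype.val h))

/-- In the extremal odd case without repeated rows, the rows account exactly for the upper bound
on their number. -/
lemma exists_row_eq_single {D : ι → ι → ℤ} (hr : ∀ i, ∑ j, D i j = 1)
    (hc : ∀ j, ∑ i, D i j = 1) (hcard : Fintype.card ι = 2 * negTotal D + 1)
    (hinj : Function.Injective D) (hs : (isolatedPairs D).card ≤ 1) :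
    (nonunitRows D).card = negTotal D ∧ (isolatedPairs D).Nonempty ∧
      ∀ j ∈ nonunitRows (flip D), ∃ i, D i = Pi.single j 1 := by
  have hA : (nonunitRows D).card ≤ negTotal D := card_nonunitRows_le hr
  have hB : (nonunitRows (flip D)).card ≤ negTotal D := by
    rw [← negTotal_flip]; exact card_nonunitRows_le hc
  have h1 := Finset.card_le_card (image_rows_subset D)
  have h2 := card_union_images_le D
  have h3 : (Finset.univ.image D).card = Fintype.card ι :=
    Finset.card_image_of_injective _ hinj
  have heq := Finset.eq_of_subset_of_card_le (image_rows_subset D) (by omega)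
  refine ⟨by omega, Finset.card_pos.1 (by omega), fun j hj => ?_⟩
  have : (Pi.single j 1 : ι → ℤ) ∈ Finset.univ.image D := by
    rw [heq]
    exact Finset.mem_union_left _ (Finset.mem_union_right _ (Finset.mem_image.2 ⟨j, hj, rfl⟩))
  obtain ⟨i, -, hi⟩ := Finset.mem_image.1 this
  exact ⟨i, hi⟩

lemma sum_neg_eq_one {D : ι → ι → ℤ} (hr : ∀ i, ∑ j, D i j = 1)
    (hcard : (nonunitRows D).card = negTotal D) {i : ι} (hi : i ∈ nonunitRows D) :
    ∑ j, (-D i j).toNat = 1 := by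
  have hle : ∑ i ∈ nonunitRows D, ∑ j, (-D i j).toNat ≤ ∑ i ∈ nonunitRows D, 1 := by
    rw [Finset.sum_const, smul_eq_mul, mul_one, hcard]
    exact Finset.sum_le_univ_sum_of_nonneg fun _ => Nat.zero_le _
  have heq := le_antisymm (Finset.sum_le_sum fun _ hi => one_le_sum_neg hr hi) hle
  exact ((Finset.sum_eq_sum_iff_of_le fun _ hi => one_le_sum_neg hr hi).1 heq i hi).symm

lemma apply_of_eq_single {α : Type*} [DecidableEq α] {D : α → α → ℤ} {i j : α}
    (h : D i = Pi.single j 1) (x : α) : D i x = if x = j then 1 else 0 := by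
  rw [h, Pi.single_apply]

lemma two_le_card_matrixStab {D : ι → ι → ℤ} (hr : ∀ i, ∑ j, D i j = 1)
    (hc : ∀ j, ∑ i, D i j = 1) (hcard : Fintype.card ι = 2 * negTotal D + 1)
    (hpos : 0 < negTotal D) : 2 ≤ Nat.card (MatrixStab D) := by
  by_contra! hlt
  have hsub : Subsingleton (MatrixStab D) := Finite.card_le_one_iff_subsingleton.1 (by omega)
  have hsub' : Subsingleton (MatrixStab (flip D)) := subsingleton_matrixStab_flip
  have hs : (isolatedPairs D).card ≤ 1 := by
    have h1 := factorial_mul_two_pow_le hr hc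
    have h2 := Nat.le_mul_of_pos_right (isolatedPairs D).card.factorial
      (pow_pos two_pos (2 * (Fintype.card ι - 2 * negTotal D - (isolatedPairs D).card)))
    have h3 := Nat.self_le_factorial (isolatedPairs D).card
    omega
  obtain ⟨hA, ⟨⟨i₀, j₀⟩, hiso⟩, hρ⟩ :=
    exists_row_eq_single hr hc hcard row_injective_of_subsingleton hs
  obtain ⟨hB, -, hγ⟩ := exists_row_eq_single (D := flip D) hc hr
    (by rw [negTotal_flip]; exact hcard) row_injective_of_subsingleton
    (by rw [card_isolatedPairs_flip]; exact hs)
  rw [show flip (flip D) = D from rfl] at hγ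
  obtain ⟨hi₀, hj₀⟩ := mem_isolatedPairs.1 hiso
  dsimp only at hi₀ hj₀
  choose! ρ hρ using hρ
  choose! γ hγ using hγ
  have hcolinj : Function.Injective (flip D) := row_injective_of_subsingleton
  -- entries of unit rows and columns
  have eρ : ∀ j ∈ nonunitRows (flip D), ∀ x, D (ρ j) x = if x = j then 1 else 0 :=
    fun j hj => apply_of_eq_single (hρ j hj)
  have eγ : ∀ i ∈ nonunitRows D, ∀ x, D x (γ i) = if x = i then 1 else 0 :=
    fun i hi => apply_of_eq_single (D := flip D) (hγ i hi)
  have ei₀ : ∀ x, D i₀ x = if x = j₀ then 1 else 0 := apply_of_eq_single hi₀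
  have ej₀ : ∀ x, D x j₀ = if x = i₀ then 1 else 0 := apply_of_eq_single (D := flip D) hj₀
  have mρ : ∀ j ∈ nonunitRows (flip D), ρ j ∉ nonunitRows D := fun j hj =>
    notMem_nonunitRows.2 ⟨j, hρ j hj⟩
  have mγ : ∀ i ∈ nonunitRows D, γ i ∉ nonunitRows (flip D) := fun i hi =>
    notMem_nonunitRows.2 ⟨i, hγ i hi⟩
  have mi₀ : i₀ ∉ nonunitRows D := notMem_nonunitRows.2 ⟨j₀, hi₀⟩
  have mj₀ : j₀ ∉ nonunitRows (flip D) := notMem_nonunitRows.2 ⟨i₀, hj₀⟩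
  have neρ : ∀ i ∈ nonunitRows D, ∀ j ∈ nonunitRows (flip D), i ≠ ρ j := fun i hi j hj =>
    ne_of_mem_of_not_mem hi (mρ j hj)
  have neγ : ∀ j ∈ nonunitRows (flip D), ∀ i ∈ nonunitRows D, j ≠ γ i := fun j hj i hi =>
    ne_of_mem_of_not_mem hj (mγ i hi)
  have nei₀ : ∀ i ∈ nonunitRows D, i ≠ i₀ := fun i hi => ne_of_mem_of_not_mem hi mi₀
  have nej₀ : ∀ j ∈ nonunitRows (flip D), j ≠ j₀ := fun j hj => ne_of_mem_of_not_mem hj mj₀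
  -- shape of the nonunit rows and columns
  have hrow : ∀ i ∈ nonunitRows D, ∃ p n, p ≠ γ i ∧ n ≠ γ i ∧ p ≠ n ∧ ∀ j, D i j =
      (if j = p then 1 else 0) + (if j = γ i then 1 else 0) - if j = n then 1 else 0 :=
    fun i hi => exists_eq_single_add_single_sub_single (hr i) (sum_neg_eq_one hr hA hi)
      (by rw [eγ i hi, if_pos rfl])
  have hcol : ∀ j ∈ nonunitRows (flip D), ∃ p n, p ≠ ρ j ∧ n ≠ ρ j ∧ p ≠ n ∧ ∀ i, D i j =
      (if i = p then 1 else 0) + (if i = ρ j then 1 else 0) - if i = n then 1 else 0 :=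
    fun j hj => exists_eq_single_add_single_sub_single (hc j) (sum_neg_eq_one hc hB hj)
      (by rw [eρ j hj, if_pos rfl])
  choose! p n hpγ hnγ hpn hD using hrow
  have mn : ∀ i ∈ nonunitRows D, n i ∈ nonunitRows (flip D) := by
    intro i hi
    by_contra h
    obtain ⟨x, hx⟩ := notMem_nonunitRows.1 h
    have h1 := apply_of_eq_single hx i
    have h2 := hD i hi (n i)
    rw [if_neg (hpn i hi).symm, if_neg (hnγ i hi), if_pos rfl] at h2
    simp only [flip] at h1
    split_ifs at h1 <;> omega
  have mp : ∀ i ∈ nonunitRows D, p i ∈ nonunitRows (flip D) := by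
    intro i hi
    by_contra h
    obtain ⟨x, hx⟩ := notMem_nonunitRows.1 h
    have h1 := apply_of_eq_single hx i
    have h2 := hD i hi (p i)
    rw [if_pos rfl, if_neg (hpγ i hi), if_neg (hpn i hi)] at h2
    simp only [flip] at h1
    have hix : i = x := by by_contra hne; rw [if_neg hne] at h1; omega
    subst hix
    exact hpγ i hi (hcolinj (hx.trans (hγ i hi).symm))
  have pinj : ∀ i ∈ nonunitRows D, ∀ i' ∈ nonunitRows D, p i = p i' → i = i' := by
    intro i hi i' hi' h
    obtain ⟨a, b, h1, h2, h3, h4⟩ := hcol (p i) (mp i hi)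
    have e1 := hD i hi (p i)
    rw [if_pos rfl, if_neg (hpγ i hi), if_neg (hpn i hi), h4,
      if_neg (neρ i hi _ (mp i hi))] at e1
    have e2 := hD i' hi' (p i')
    rw [if_pos rfl, if_neg (hpγ i' hi'), if_neg (hpn i' hi'), ← h, h4,
      if_neg (neρ i' hi' _ (mp i hi))] at e2
    have f1 : i = a := by by_contra hne; rw [if_neg hne] at e1; split_ifs at e1 <;> omega
    have f2 : i' = a := by by_contra hne; rw [if_neg hne] at e2; split_ifs at e2 <;> omega
    rw [f1, f2]
  have ninj : ∀ i ∈ nonunitRows D, ∀ i' ∈ nonunitRows D, n i = n i' → i = i' := by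
    intro i hi i' hi' h
    obtain ⟨a, b, h1, h2, h3, h4⟩ := hcol (n i) (mn i hi)
    have e1 := hD i hi (n i)
    rw [if_neg (hpn i hi).symm, if_neg (hnγ i hi), if_pos rfl, h4] at e1
    have e2 := hD i' hi' (n i')
    rw [if_neg (hpn i' hi').symm, if_neg (hnγ i' hi'), if_pos rfl, ← h, h4] at e2
    have f1 : i = b := by by_contra hne; rw [if_neg hne] at e1; split_ifs at e1 <;> omega
    have f2 : i' = b := by by_contra hne; rw [if_neg hne] at e2; split_ifs at e2 <;> omega
    rw [f1, f2]
  -- the permutation of the nonunit rows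
  have hcardAB : (nonunitRows (flip D)).card ≤ (nonunitRows D).card := by
    rw [hA, hB, negTotal_flip]
  have psurj : ∀ j ∈ nonunitRows (flip D), ∃ i ∈ nonunitRows D, p i = j := fun j hj => by
    obtain ⟨i, hi, h⟩ := Finset.surj_on_of_inj_on_of_card_le (s := nonunitRows D)
      (t := nonunitRows (flip D)) (fun i _ => p i) (fun i hi => mp i hi)
      (fun i i' hi hi' => pinj i hi i' hi') hcardAB j hj
    exact ⟨i, hi, h.symm⟩
  choose! s ms hps using fun i (hi : i ∈ nonunitRows D) => psurj (n i) (mn i hi)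
  let A := {i // i ∈ nonunitRows D}
  have σinj : Function.Injective fun i : A => (⟨s i.1, ms i.1 i.2⟩ : A) := by
    intro i i' h
    have h' : s i.1 = s i'.1 := congrArg Subtype.val h
    exact Subtype.ext (ninj _ i.2 _ i'.2 (by rw [← hps _ i.2, ← hps _ i'.2, h']))
  let σ : Equiv.Perm A := Equiv.ofBijective _ (Finite.injective_iff_bijective.1 σinj)
  have hσ : ∀ i : A, p (σ i).1 = n i.1 := fun i => hps i.1 i.2
  -- coordinates in which the matrix is determined by `σ`
  have pA : ∀ i i' : A, p i.1 = p i'.1 ↔ i = i' := fun i i' =>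
    ⟨fun h => Subtype.ext (pinj _ i.2 _ i'.2 h), fun h => by rw [h]⟩
  let er : A ⊕ A ⊕ Unit → ι := Sum.elim (fun i => i.1) (Sum.elim (fun i => ρ (p i.1)) fun _ => i₀)
  let ec : A ⊕ A ⊕ Unit → ι := Sum.elim (fun i => p i.1) (Sum.elim (fun i => γ i.1) fun _ => j₀)
  have ρinj : ∀ i i' : A, ρ (p i.1) = ρ (p i'.1) → i = i' := by
    intro i i' h
    have h1 := eρ _ (mp _ i.2) (p i.1)
    rw [h, eρ _ (mp _ i'.2), if_pos rfl] at h1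
    exact (pA i i').1 (by by_contra hne; rw [if_neg hne] at h1; omega)
  have γinj : ∀ i i' : A, γ i.1 = γ i'.1 → i = i' := by
    intro i i' h
    have h1 := eγ _ i.2 i.1
    rw [h, eγ _ i'.2, if_pos rfl] at h1
    exact Subtype.ext (by by_contra hne; rw [if_neg hne] at h1; omega)
  have ρi₀ : ∀ i : A, ρ (p i.1) ≠ i₀ := by
    intro i h
    have h1 := eρ _ (mp _ i.2) (p i.1)
    rw [h, ei₀, if_pos rfl, if_neg (nej₀ _ (mp _ i.2))] at h1
    omega
  have γj₀ : ∀ i : A, γ i.1 ≠ j₀ := by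
    intro i h
    have h1 := eγ _ i.2 i.1
    rw [h, ej₀, if_pos rfl, if_neg (nei₀ _ i.2)] at h1
    omega
  have erinj : Function.Injective er := by
    rintro (i | i | _) (i' | i' | _) h <;> simp only [er, Sum.elim_inl, Sum.elim_inr] at h
    · rw [Subtype.ext h]
    · exact absurd h (neρ _ i.2 _ (mp _ i'.2))
    · exact absurd h (nei₀ _ i.2)
    · exact absurd h.symm (neρ _ i'.2 _ (mp _ i.2))
    · rw [ρinj _ _ h]
    · exact absurd h (ρi₀ i)
    · exact absurd h.symm (nei₀ _ i'.2)
    · exact absurd h.symm (ρi₀ i')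
    · rfl
  have ecinj : Function.Injective ec := by
    rintro (i | i | _) (i' | i' | _) h <;> simp only [ec, Sum.elim_inl, Sum.elim_inr] at h
    · rw [(pA i i').1 h]
    · exact absurd h (neγ _ (mp _ i.2) _ i'.2)
    · exact absurd h (nej₀ _ (mp _ i.2))
    · exact absurd h.symm (neγ _ (mp _ i'.2) _ i.2)
    · rw [γinj _ _ h]
    · exact absurd h (γj₀ i)
    · exact absurd h.symm (nej₀ _ (mp _ i'.2))
    · exact absurd h.symm (γj₀ i')
    · rfl
  have hcardA : Fintype.card (A ⊕ A ⊕ Unit) = Fintype.card ι := by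
    simp only [Fintype.card_sum, A, Fintype.card_coe, hA, Fintype.card_unit, hcard]
    omega
  let Er := Equiv.ofBijective er ((Fintype.bijective_iff_injective_and_card er).2 ⟨erinj, hcardA⟩)
  let Ec := Equiv.ofBijective ec ((Fintype.bijective_iff_injective_and_card ec).2 ⟨ecinj, hcardA⟩)
  let θ : Equiv.Perm (A ⊕ A ⊕ Unit) := Equiv.sumCongr σ (Equiv.sumCongr σ (Equiv.refl _))
  have hblock : ∀ i i' : A, D i.1 (p i'.1) =
      (if i' = i then 1 else 0) - if i' = σ i then 1 else 0 := by
    intro i i'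
    rw [hD _ i.2, if_neg (neγ _ (mp _ i'.2) _ i.2), ← hσ, add_zero]
    simp only [pA]
  have hθ : ∀ x y, D (er (θ x)) (ec (θ y)) = D (er x) (ec y) := by
    rintro (i | i | _) (i' | i' | _) <;>
      simp only [er, ec, θ, Equiv.sumCongr_apply, Sum.map_inl, Sum.map_inr, Sum.elim_inl,
        Sum.elim_inr, Equiv.refl_apply]
    · simp only [hblock, EmbeddingLike.apply_eq_iff_eq]
    · rw [eγ _ (σ i').2, eγ _ i'.2]
      simp only [Subtype.coe_inj, EmbeddingLike.apply_eq_iff_eq]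
    · rw [ej₀, ej₀, if_neg (nei₀ _ (σ i).2), if_neg (nei₀ _ i.2)]
    · rw [eρ _ (mp _ (σ i).2), eρ _ (mp _ i.2)]
      simp only [pA, EmbeddingLike.apply_eq_iff_eq]
    · rw [eγ _ (σ i').2, eγ _ i'.2, if_neg (neρ _ (σ i').2 _ (mp _ (σ i).2)).symm,
        if_neg (neρ _ i'.2 _ (mp _ i.2)).symm]
    · rw [ej₀, ej₀, if_neg (ρi₀ _), if_neg (ρi₀ _)]
    · rw [ei₀, ei₀, if_neg (nej₀ _ (mp _ (σ i').2)), if_neg (nej₀ _ (mp _ i'.2))]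
    · rw [ei₀, ei₀, if_neg (γj₀ _), if_neg (γj₀ _)]
  let X : MatrixStab D := ⟨(Er.symm.trans (θ.trans Er), Ec.symm.trans (θ.trans Ec)), by
    intro i j
    obtain ⟨x, rfl⟩ := Er.surjective i
    obtain ⟨y, rfl⟩ := Ec.surjective j
    simp only [Equiv.trans_apply, Equiv.symm_apply_apply]
    exact hθ x y⟩
  obtain ⟨i, hi⟩ := Finset.card_pos.1 (hA ▸ hpos)
  have hX : X = ⟨1, fun _ _ => rfl⟩ := Subsingleton.elim _ _
  have h1 := Equiv.congr_fun (congrArg (fun y : MatrixStab D => y.1.1) hX) (Er (Sum.inl ⟨i, hi⟩))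
  simp only [X, Equiv.trans_apply, Equiv.symm_apply_apply, Prod.fst_one, Equiv.Perm.coe_one,
    id_eq, EmbeddingLike.apply_eq_iff_eq, θ, Equiv.sumCongr_apply, Sum.map_inl, Sum.inl.injEq] at h1
  have h2 := hσ ⟨i, hi⟩
  rw [h1] at h2
  exact hpn i hi h2

lemma two_le_card_of_add_one {D : ι → ι → ℤ} (hr : ∀ i, ∑ j, D i j = 1)
    (hc : ∀ j, ∑ i, D i j = 1) (hpos : 0 < negTotal D)
    (ht : negTotal D + 1 = (Fintype.card ι + 1) / 2) : 2 ≤ Nat.card (MatrixStab D) := by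
  by_cases hs1 : (isolatedPairs D).card = 1 ∧ Fintype.card ι = 2 * negTotal D + 1
  · exact two_le_card_matrixStab hr hc hs1.2 hpos
  refine le_trans ?_ (factorial_mul_two_pow_le hr hc)
  generalize (isolatedPairs D).card = s at *
  have hf := Nat.self_le_factorial s
  have hf0 := Nat.factorial_pos s
  by_cases hs : 2 ≤ s
  · exact (hs.trans hf).trans (Nat.le_mul_of_pos_right _ (pow_pos two_pos _))
  · have : 2 ^ 1 ≤ 2 ^ (2 * (Fintype.card ι - 2 * negTotal D - s)) :=
      Nat.pow_le_pow_right two_pos (by omega)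
    nlinarith

lemma two_pow_lt_card_of_add_two_le {D : ι → ι → ℤ} (hr : ∀ i, ∑ j, D i j = 1)
    (hc : ∀ j, ∑ i, D i j = 1) (ht : negTotal D + 2 ≤ (Fintype.card ι + 1) / 2) :
    2 ^ ((Fintype.card ι + 1) / 2 - negTotal D) < Nat.card (MatrixStab D) := by
  refine lt_of_lt_of_le ?_ (factorial_mul_two_pow_le hr hc)
  generalize (isolatedPairs D).card = s at *
  generalize negTotal D = t at *
  generalize Fintype.card ι = k at *
  by_cases hs : s = 3 ∧ (k + 1) / 2 - t = 2
  · rw [hs.1, hs.2]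
    have : 0 < 2 ^ (2 * (k - 2 * t - 3)) := pow_pos two_pos _
    simp only [Nat.factorial]
    omega
  · calc 2 ^ ((k + 1) / 2 - t) < 2 ^ (s - 1 + 2 * (k - 2 * t - s)) :=
        Nat.pow_lt_pow_right one_lt_two (by omega)
      _ ≤ _ := by
        rw [pow_add]
        exact Nat.mul_le_mul_right _ (two_pow_pred_le_factorial s)

end Symmetries

section Weights

lemma factorial_mul_pow_le_factorial_mul_pow (q n : ℕ) :
    q.factorial * (q + 1) ^ (n - q) ≤ n.factorial * q ^ (q - n) := by
  rcases le_total q n with h | h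
  · obtain ⟨m, rfl⟩ := Nat.exists_eq_add_of_le h
    simpa using @Nat.factorial_mul_pow_le_factorial q m
  · rw [Nat.sub_eq_zero_of_le h, pow_zero, mul_one,
      ← Nat.factorial_mul_descFactorial (Nat.sub_le q n), Nat.sub_sub_self h]
    exact Nat.mul_le_mul_left _ (Nat.descFactorial_le_pow _ _)

lemma factorial_mul_pow_lt_factorial_mul_pow {q n : ℕ} (hq : 0 < q)
    (h : q + 1 < n ∨ n + 1 < q) :
    q.factorial * (q + 1) ^ (n - q) < n.factorial * q ^ (q - n) := by
  rcases h with h | h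
  · obtain ⟨m, rfl⟩ := Nat.exists_eq_add_of_le (show q ≤ n by omega)
    rw [Nat.add_sub_cancel_left, Nat.sub_eq_zero_of_le (by omega), pow_zero, mul_one,
      ← Nat.factorial_mul_ascFactorial]
    exact Nat.mul_lt_mul_of_pos_left (Nat.pow_lt_ascFactorial q (by omega)) (Nat.factorial_pos _)
  · have hle : n ≤ q := by omega
    rw [Nat.sub_eq_zero_of_le hle, pow_zero, mul_one,
      ← Nat.factorial_mul_descFactorial (Nat.sub_le q n), Nat.sub_sub_self hle]
    exact Nat.mul_lt_mul_of_pos_left (Nat.descFactorial_lt_pow hq.ne' (by omega))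
      (Nat.factorial_pos _)

variable {k : ℕ}

lemma prod_factorial_bound (N : Fin k → Fin k → ℕ) (q : ℕ) :
    q.factorial ^ k ^ 2 * (q + 1) ^ (∑ i, ∑ j, (N i j - q)) ≤
      (∏ i, ∏ j, (N i j).factorial) * q ^ ∑ i, ∑ j, (q - N i j) := by
  have h := Finset.prod_le_prod' (s := Finset.univ) fun (p : Fin k × Fin k) _ =>
    factorial_mul_pow_le_factorial_mul_pow q (N p.1 p.2)
  simpa only [Finset.prod_mul_distrib, Finset.prod_const, Finset.prod_pow_eq_pow_sum,
    Finset.card_univ, Fintype.card_prod, Fintype.card_fin, ← sq, Fintype.sum_prod_type,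
    Fintype.prod_prod_type] using h

lemma near_of_prod_factorial_eq {N : Fin k → Fin k → ℕ} {q : ℕ} (hq : 0 < q)
    (h : q.factorial ^ k ^ 2 * (q + 1) ^ (∑ i, ∑ j, (N i j - q)) =
      (∏ i, ∏ j, (N i j).factorial) * q ^ ∑ i, ∑ j, (q - N i j)) (i j : Fin k) :
    N i j ≤ q + 1 ∧ q ≤ N i j + 1 := by
  by_contra hne
  have h' := Finset.prod_lt_prod (s := Finset.univ)
    (f := fun p : Fin k × Fin k => q.factorial * (q + 1) ^ (N p.1 p.2 - q))
    (g := fun p : Fin k × Fin k => (N p.1 p.2).factorial * q ^ (q - N p.1 p.2))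
    (fun p _ => by positivity)
    (fun p _ => factorial_mul_pow_le_factorial_mul_pow q (N p.1 p.2))
    ⟨(i, j), Finset.mem_univ _, factorial_mul_pow_lt_factorial_mul_pow hq (by dsimp only; omega)⟩
  refine h'.ne ?_
  simpa only [Finset.prod_mul_distrib, Finset.prod_const, Finset.prod_pow_eq_pow_sum,
    Finset.card_univ, Fintype.card_prod, Fintype.card_fin, ← sq, Fintype.sum_prod_type,
    Fintype.prod_prod_type] using h

/-- The signed deviation of a matrix from the constant matrix `q`. -/
def deviation (q : ℕ) (r : ℤ) (N : Fin k → Fin k → ℕ) (i j : Fin k) : ℤ := r * (N i j - q)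

/-- The product of factorials of `t` entries `a`, `k + t` entries `b` and otherwise `q`. -/
def balancedValue (k q a b t : ℕ) : ℕ :=
  a.factorial ^ t * q.factorial ^ (k ^ 2 - k - 2 * t) * b.factorial ^ (k + t)

lemma stabCard_eq_card_matrixStab (q : ℕ) {r : ℤ} (hr : r = 1 ∨ r = -1)
    (N : Fin k → Fin k → ℕ) : stabCard N = Nat.card (MatrixStab (deviation q r N)) := by
  refine Nat.card_congr (Equiv.subtypeEquivRight fun p => forall₂_congr fun i j => ?_)
  unfold deviation
  rcases hr with rfl | rfl <;> omega

lemma sum_deviation_row {l q : ℕ} {r : ℤ} (hr : r = 1 ∨ r = -1) (hlq : (l : ℤ) = q * k + r)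
    {N : Fin k → Fin k → ℕ} (hN : IsInterMatrix k l N) (i : Fin k) :
    ∑ j, deviation q r N i j = 1 := by
  have h : (∑ j, (N i j : ℤ)) = l := by exact_mod_cast hN.1 i
  simp only [deviation, ← Finset.mul_sum, Finset.sum_sub_distrib, h, hlq]
  rcases hr with rfl | rfl <;> simp <;> ring

lemma sum_deviation_col {l q : ℕ} {r : ℤ} (hr : r = 1 ∨ r = -1) (hlq : (l : ℤ) = q * k + r)
    {N : Fin k → Fin k → ℕ} (hN : IsInterMatrix k l N) (j : Fin k) :
    ∑ i, deviation q r N i j = 1 :=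
  sum_deviation_row (N := flip N) hr hlq ⟨hN.2, hN.1⟩ j

lemma entries_eq_of_near {q a b : ℕ} {r : ℤ} (hr : r = 1 ∨ r = -1) (ha : (a : ℤ) = q - r)
    (hb : (b : ℤ) = q + r) {N : Fin k → Fin k → ℕ}
    (hrow : ∀ i, ∑ j, deviation q r N i j = 1)
    (hnear : ∀ i j, N i j ≤ q + 1 ∧ q ≤ N i j + 1) :
    entries N = Multiset.replicate (negTotal (deviation q r N)) a +
      Multiset.replicate (k ^ 2 - k - 2 * negTotal (deviation q r N)) q +
      Multiset.replicate (k + negTotal (deviation q r N)) b := by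
  have hcount : ∀ x, (entries N).count x = ∑ p : Fin k × Fin k, if N p.1 p.2 = x then 1 else 0 := by
    intro x
    rw [entries, Multiset.count_map, ← Finset.filter_val, Finset.card_val, Finset.card_filter]
    simp only [eq_comm]
  have hval : ∀ i j, N i j = a ∨ N i j = q ∨ N i j = b := by
    intro i j
    have := hnear i j
    rcases hr with rfl | rfl <;> omega
  have hne : a ≠ q ∧ a ≠ b ∧ q ≠ b := by rcases hr with rfl | rfl <;> omega
  have h_a : (entries N).count a = negTotal (deviation q r N) := by
    rw [hcount, negTotal, Fintype.sum_prod_type]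
    refine Finset.sum_congr rfl fun i _ => Finset.sum_congr rfl fun j _ => ?_
    have := hnear i j
    dsimp only [deviation]
    rcases hr with rfl | rfl <;> split_ifs <;> omega
  have hall : (entries N).count a + (entries N).count q + (entries N).count b = k ^ 2 := by
    rw [hcount, hcount, hcount, ← Finset.sum_add_distrib, ← Finset.sum_add_distrib]
    rw [Finset.sum_congr rfl (g := fun _ => 1)]
    · simp [sq]
    · rintro ⟨i, j⟩ -
      rcases hval i j with h | h | h <;> simp [h, hne, hne.1.symm, hne.2.1.symm, hne.2.2.symm]
  have hdiff : ((entries N).count b : ℤ) - (entries N).count a = k := by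
    have hsum : ∑ i, ∑ j, deviation q r N i j = k := by simp [hrow]
    rw [hcount, hcount, ← hsum, ← Fintype.sum_prod_type']
    push_cast
    rw [← Finset.sum_sub_distrib]
    refine Finset.sum_congr rfl fun p _ => ?_
    have := hnear p.1 p.2
    unfold deviation
    rcases hr with rfl | rfl <;> split_ifs <;> omega
  ext x
  simp only [Multiset.count_add, Multiset.count_replicate]
  by_cases hxa : a = x
  · subst hxa
    simp [h_a, hne.1.symm, hne.2.1.symm]
  by_cases hxq : q = x
  · subst hxq
    simp only [hne.1, hne.2.2.symm, if_true, if_false]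
    omega
  by_cases hxb : b = x
  · subst hxb
    simp only [hne.2.1, hne.2.2, if_true, if_false]
    omega
  · rw [hcount]
    simp only [hxa, hxq, hxb, if_false, add_zero]
    refine Finset.sum_eq_zero fun p _ => if_neg ?_
    rintro rfl
    rcases hval p.1 p.2 with h | h | h
    · exact hxa h.symm
    · exact hxq h.symm
    · exact hxb h.symm

lemma prod_factorial_eq_of_entries {N : Fin k → Fin k → ℕ} {q a b t : ℕ}
    (h : entries N = Multiset.replicate t a + Multiset.replicate (k ^ 2 - k - 2 * t) q +
      Multiset.replicate (k + t) b) :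
    ∏ i, ∏ j, (N i j).factorial = balancedValue k q a b t := by
  have h1 : ∏ i, ∏ j, (N i j).factorial = ((entries N).map Nat.factorial).prod := by
    rw [entries, Multiset.map_map, ← Fintype.prod_prod_type']
    rfl
  rw [h1, h, balancedValue]
  simp

lemma balancedValue_mul_pow {q a b t : ℕ} {r : ℤ} (hq : 0 < q) (hr : r = 1 ∨ r = -1)
    (ha : (a : ℤ) = q - r) (hb : (b : ℤ) = q + r) (ht : 2 * t + k ≤ k ^ 2) :
    balancedValue k q a b t * q ^ (if r = 1 then t else k + t) =
      q.factorial ^ k ^ 2 * (q + 1) ^ (if r = 1 then k + t else t) := by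
  obtain ⟨m, hm⟩ := Nat.exists_eq_add_of_le ht
  have hm' : k ^ 2 - k - 2 * t = m := by omega
  rw [balancedValue, hm', hm]
  have hpred : (q - 1).factorial * q = q.factorial := by
    rw [mul_comm]; exact Nat.mul_factorial_pred hq.ne'
  rcases hr with rfl | rfl
  · obtain rfl : a = q - 1 := by omega
    obtain rfl : b = q + 1 := by omega
    simp only [if_true, Nat.factorial_succ, ← hpred]
    generalize q + 1 = Q
    ring
  · obtain rfl : a = q + 1 := by omega
    obtain rfl : b = q - 1 := by omega
    simp only [show ¬((-1 : ℤ) = 1) by decide, if_false, Nat.factorial_succ, ← hpred]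
    generalize q + 1 = Q
    ring

/-- Comparison of the product of factorials with the balanced value for any `c`. -/
lemma balancedValue_mul_le {q a b c : ℕ} {r : ℤ} (hq : 0 < q) (hr : r = 1 ∨ r = -1)
    (ha : (a : ℤ) = q - r) (hb : (b : ℤ) = q + r) (hc : 2 * c + k ≤ k ^ 2)
    {N : Fin k → Fin k → ℕ} (hrow : ∀ i, ∑ j, deviation q r N i j = 1) :
    balancedValue k q a b c * (q + 1) ^ negTotal (deviation q r N) * q ^ c ≤
      (∏ i, ∏ j, (N i j).factorial) * q ^ negTotal (deviation q r N) * (q + 1) ^ c ∧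
    (balancedValue k q a b c * (q + 1) ^ negTotal (deviation q r N) * q ^ c =
      (∏ i, ∏ j, (N i j).factorial) * q ^ negTotal (deviation q r N) * (q + 1) ^ c →
      ∀ i j, N i j ≤ q + 1 ∧ q ≤ N i j + 1) := by
  have hsum : ∑ i, ∑ j, deviation q r N i j = k := by simp [hrow]
  have hPM : ((∑ i, ∑ j, (N i j - q) : ℕ) : ℤ) - ((∑ i, ∑ j, (q - N i j) : ℕ) : ℤ) = r * k := by
    rw [← hsum, Finset.mul_sum]
    push_cast
    rw [← Finset.sum_sub_distrib]
    refine Finset.sum_congr rfl fun i _ => ?_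
    rw [← Finset.sum_sub_distrib, Finset.mul_sum]
    refine Finset.sum_congr rfl fun j _ => ?_
    unfold deviation
    rcases hr with rfl | rfl <;> omega
  have hP : ∑ i, ∑ j, (N i j - q) = if r = 1 then k + negTotal (deviation q r N)
      else negTotal (deviation q r N) := by
    have ht : negTotal (deviation q r N) =
        if r = 1 then ∑ i, ∑ j, (q - N i j) else ∑ i, ∑ j, (N i j - q) := by
      unfold negTotal deviation
      rcases hr with rfl | rfl
      · rw [if_pos rfl]
        exact Finset.sum_congr rfl fun i _ => Finset.sum_congr rfl fun j _ => by omega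
      · rw [if_neg (by decide)]
        exact Finset.sum_congr rfl fun i _ => Finset.sum_congr rfl fun j _ => by omega
    rcases hr with rfl | rfl
    · rw [if_pos rfl] at ht ⊢
      omega
    · rw [if_neg (by decide)] at ht ⊢
      exact ht.symm
  have hM : ∑ i, ∑ j, (q - N i j) = if r = 1 then negTotal (deviation q r N)
      else k + negTotal (deviation q r N) := by
    rcases hr with rfl | rfl
    · rw [if_pos rfl] at hP ⊢
      omega
    · rw [if_neg (by decide)] at hP ⊢
      omega
  have hle := prod_factorial_bound N q
  have heq := near_of_prod_factorial_eq (N := N) hq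
  have hV := balancedValue_mul_pow hq hr ha hb hc
  rw [hP, hM] at hle heq
  generalize negTotal (deviation q r N) = t at *
  generalize ∏ i, ∏ j, (N i j).factorial = F at *
  generalize balancedValue k q a b c = V at *
  have hl : V * (q + 1) ^ t * q ^ c * q ^ (if r = 1 then c else k + c) =
      q.factorial ^ k ^ 2 * (q + 1) ^ (if r = 1 then k + t else t) * ((q + 1) ^ c * q ^ c) := by
    calc _ = (V * q ^ (if r = 1 then c else k + c)) * (q + 1) ^ t * q ^ c := by ring
      _ = _ := by rw [hV]; split_ifs <;> ring
  have hr' : F * q ^ t * (q + 1) ^ c * q ^ (if r = 1 then c else k + c) =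
      F * q ^ (if r = 1 then t else k + t) * ((q + 1) ^ c * q ^ c) := by
    split_ifs <;> ring
  have hpos : 0 < q ^ (if r = 1 then c else k + c) := pow_pos hq _
  have hpos' : 0 < (q + 1) ^ c * q ^ c := by positivity
  refine ⟨Nat.le_of_mul_le_mul_right (c := q ^ (if r = 1 then c else k + c)) ?_ hpos,
    fun he => heq (Nat.eq_of_mul_eq_mul_right hpos' ?_)⟩
  · rw [hl, hr']
    exact Nat.mul_le_mul_right _ hle
  · rw [← hl, ← hr', he]

end Weights

section Construction

/-- An asymmetric pattern: on the first `t` rows and columns a directed cycle with one chord, with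
`-1` on the diagonal, completed to row and column sums `1` by unit rows and columns. -/
def asymmetricPattern (t i j : ℕ) : ℤ :=
  if i < t then
    if j < t then
      if i = j then -1
      else if j = i + 1 ∨ (i + 1 = t ∧ j = 0) ∨ (i = 0 ∧ j + 1 = t) then 1 else 0
    else if j + 1 = t + i then 1 else 0
  else if j < t then if i = t + j ∧ j + 1 < t then 1 else 0
  else if i = j ∧ i + 1 = 2 * t then 1 else 0

variable {t : ℕ}

lemma asymmetricPattern_eq_neg_one {i j : ℕ} :
    asymmetricPattern t i j = -1 ↔ i = j ∧ i < t := by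
  unfold asymmetricPattern
  split_ifs <;> simp <;> omega

lemma asymmetricPattern_mem (i j : ℕ) :
    asymmetricPattern t i j = -1 ∨ asymmetricPattern t i j = 0 ∨ asymmetricPattern t i j = 1 := by
  unfold asymmetricPattern
  split_ifs <;> simp

lemma asymmetricPattern_block (ht : 3 ≤ t) {i j : ℕ} (hi : i < t) (hj : j < t) :
    asymmetricPattern t i j = 1 ↔ j = i + 1 ∨ (i + 1 = t ∧ j = 0) ∨ (i = 0 ∧ j + 1 = t) := by
  unfold asymmetricPattern
  rw [if_pos hi, if_pos hj]
  split_ifs <;> simp <;> omega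

lemma asymmetricPattern_lower {i j : ℕ} (hi : t ≤ i) (hj : j < t) :
    asymmetricPattern t i j = 1 ↔ i = t + j ∧ j + 1 < t := by
  unfold asymmetricPattern
  rw [if_neg (by omega), if_pos hj]
  split_ifs <;> simp <;> omega

lemma asymmetricPattern_upper {i j : ℕ} (hi : i < t) (hj : t ≤ j) :
    asymmetricPattern t i j = 1 ↔ j + 1 = t + i := by
  unfold asymmetricPattern
  rw [if_pos hi, if_neg (by omega)]
  split_ifs <;> simp <;> omega

lemma sum_fin_ite_val_eq {k c : ℕ} (hc : c < k) :
    ∑ j : Fin k, (if (j : ℕ) = c then (1 : ℤ) else 0) = 1 := by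
  rw [Finset.sum_eq_single (⟨c, hc⟩ : Fin k)]
  · simp
  · intro b _ hb
    exact if_neg fun h => hb (Fin.ext h)
  · simp

variable {k : ℕ}

lemma sum_asymmetricPattern_row (ht : 3 ≤ t) (hk : k = 2 * t ∨ k + 1 = 2 * t) (i : Fin k) :
    ∑ j : Fin k, asymmetricPattern t i j = 1 := by
  have hi := i.2
  by_cases h : (i : ℕ) < t
  · have : ∀ j : Fin k, asymmetricPattern t i j =
        (if (j : ℕ) = (if (i : ℕ) + 1 = t then 0 else (i : ℕ) + 1) then 1 else 0) +
        (if (j : ℕ) = (if (i : ℕ) = 0 then t - 1 else t + (i : ℕ) - 1) then 1 else 0) -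
        (if (j : ℕ) = i then 1 else 0) := by
      intro j
      have hj := j.2
      unfold asymmetricPattern
      rw [if_pos h]
      split_ifs <;> omega
    simp only [this, Finset.sum_sub_distrib, Finset.sum_add_distrib]
    rw [sum_fin_ite_val_eq (by split_ifs <;> omega), sum_fin_ite_val_eq (by split_ifs <;> omega),
      sum_fin_ite_val_eq (by omega)]
    norm_num
  · have : ∀ j : Fin k, asymmetricPattern t i j =
        if (j : ℕ) = (if (i : ℕ) + 1 = 2 * t then (i : ℕ) else i - t) then 1 else 0 := by
      intro j
      have hj := j.2
      unfold asymmetricPattern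
      rw [if_neg h]
      split_ifs <;> omega
    simp only [this]
    exact sum_fin_ite_val_eq (by split_ifs <;> omega)

lemma sum_asymmetricPattern_col (ht : 3 ≤ t) (hk : k = 2 * t ∨ k + 1 = 2 * t) (j : Fin k) :
    ∑ i : Fin k, asymmetricPattern t i j = 1 := by
  have hj := j.2
  by_cases h : (j : ℕ) < t
  · have : ∀ i : Fin k, asymmetricPattern t i j =
        (if (i : ℕ) = (if (j : ℕ) = 0 then t - 1 else (j : ℕ) - 1) then 1 else 0) +
        (if (i : ℕ) = (if (j : ℕ) + 1 = t then 0 else t + (j : ℕ)) then 1 else 0) -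
        (if (i : ℕ) = j then 1 else 0) := by
      intro i
      have hi := i.2
      unfold asymmetricPattern
      simp only [h, if_true]
      split_ifs <;> omega
    simp only [this, Finset.sum_sub_distrib, Finset.sum_add_distrib]
    rw [sum_fin_ite_val_eq (by split_ifs <;> omega), sum_fin_ite_val_eq (by split_ifs <;> omega),
      sum_fin_ite_val_eq (by omega)]
    norm_num
  · have : ∀ i : Fin k, asymmetricPattern t i j =
        if (i : ℕ) = (if (j : ℕ) + 1 = 2 * t then (j : ℕ) else j + 1 - t) then 1 else 0 := by
      intro i
      have hi := i.2
      unfold asymmetricPattern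
      simp only [h, if_false]
      split_ifs <;> omega
    simp only [this]
    exact sum_fin_ite_val_eq (by split_ifs <;> omega)

lemma negTotal_asymmetricPattern (ht : t ≤ k) :
    negTotal (fun i j : Fin k => asymmetricPattern t i j) = t := by
  have h : ∀ i j : Fin k, (-asymmetricPattern t i j).toNat =
      if j = i then (if (i : ℕ) < t then 1 else 0) else 0 := by
    intro i j
    have h1 := @asymmetricPattern_eq_neg_one t i j
    rw [← Fin.ext_iff, eq_comm (a := i)] at h1
    rcases asymmetricPattern_mem (t := t) i j with h2 | h2 | h2 <;> rw [h2] at h1 ⊢ <;>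
      split_ifs <;> simp_all
  simp only [negTotal, h, Finset.sum_ite_eq', Finset.mem_univ, if_true]
  rw [Fin.sum_univ_eq_sum_range (fun i => if i < t then 1 else 0), ← Finset.card_filter]
  have : (Finset.range k).filter (· < t) = Finset.range t := by
    ext x; simp; omega
  rw [this, Finset.card_range]

lemma card_matrixStab_asymmetricPattern (ht : 3 ≤ t) (hk : k = 2 * t ∨ k + 1 = 2 * t) :
    Nat.card (MatrixStab fun i j : Fin k => asymmetricPattern t i j) = 1 := by
  rw [Nat.card_eq_one_iff_unique]
  refine ⟨⟨?_⟩, ⟨⟨1, fun _ _ => rfl⟩⟩⟩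
  suffices h : ∀ x : MatrixStab fun i j : Fin k => asymmetricPattern t i j,
      x = ⟨1, fun _ _ => rfl⟩ from fun x y => (h x).trans (h y).symm
  rintro ⟨⟨σ, τ⟩, hst⟩
  dsimp only at hst
  have hdiag : ∀ i : Fin k, (i : ℕ) < t → ((σ i : Fin k) : ℕ) = τ i ∧ ((σ i : Fin k) : ℕ) < t := by
    intro i hi
    rw [← asymmetricPattern_eq_neg_one, hst, asymmetricPattern_eq_neg_one]
    exact ⟨rfl, hi⟩
  have hτlt : ∀ i : Fin k, (i : ℕ) < t → ((τ i : Fin k) : ℕ) < t := fun i hi => by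
    have := hdiag i hi; omega
  have hσge : ∀ i : Fin k, t ≤ (i : ℕ) → t ≤ ((σ i : Fin k) : ℕ) := by
    intro i hi
    by_contra! h
    have h1 := hst i (τ.symm (σ i))
    rw [Equiv.apply_symm_apply, asymmetricPattern_eq_neg_one.2 ⟨rfl, h⟩] at h1
    have := asymmetricPattern_eq_neg_one.1 h1.symm
    omega
  have hτge : ∀ j : Fin k, t ≤ (j : ℕ) → t ≤ ((τ j : Fin k) : ℕ) := by
    intro j hj
    by_contra! h
    have h1 := hst (σ.symm (τ j)) j
    rw [Equiv.apply_symm_apply, asymmetricPattern_eq_neg_one.2 ⟨rfl, h⟩] at h1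
    have := asymmetricPattern_eq_neg_one.1 h1.symm
    omega
  have hblock : ∀ i j : Fin k, (i : ℕ) < t → (j : ℕ) < t →
      ((j : ℕ) = i + 1 ∨ ((i : ℕ) + 1 = t ∧ (j : ℕ) = 0) ∨ ((i : ℕ) = 0 ∧ (j : ℕ) + 1 = t)) →
      ((τ j : ℕ) = σ i + 1 ∨ ((σ i : ℕ) + 1 = t ∧ (τ j : ℕ) = 0) ∨
        ((σ i : ℕ) = 0 ∧ (τ j : ℕ) + 1 = t)) := by
    intro i j hi hj h
    rw [← asymmetricPattern_block ht (hdiag i hi).2 (hτlt j hj), hst]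
    exact (asymmetricPattern_block ht hi hj).2 h
  have hτne : ∀ i j : Fin k, (i : ℕ) ≠ j → ((τ i : Fin k) : ℕ) ≠ τ j := fun i j h e =>
    h (congrArg Fin.val (τ.injective (Fin.ext e)))
  -- the two ends of the chord and the successor of its source are fixed
  let v0 : Fin k := ⟨0, by omega⟩
  let v1 : Fin k := ⟨1, by omega⟩
  let vl : Fin k := ⟨t - 1, by omega⟩
  let vp : Fin k := ⟨t - 2, by omega⟩
  have l0 : (v0 : ℕ) = 0 := rfl
  have l1 : (v1 : ℕ) = 1 := rfl
  have ll : (vl : ℕ) = t - 1 := rfl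
  have lp : (vp : ℕ) = t - 2 := rfl
  have b1 := hblock v0 v1 (by omega) (by omega) (by omega)
  have b2 := hblock v0 vl (by omega) (by omega) (by omega)
  have b3 := hblock vp vl (by omega) (by omega) (by omega)
  have n1 := hτne v1 vl (by omega)
  have n2 := hτne v0 vp (by omega)
  have d0 := hdiag v0 (by omega)
  have dp := hdiag vp (by omega)
  have c1 := hτlt v1 (by omega)
  have cl := hτlt vl (by omega)
  have hσ0 : (σ v0 : ℕ) = 0 := by omega
  have hτ1 : (τ v1 : ℕ) = 1 := by omega
  have hτfix : ∀ m (hm : m < t), (τ ⟨m, by omega⟩ : ℕ) = m := by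
    intro m
    induction m with
    | zero =>
      intro hm
      change (τ v0 : ℕ) = 0
      omega
    | succ m ih =>
      intro hm
      by_cases hm0 : m = 0
      · subst hm0
        exact hτ1
      · have h1 := ih (by omega)
        have h2 := hdiag ⟨m, by omega⟩ (show m < t by omega)
        have h3 := hblock ⟨m, by omega⟩ ⟨m + 1, by omega⟩ (show m < t by omega)
          (show m + 1 < t by omega) (Or.inl rfl)
        omega
  have hσfix : ∀ i : Fin k, (i : ℕ) + 1 < 2 * t → σ i = i := by
    intro i hi
    by_cases h : (i : ℕ) < t
    · have h1 := hdiag i h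
      have h2 : (τ i : ℕ) = i := hτfix i h
      exact Fin.ext (by omega)
    · have h0 : (i : ℕ) - t < t := by omega
      have h1 := hst i ⟨i - t, by omega⟩
      rw [(asymmetricPattern_lower (t := t) (i := i) (j := i - t) (by omega) h0).2 (by omega),
        asymmetricPattern_lower (hσge i (by omega)) (hτlt _ h0), hτfix _ h0] at h1
      exact Fin.ext (by omega)
  have hτfix' : ∀ j : Fin k, (j : ℕ) + 1 < 2 * t → τ j = j := by
    intro j hj
    by_cases h : (j : ℕ) < t
    · exact Fin.ext (hτfix j h)
    · have h0 : (j : ℕ) + 1 - t < t := by omega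
      have h1 := hst ⟨j + 1 - t, by omega⟩ j
      have h2 := hσfix ⟨j + 1 - t, by omega⟩ (show (j : ℕ) + 1 - t + 1 < 2 * t by omega)
      rw [h2, (asymmetricPattern_upper (t := t) (i := j + 1 - t) (j := j) h0 (by omega)).2
        (by omega), asymmetricPattern_upper h0 (hτge j (by omega))] at h1
      exact Fin.ext (by omega)
  have hlast : ∀ π : Equiv.Perm (Fin k), (∀ i : Fin k, (i : ℕ) + 1 < 2 * t → π i = i) → π = 1 := by
    intro π hπ
    ext1 i
    by_cases h : (i : ℕ) + 1 < 2 * t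
    · exact hπ i h
    · by_contra hne
      have h2 : (π i : ℕ) ≠ i := fun e => hne (Fin.ext e)
      exact hne (π.injective (hπ (π i) (by omega)))
  exact Subtype.ext (Prod.ext (hlast σ hσfix) (hlast τ hτfix'))

/-- The matrix realizing the asymmetric pattern as its deviation from `q`. -/
def asymmetricMatrix (k q : ℕ) (r : ℤ) (i j : Fin k) : ℕ :=
  (q + r * asymmetricPattern ((k + 1) / 2) i j).toNat

lemma deviation_asymmetricMatrix {q : ℕ} {r : ℤ} (hq : 0 < q) (hr : r = 1 ∨ r = -1) :
    deviation q r (asymmetricMatrix k q r) =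
      fun i j : Fin k => asymmetricPattern ((k + 1) / 2) i j := by
  funext i j
  unfold deviation asymmetricMatrix
  rcases asymmetricPattern_mem (t := (k + 1) / 2) i j with h | h | h <;> rw [h] <;>
    rcases hr with rfl | rfl <;> omega

lemma isInterMatrix_asymmetricMatrix {l q : ℕ} {r : ℤ} (hk : 7 ≤ k) (hq : 0 < q)
    (hr : r = 1 ∨ r = -1) (hlq : (l : ℤ) = q * k + r) :
    IsInterMatrix k l (asymmetricMatrix k q r) := by
  have hcast : ∀ i j : Fin k, (asymmetricMatrix k q r i j : ℤ) =
      q + r * asymmetricPattern ((k + 1) / 2) i j := by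
    intro i j
    refine Int.toNat_of_nonneg ?_
    rcases asymmetricPattern_mem (t := (k + 1) / 2) i j with h | h | h <;> rw [h] <;>
      rcases hr with rfl | rfl <;> omega
  constructor
  · intro i
    zify
    simp only [hcast, Finset.sum_add_distrib, ← Finset.mul_sum,
      sum_asymmetricPattern_row (t := (k + 1) / 2) (by omega) (by omega) i, hlq]
    simp [mul_comm]
  · intro j
    zify
    simp only [hcast, Finset.sum_add_distrib, ← Finset.mul_sum,
      sum_asymmetricPattern_col (t := (k + 1) / 2) (by omega) (by omega) j, hlq]
    simp [mul_comm]

lemma autCard_asymmetricMatrix {q a b : ℕ} {r : ℤ} (hk : 7 ≤ k) (hq : 0 < q)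
    (hr : r = 1 ∨ r = -1) (ha : (a : ℤ) = q - r) (hb : (b : ℤ) = q + r) :
    autCard (asymmetricMatrix k q r) = balancedValue k q a b ((k + 1) / 2) := by
  have hnear : ∀ i j : Fin k, asymmetricMatrix k q r i j ≤ q + 1 ∧
      q ≤ asymmetricMatrix k q r i j + 1 := by
    intro i j
    unfold asymmetricMatrix
    rcases asymmetricPattern_mem (t := (k + 1) / 2) i j with h | h | h <;> rw [h] <;>
      rcases hr with rfl | rfl <;> omega
  have hent := entries_eq_of_near hr ha hb (fun i => by
    rw [deviation_asymmetricMatrix hq hr]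
    exact sum_asymmetricPattern_row (t := (k + 1) / 2) (by omega) (by omega) i) hnear
  rw [deviation_asymmetricMatrix hq hr, negTotal_asymmetricPattern (by omega)] at hent
  rw [autCard, prod_factorial_eq_of_entries hent, stabCard_eq_card_matrixStab q hr,
    deviation_asymmetricMatrix hq hr,
    card_matrixStab_asymmetricPattern (by omega) (by omega), one_mul]

end Construction

section LowerBound

variable {k : ℕ}

/-- The lower bound for the automorphism count together with the equality cases. -/
lemma balancedValue_le_autCard {l q a b : ℕ} {r : ℤ} (hk : 7 ≤ k) (hq : 0 < q)
    (hr : r = 1 ∨ r = -1) (hlq : (l : ℤ) = q * k + r) (ha : (a : ℤ) = q - r)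
    (hb : (b : ℤ) = q + r) {N : Fin k → Fin k → ℕ} (hN : IsInterMatrix k l N) :
    balancedValue k q a b ((k + 1) / 2) ≤ autCard N ∧
    (autCard N = balancedValue k q a b ((k + 1) / 2) →
      (∀ i j, N i j ≤ q + 1 ∧ q ≤ N i j + 1) ∧
      (stabCard N = 1 ∧ negTotal (deviation q r N) = (k + 1) / 2 ∨
        q = 1 ∧ stabCard N = 2 ∧ negTotal (deviation q r N) + 1 = (k + 1) / 2)) := by
  have hrow := sum_deviation_row hr hlq hN
  have hcol := sum_deviation_col hr hlq hN
  have hc : 2 * ((k + 1) / 2) + k ≤ k ^ 2 := by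
    have : 7 * k ≤ k ^ 2 := by nlinarith
    omega
  obtain ⟨hle, heq⟩ := balancedValue_mul_le hq hr ha hb hc hrow
  have hS := stabCard_eq_card_matrixStab q hr N
  have hS1 : 0 < stabCard N := by
    have : Nonempty (MatrixStab (deviation q r N)) := ⟨⟨1, fun _ _ => rfl⟩⟩
    rw [hS]
    exact Nat.card_pos
  have hgap1 : negTotal (deviation q r N) + 1 = (k + 1) / 2 → 2 ≤ stabCard N := fun h => by
    rw [hS]
    exact two_le_card_of_add_one hrow hcol (by omega) (by rwa [Fintype.card_fin])
  have hgap2 : negTotal (deviation q r N) + 2 ≤ (k + 1) / 2 →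
      2 ^ ((k + 1) / 2 - negTotal (deviation q r N)) < stabCard N := fun h => by
    rw [hS]
    have := two_pow_lt_card_of_add_two_le hrow hcol (by rwa [Fintype.card_fin])
    rwa [Fintype.card_fin] at this
  have hF : 0 < ∏ i, ∏ j, (N i j).factorial :=
    Finset.prod_pos fun i _ => Finset.prod_pos fun j _ => Nat.factorial_pos _
  rw [autCard]
  generalize negTotal (deviation q r N) = t at *
  generalize ∏ i, ∏ j, (N i j).factorial = F at *
  generalize balancedValue k q a b ((k + 1) / 2) = V at *
  generalize stabCard N = K at *
  generalize (k + 1) / 2 = c at *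
  rcases le_or_gt c t with hct | hct
  · obtain ⟨m, rfl⟩ := Nat.exists_eq_add_of_le hct
    have hpos : 0 < q ^ c * (q + 1) ^ c := by positivity
    have hle' : V * (q + 1) ^ m ≤ F * q ^ m := by
      refine Nat.le_of_mul_le_mul_right (c := q ^ c * (q + 1) ^ c) ?_ hpos
      convert hle using 1 <;> ring
    have hqm : q ^ m ≤ (q + 1) ^ m := Nat.pow_le_pow_left (Nat.le_succ q) m
    have hVF : V ≤ F := Nat.le_of_mul_le_mul_right
      (hle'.trans (Nat.mul_le_mul_left F hqm)) (by positivity)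
    have hFK : F ≤ K * F := Nat.le_mul_of_pos_left F hS1
    refine ⟨hVF.trans hFK, fun he => ?_⟩
    have hVF' : V = F := by omega
    have hK : K = 1 := Nat.eq_of_mul_eq_mul_right hF (by omega)
    have hm : m = 0 := by
      by_contra hm
      have h1 : q ^ m < (q + 1) ^ m := Nat.pow_lt_pow_left (Nat.lt_succ_self q) hm
      rw [hVF'] at hle'
      exact absurd (Nat.le_of_mul_le_mul_left hle' hF) (by omega)
    subst hm
    exact ⟨heq (by rw [hVF', add_zero]; ring), Or.inl ⟨hK, rfl⟩⟩
  · obtain ⟨m, rfl⟩ := Nat.exists_eq_add_of_le hct.le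
    have hpos : 0 < q ^ t * (q + 1) ^ t := by positivity
    have hle' : V * q ^ m ≤ F * (q + 1) ^ m := by
      refine Nat.le_of_mul_le_mul_right (c := q ^ t * (q + 1) ^ t) ?_ hpos
      convert hle using 1 <;> ring
    have hK : 2 ^ m ≤ K := by
      by_cases hm : m = 1
      · subst hm
        exact hgap1 rfl
      · have := hgap2 (by omega)
        rw [Nat.add_sub_cancel_left] at this
        exact this.le
    have hqm : (q + 1) ^ m ≤ 2 ^ m * q ^ m := by
      rw [← mul_pow]
      exact Nat.pow_le_pow_left (by omega) m
    have hqpos : 0 < q ^ m := by positivity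
    have h1 : F * (q + 1) ^ m ≤ F * (2 ^ m * q ^ m) := Nat.mul_le_mul_left F hqm
    have h2 : F * (2 ^ m * q ^ m) ≤ K * F * q ^ m := by
      rw [← mul_assoc, mul_comm F]
      exact Nat.mul_le_mul_right _ (Nat.mul_le_mul_right _ hK)
    refine ⟨Nat.le_of_mul_le_mul_right (hle'.trans (h1.trans h2)) hqpos, fun he => ?_⟩
    rw [he] at h2
    have e1 : V * q ^ m = F * (q + 1) ^ m := le_antisymm hle' (h1.trans h2)
    have e2 : (q + 1) ^ m = 2 ^ m * q ^ m :=
      Nat.eq_of_mul_eq_mul_left hF (le_antisymm h1 (h2.trans hle'))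
    have e3 : K = 2 ^ m := by
      refine Nat.eq_of_mul_eq_mul_right hF (Nat.eq_of_mul_eq_mul_right hqpos ?_)
      rw [he, e1, e2]
      ring
    have hm : m = 1 := by
      by_contra hm
      have := hgap2 (by omega)
      rw [Nat.add_sub_cancel_left] at this
      omega
    subst hm
    rw [pow_one, pow_one, pow_one] at e2
    refine ⟨heq ?_, Or.inr ⟨by omega, by simpa using e3, rfl⟩⟩
    calc V * (q + 1) ^ t * q ^ (t + 1) = V * q ^ 1 * ((q + 1) ^ t * q ^ t) := by ring
      _ = F * q ^ t * (q + 1) ^ (t + 1) := by rw [e1]; ring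

end LowerBound

/-- χ(k,l) for l = qk + r with r = ±1, k ≥ 7, together with the structure of the minimising
matrices.  Here `a = q − r` and `b = q + r` as natural numbers, and `(k+1)/2 = ⌈k/2⌉`. -/
theorem chi_pm_one (k l q : ℕ) (r : ℤ) (hk : 7 ≤ k) (hl : 2 < l)
    (hr : r = 1 ∨ r = -1) (hlq : (l : ℤ) = q * k + r)
    (a b : ℕ) (ha : (a : ℤ) = q - r) (hb : (b : ℤ) = q + r) :
    IsLeast {m | ∃ N : Fin k → Fin k → ℕ, IsInterMatrix k l N ∧ m = autCard N}
      (a.factorial ^ ((k + 1) / 2) * q.factorial ^ (k ^ 2 - k - 2 * ((k + 1) / 2)) *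
        b.factorial ^ (k + (k + 1) / 2)) ∧
    ∀ N : Fin k → Fin k → ℕ, IsInterMatrix k l N →
      autCard N = a.factorial ^ ((k + 1) / 2) * q.factorial ^ (k ^ 2 - k - 2 * ((k + 1) / 2)) *
          b.factorial ^ (k + (k + 1) / 2) →
      (stabCard N = 1 ∧
        entries N = Multiset.replicate ((k + 1) / 2) a +
          Multiset.replicate (k ^ 2 - k - 2 * ((k + 1) / 2)) q +
          Multiset.replicate (k + (k + 1) / 2) b) ∨
      (q = 1 ∧ stabCard N = 2 ∧
        entries N = Multiset.replicate ((k + 1) / 2 - 1) a +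
          Multiset.replicate (k ^ 2 - k - 2 * ((k + 1) / 2) + 2) 1 +
          Multiset.replicate (k + (k + 1) / 2 - 1) b) := by
  have hq : 0 < q := by
    rcases Nat.eq_zero_or_pos q with rfl | h
    · rw [Nat.cast_zero, zero_mul, zero_add] at hlq
      omega
    · exact h
  refine ⟨⟨⟨asymmetricMatrix k q r, isInterMatrix_asymmetricMatrix hk hq hr hlq,
    (autCard_asymmetricMatrix hk hq hr ha hb).symm⟩, ?_⟩, fun N hN he => ?_⟩
  · rintro m ⟨N, hN, rfl⟩
    exact (balancedValue_le_autCard hk hq hr hlq ha hb hN).1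
  · obtain ⟨hnear, hcase⟩ := (balancedValue_le_autCard hk hq hr hlq ha hb hN).2 he
    have hent := entries_eq_of_near hr ha hb (sum_deviation_row hr hlq hN) hnear
    rcases hcase with ⟨hS, ht⟩ | ⟨hq1, hS, ht⟩
    · left
      rw [ht] at hent
      exact ⟨hS, hent⟩
    · right
      refine ⟨hq1, hS, ?_⟩
      have hk2 : 7 * k ≤ k ^ 2 := by nlinarith
      have ht' : negTotal (deviation q r N) = (k + 1) / 2 - 1 := by omega
      rw [ht', hq1] at hent
      rw [hent]
      congr 3 <;> omega
end

section
/- Fix an integer k ≥ 2 and a real number ε > 0. For each positive integer l, let B(l) be the number of (k,l)-intersection matrices N such that |K_N| · ∏_{i,j} N_{i,j}! > (l!)^k / l^{(k−1)²−ε}, and let H_k(l) be the total number of (k,l)-intersection matrices. Then B(l)/H_k(l) → 0 as l → ∞. -/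
open Filter Finset

theorem IsInterMatrix.le {k l : ℕ} {N : Fin k → Fin k → ℕ} (h : IsInterMatrix k l N)
    (i j : Fin k) : N i j ≤ l :=
  (h.1 i) ▸ single_le_sum (f := N i) (fun _ _ => Nat.zero_le _) (mem_univ j)

/-- Binomial coefficients away from the two ends of a row dominate those at distance `m` from
the ends. -/
theorem Nat.choose_le_choose_of_add_le {l m n : ℕ} (hm : m ≤ n) (hn : n + m ≤ l) :
    l.choose m ≤ l.choose n := by
  have h1 : l.choose n * n.choose m = l.choose m * (l - m).choose (n - m) :=
    Nat.choose_mul hm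
  have h2 : n.choose m ≤ (l - m).choose (n - m) := by
    rw [← Nat.choose_symm hm]
    exact Nat.choose_le_choose _ (by omega)
  refine Nat.le_of_mul_le_mul_right ?_ (Nat.choose_pos hm)
  rw [h1]
  exact Nat.mul_le_mul_left _ h2

theorem Nat.pow_le_pow_mul_choose {l m : ℕ} (hm : 0 < m) (hl : m ≤ l) :
    l ^ m ≤ m ^ m * m.factorial * l.choose m := by
  have hle : l ≤ m * (l + 1 - m) := by
    obtain ⟨d, rfl⟩ := Nat.exists_eq_add_of_le hl
    rw [show m + d + 1 - m = d + 1 by omega]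
    nlinarith
  calc l ^ m ≤ (m * (l + 1 - m)) ^ m := Nat.pow_le_pow_left hle m
    _ = m ^ m * (l + 1 - m) ^ m := mul_pow _ _ _
    _ ≤ m ^ m * l.descFactorial m := Nat.mul_le_mul_left _ (Nat.pow_sub_le_descFactorial l m)
    _ = _ := by rw [Nat.descFactorial_eq_factorial_mul_choose, mul_assoc]

theorem prod_factorial_le {ι : Type*} [Fintype ι] (f : ι → ℕ) :
    ∏ j, (f j).factorial ≤ (∑ j, f j).factorial :=
  Nat.le_of_dvd (Nat.factorial_pos _) (Nat.prod_factorial_dvd_factorial_sum _ _)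

theorem prod_factorial_mul_choose_le {ι : Type*} [Fintype ι] [DecidableEq ι] (f : ι → ℕ)
    (j : ι) :
    (∏ i, (f i).factorial) * (∑ i, f i).choose (f j) ≤ (∑ i, f i).factorial := by
  have hsum := add_sum_erase univ f (mem_univ j)
  have hprod := mul_prod_erase univ (fun i => (f i).factorial) (mem_univ j)
  have hle : ∏ i ∈ univ.erase j, (f i).factorial ≤ (∑ i ∈ univ.erase j, f i).factorial :=
    Nat.le_of_dvd (Nat.factorial_pos _) (Nat.prod_factorial_dvd_factorial_sum _ _)
  have hfac := Nat.choose_mul_factorial_mul_factorial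
    (Nat.le_add_right (f j) (∑ i ∈ univ.erase j, f i))
  rw [Nat.add_sub_cancel_left] at hfac
  rw [← hprod, ← hsum, ← hfac]
  calc _ = (f j + ∑ i ∈ univ.erase j, f i).choose (f j) * (f j).factorial *
        ∏ i ∈ univ.erase j, (f i).factorial := by ring
    _ ≤ _ := Nat.mul_le_mul_left _ hle

/-- An entry at distance at least `m` from both `0` and `l` makes the automorphism group small. -/
theorem IsInterMatrix.autCard_mul_choose_le {k l m : ℕ} {N : Fin k → Fin k → ℕ}
    (h : IsInterMatrix k l N) {i j : Fin k} (hm : m ≤ N i j) (hl : N i j + m ≤ l) :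
    autCard N * l.choose m ≤ k.factorial ^ 2 * l.factorial ^ k := by
  have hstab : stabCard N ≤ k.factorial ^ 2 := by
    refine (Nat.card_le_card_of_injective _ Subtype.val_injective).trans ?_
    simp [Nat.card_eq_fintype_card, Fintype.card_perm, sq]
  have hrow : (∏ j, (N i j).factorial) * l.choose m ≤ l.factorial := by
    refine (Nat.mul_le_mul_left _ (Nat.choose_le_choose_of_add_le hm hl)).trans ?_
    simpa only [h.1 i] using prod_factorial_mul_choose_le (N i) j
  have hrest : ∏ i ∈ univ.erase i, ∏ j, (N i j).factorial ≤ l.factorial ^ (k - 1) := by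
    refine (prod_le_pow_card _ _ l.factorial fun i' _ => ?_).trans ?_
    · simpa only [h.1 i'] using prod_factorial_le (N i')
    · simp
  have hprod := mul_prod_erase univ (fun i => ∏ j, (N i j).factorial) (mem_univ i)
  unfold autCard
  rw [mul_assoc]
  refine Nat.mul_le_mul hstab ?_
  rw [← hprod, ← mul_pow_sub_one i.pos.ne', mul_right_comm]
  exact Nat.mul_le_mul hrow hrest

/-- For large `l`, the entries of an intersection matrix with large automorphism group are all
within `k ^ 2` of `0` or `l`. -/
theorem IsInterMatrix.entry_near_ends {k l : ℕ} {N : Fin k → Fin k → ℕ} {ε : ℝ} (hk : 2 ≤ k)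
    (hε : 0 < ε) (h : IsInterMatrix k l N)
    (hl : (k ^ 2) ^ (k ^ 2) * (k ^ 2).factorial * k.factorial ^ 2 < l)
    (hN : (l.factorial : ℝ) ^ k / (l : ℝ) ^ (((k : ℝ) - 1) ^ 2 - ε) < (autCard N : ℝ))
    (i j : Fin k) : N i j < k ^ 2 ∨ l < N i j + k ^ 2 := by
  by_contra! hc
  have hl1 : (1 : ℝ) ≤ l := by exact_mod_cast (by omega : 1 ≤ l)
  have hl0 : (0 : ℝ) < l := by linarith
  have hk' : (2 : ℝ) ≤ k := by exact_mod_cast hk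
  have hk2 : 0 < k ^ 2 := by positivity
  set m := k ^ 2 with hmdef
  have hpow : (l : ℝ) ^ (((k : ℝ) - 1) ^ 2 - ε) ≤ (l : ℝ) ^ (m - 1) := by
    rw [← Real.rpow_natCast _ (m - 1)]
    refine Real.rpow_le_rpow_of_exponent_le hl1 ?_
    rw [Nat.cast_sub hk2, hmdef]
    push_cast
    nlinarith
  have haut : (l.factorial : ℝ) ^ k < autCard N * (l : ℝ) ^ (m - 1) := by
    rw [div_lt_iff₀ (Real.rpow_pos_of_pos hl0 _)] at hN
    exact hN.trans_le (mul_le_mul_of_nonneg_left hpow (Nat.cast_nonneg _))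
  have haut' : l.factorial ^ k < autCard N * l ^ (m - 1) := by exact_mod_cast haut
  have hml : m ≤ l := by omega
  have hch : 0 < l.choose m := Nat.choose_pos hml
  have hmain := h.autCard_mul_choose_le hc.1 hc.2
  have hlt : l.choose m < k.factorial ^ 2 * l ^ (m - 1) := by
    refine Nat.lt_of_mul_lt_mul_left (a := l.factorial ^ k) ?_
    calc l.factorial ^ k * l.choose m < autCard N * l ^ (m - 1) * l.choose m :=
          Nat.mul_lt_mul_of_pos_right haut' hch
      _ = autCard N * l.choose m * l ^ (m - 1) := by ring
      _ ≤ k.factorial ^ 2 * l.factorial ^ k * l ^ (m - 1) := Nat.mul_le_mul_right _ hmain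
      _ = _ := by ring
  have hdiv := Nat.pow_le_pow_mul_choose hk2 hml
  have : l * l ^ (m - 1) < l * l ^ (m - 1) := by
    calc l * l ^ (m - 1) = l ^ m := by rw [← pow_succ', Nat.sub_add_cancel hk2]
      _ ≤ m ^ m * m.factorial * l.choose m := hdiv
      _ ≤ m ^ m * m.factorial * (k.factorial ^ 2 * l ^ (m - 1)) := Nat.mul_le_mul_left _ hlt.le
      _ = m ^ m * m.factorial * k.factorial ^ 2 * l ^ (m - 1) := by ring
      _ < _ := Nat.mul_lt_mul_of_pos_right hl (pow_pos (by omega) _)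
  exact this.false

theorem finite_isInterMatrix (k l : ℕ) : {N | IsInterMatrix k l N}.Finite :=
  (Fintype.piFinset fun _ : Fin k => Fintype.piFinset fun _ : Fin k =>
    range (l + 1)).finite_toSet.subset fun N hN => by
      simpa [Fintype.mem_piFinset, Nat.lt_succ_iff] using IsInterMatrix.le hN

/-- `a` times the identity matrix plus `b` times the permutation matrix of `σ` is an
intersection matrix. -/
theorem isInterMatrix_add_perm {k : ℕ} (a b : ℕ) (σ : Equiv.Perm (Fin k)) :
    IsInterMatrix k (a + b)
      fun i j => (if i = j then a else 0) + if σ i = j then b else 0 := by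
  refine ⟨fun i => ?_, fun j => ?_⟩
  · simp [sum_add_distrib]
  · simp [sum_add_distrib, ← Equiv.eq_symm_apply]

theorem le_card_isInterMatrix {k : ℕ} (hk : 2 ≤ k) (l : ℕ) :
    l ≤ Nat.card {N : Fin k → Fin k → ℕ // IsInterMatrix k l N} := by
  have : Finite {N : Fin k → Fin k → ℕ // IsInterMatrix k l N} :=
    (finite_isInterMatrix k l).to_subtype
  let x : Fin k := ⟨0, by omega⟩
  let y : Fin k := ⟨1, by omega⟩
  have hxy : y ≠ x := by simp [x, y]
  let f (a : Fin l) : {N : Fin k → Fin k → ℕ // IsInterMatrix k l N} :=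
    ⟨_, Nat.add_sub_of_le a.2.le ▸ isInterMatrix_add_perm a (l - a) (Equiv.swap x y)⟩
  have hf : Function.Injective f := by
    intro a b hab
    have := congrFun (congrFun (congrArg Subtype.val hab) x) x
    simpa [f, hxy, Fin.ext_iff] using this
  simpa using Nat.card_le_card_of_injective f hf

theorem card_large_aut_le {k l : ℕ} {ε : ℝ} (hk : 2 ≤ k) (hε : 0 < ε)
    (hl : (k ^ 2) ^ (k ^ 2) * (k ^ 2).factorial * k.factorial ^ 2 < l) :
    Nat.card {N : Fin k → Fin k → ℕ // IsInterMatrix k l N ∧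
      (l.factorial : ℝ) ^ k / (l : ℝ) ^ (((k : ℝ) - 1) ^ 2 - ε) < (autCard N : ℝ)} ≤
    ((k ^ 2 + k ^ 2) ^ k) ^ k := by
  let S : Finset ℕ := range (k ^ 2) ∪ Ioc (l - k ^ 2) l
  have hS : #S ≤ k ^ 2 + k ^ 2 :=
    (card_union_le _ _).trans (by simp; omega)
  let T := Fintype.piFinset fun _ : Fin k => Fintype.piFinset fun _ : Fin k => S
  have hT : #T ≤ ((k ^ 2 + k ^ 2) ^ k) ^ k := by
    simp only [T, Fintype.card_piFinset_const]
    gcongr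
  refine le_trans ?_ hT
  rw [← Set.ncard_coe_finset]
  refine Set.ncard_le_ncard (fun N hN => ?_) T.finite_toSet
  simp only [T, S, mem_coe, Fintype.mem_piFinset, mem_union, mem_range, mem_Ioc]
  intro i j
  have h1 := hN.1.entry_near_ends hk hε hl hN.2 i j
  have h2 := hN.1.le i j
  have : k ^ 2 ≠ 0 := by positivity
  omega

/-- Almost all `(k,l)`-bipartite graphs satisfy `|Aut Γ| ≤ l!^k / l^{(k−1)²−ε}`:
the proportion of `(k,l)`-intersection matrices `N` with
`|K_N| · ∏ N_{i,j}! > l!^k / l^{(k−1)²−ε}` tends to `0` as `l → ∞`. -/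
theorem few_large_aut (k : ℕ) (hk : 2 ≤ k) (ε : ℝ) (hε : 0 < ε) :
    Filter.Tendsto (fun l : ℕ =>
      (Nat.card {N : Fin k → Fin k → ℕ // IsInterMatrix k l N ∧
          (l.factorial : ℝ) ^ k / (l : ℝ) ^ (((k : ℝ) - 1) ^ 2 - ε) < (autCard N : ℝ)} : ℝ) /
        (Nat.card {N : Fin k → Fin k → ℕ // IsInterMatrix k l N} : ℝ))
      Filter.atTop (nhds 0) := by
  refine squeeze_zero' (Eventually.of_forall fun l => by positivity) ?_
    (tendsto_const_div_atTop_nhds_zero_nat ((((k ^ 2 + k ^ 2) ^ k) ^ k : ℕ) : ℝ))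
  filter_upwards [eventually_gt_atTop ((k ^ 2) ^ (k ^ 2) * (k ^ 2).factorial * k.factorial ^ 2)] with l hl
  have hl0 : (0 : ℝ) < l := by exact_mod_cast (by omega : 0 < l)
  exact div_le_div₀ (Nat.cast_nonneg _) (Nat.cast_le.2 (card_large_aut_le hk hε hl)) hl0
    (Nat.cast_le.2 (le_card_isInterMatrix hk l))
end

section
/- For each positive integer l let H_k(l) be the number of (k,l)-intersection matrices. If k ≥ 3, then the proportion of (k,l)-intersection matrices N whose stabilizer K_N is nontrivial, i.e. #{N : K_N ≠ 1}/H_k(l), tends to 0 as l → ∞. If k = 2, then the proportion of (2,l)-intersection matrices N with |K_N| ≠ 2 tends to 0 as l → ∞. -/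
open Filter

/-- The set of `(k,l)`-intersection matrices satisfying `P`. -/
def interSet (k l : ℕ) (P : (Fin k → Fin k → ℕ) → Prop) : Set (Fin k → Fin k → ℕ) :=
  {N | IsInterMatrix k l N ∧ P N}

/-- The set of all `(k,l)`-intersection matrices. -/
def allInter (k l : ℕ) : Set (Fin k → Fin k → ℕ) :=
  {N | IsInterMatrix k l N}

/-- The proportion of `(k,l)`-intersection matrices satisfying `P` tends to `0`, phrased without
division. -/
def Negligible (k : ℕ) (P : (Fin k → Fin k → ℕ) → Prop) : Prop :=
  ∀ m : ℕ, ∀ᶠ l in atTop, (interSet k l P).ncard * m ≤ (allInter k l).ncard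

lemma allInter_finite (k l : ℕ) : (allInter k l).Finite := by
  refine (Set.finite_Iic (fun _ _ => l : Fin k → Fin k → ℕ)).subset fun N hN i j => ?_
  rw [← hN.1 i]
  exact Finset.single_le_sum (fun _ _ => Nat.zero_le _) (Finset.mem_univ j)

lemma interSet_subset (k l : ℕ) (P : (Fin k → Fin k → ℕ) → Prop) :
    interSet k l P ⊆ allInter k l := fun _ h => h.1

lemma interSet_finite (k l : ℕ) (P : (Fin k → Fin k → ℕ) → Prop) : (interSet k l P).Finite :=
  (allInter_finite k l).subset (interSet_subset k l P)

lemma allInter_ncard_pos (k l : ℕ) : 0 < (allInter k l).ncard := by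
  rw [Set.ncard_pos (allInter_finite k l)]
  exact ⟨fun i j => if i = j then l else 0, fun i => by simp, fun j => by simp⟩

lemma Negligible.mono {k : ℕ} {P Q : (Fin k → Fin k → ℕ) → Prop} (hQ : Negligible k Q)
    (h : ∀ l N, IsInterMatrix k l N → P N → Q N) : Negligible k P := by
  intro m
  filter_upwards [hQ m] with l hl
  refine le_trans (Nat.mul_le_mul_right m ?_) hl
  exact Set.ncard_le_ncard (fun N hN => ⟨hN.1, h l N hN.1 hN.2⟩) (interSet_finite k l Q)

lemma negligible_of_le_mul {k : ℕ} {P : (Fin k → Fin k → ℕ) → Prop} (C : ℕ)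
    (h : ∀ m : ℕ, ∀ᶠ l in atTop, (interSet k l P).ncard * m ≤ (allInter k l).ncard * C) :
    Negligible k P := by
  intro m
  rcases Nat.eq_zero_or_pos C with rfl | hC
  · filter_upwards [h 1] with l hl
    have : (interSet k l P).ncard = 0 := by simpa using hl
    simp [this]
  · filter_upwards [h (m * C)] with l hl
    exact Nat.le_of_mul_le_mul_right (by rwa [mul_assoc]) hC

lemma interSet_or_ncard_le (k l : ℕ) (P Q : (Fin k → Fin k → ℕ) → Prop) :
    (interSet k l fun N => P N ∨ Q N).ncard ≤ (interSet k l P).ncard + (interSet k l Q).ncard := by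
  refine le_trans (Set.ncard_le_ncard (fun N hN => ?_)
    ((interSet_finite k l P).union (interSet_finite k l Q))) (Set.ncard_union_le _ _)
  exact hN.2.imp (fun h => ⟨hN.1, h⟩) (fun h => ⟨hN.1, h⟩)

lemma Negligible.or {k : ℕ} {P Q : (Fin k → Fin k → ℕ) → Prop} (hP : Negligible k P)
    (hQ : Negligible k Q) : Negligible k fun N => P N ∨ Q N := by
  refine negligible_of_le_mul 2 fun m => ?_
  filter_upwards [hP m, hQ m] with l h₁ h₂
  have := Nat.mul_le_mul_right m (interSet_or_ncard_le k l P Q)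
  linarith

lemma Negligible.exists_finset {k : ℕ} {ι : Type*} (s : Finset ι)
    {P : ι → (Fin k → Fin k → ℕ) → Prop} (hP : ∀ x ∈ s, Negligible k (P x)) :
    Negligible k fun N => ∃ x ∈ s, P x N := by
  classical
  induction s using Finset.induction_on with
  | empty =>
    intro m
    refine Eventually.of_forall fun l => ?_
    simp [interSet]
  | insert a s _ ih =>
    simp only [Finset.exists_mem_insert]
    exact (hP a (Finset.mem_insert_self a s)).or
      (ih fun x hx => hP x (Finset.mem_insert_of_mem hx))

lemma Negligible.tendsto {k : ℕ} {P : (Fin k → Fin k → ℕ) → Prop} (hP : Negligible k P) :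
    Tendsto (fun l : ℕ => (Nat.card {N : Fin k → Fin k → ℕ // IsInterMatrix k l N ∧ P N} : ℝ) /
      (Nat.card {N : Fin k → Fin k → ℕ // IsInterMatrix k l N} : ℝ)) atTop (nhds 0) := by
  change Tendsto (fun l : ℕ => ((interSet k l P).ncard : ℝ) / ((allInter k l).ncard : ℝ))
    atTop (nhds 0)
  rw [Metric.tendsto_atTop']
  intro ε hε
  obtain ⟨m, hm⟩ := exists_nat_gt (1 / ε)
  obtain ⟨n, hn⟩ := eventually_atTop.1 (hP m)
  refine ⟨n, fun l hl => ?_⟩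
  have hH : (0 : ℝ) < (allInter k l).ncard := by exact_mod_cast allInter_ncard_pos k l
  have hb : ((interSet k l P).ncard : ℝ) * m ≤ (allInter k l).ncard := by
    exact_mod_cast hn l hl.le
  rw [Real.dist_eq, sub_zero, abs_of_nonneg (by positivity), div_lt_iff₀ hH]
  have hm0 : (0 : ℝ) < m := lt_trans (by positivity) hm
  rw [div_lt_iff₀ hε] at hm
  have h₁ : ((interSet k l P).ncard : ℝ) * m < (ε * (allInter k l).ncard) * m := by nlinarith
  exact lt_of_mul_lt_mul_right h₁ hm0.le

/-- The vector `e_i - e_{i'}`. -/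
def diffVec {k : ℕ} (i i' : Fin k) (a : Fin k) : ℤ :=
  (if a = i then 1 else 0) - (if a = i' then 1 else 0)

lemma sum_diffVec {k : ℕ} (i i' : Fin k) : ∑ a, diffVec i i' a = 0 := by
  simp [diffVec]

/-- Add `t` at the positions `(i,j)`, `(i',j')` and subtract `t` at `(i,j')`, `(i',j)`. -/
def switch {k : ℕ} (i i' j j' : Fin k) (t : ℕ) (N : Fin k → Fin k → ℕ) (a b : Fin k) : ℕ :=
  ((N a b : ℤ) + t * (diffVec i i' a * diffVec j j' b)).toNat

lemma cast_switch {k : ℕ} {i i' j j' : Fin k} {t : ℕ} {N : Fin k → Fin k → ℕ}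
    (h₁ : t ≤ N i j') (h₂ : t ≤ N i' j) (a b : Fin k) :
    (switch i i' j j' t N a b : ℤ) = N a b + t * (diffVec i i' a * diffVec j j' b) := by
  refine Int.toNat_of_nonneg ?_
  have := Int.natCast_nonneg (N a b)
  simp only [diffVec]
  split_ifs <;> subst_vars <;> simp <;> omega

lemma isInterMatrix_switch {k l : ℕ} {i i' j j' : Fin k} {t : ℕ} {N : Fin k → Fin k → ℕ}
    (hN : IsInterMatrix k l N) (h₁ : t ≤ N i j') (h₂ : t ≤ N i' j) :
    IsInterMatrix k l (switch i i' j j' t N) := by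
  constructor
  · intro a
    zify
    simp_rw [cast_switch h₁ h₂, Finset.sum_add_distrib, ← Finset.mul_sum, sum_diffVec]
    simpa using congrArg (Nat.cast : ℕ → ℤ) (hN.1 a)
  · intro b
    zify
    simp_rw [cast_switch h₁ h₂, Finset.sum_add_distrib, ← Finset.mul_sum, ← Finset.sum_mul,
      sum_diffVec]
    simpa using congrArg (Nat.cast : ℕ → ℤ) (hN.2 b)

lemma switch_injective {k : ℕ} {i i' j j' : Fin k} {t : ℕ} {N N' : Fin k → Fin k → ℕ}
    (h₁ : t ≤ N i j') (h₂ : t ≤ N i' j) (h₁' : t ≤ N' i j') (h₂' : t ≤ N' i' j)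
    (h : switch i i' j j' t N = switch i i' j j' t N') : N = N' := by
  funext a b
  have := congrArg (Nat.cast : ℕ → ℤ) (congrFun (congrFun h a) b)
  rw [cast_switch h₁ h₂, cast_switch h₁' h₂'] at this
  omega

lemma ncard_mul_le {α : Type*} {S T : Set α} (hT : T.Finite) {ι : Type*} [Fintype ι] (m : ℕ)
    (f : α → ℕ → α) (g : α → ι) (hf : ∀ x ∈ S, ∀ t < m, f x t ∈ T)
    (hinj : ∀ x ∈ S, ∀ y ∈ S, ∀ t < m, ∀ u < m, f x t = f y u → g x = g y → x = y ∧ t = u) :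
    S.ncard * m ≤ T.ncard * Fintype.card ι := by
  have := hT.to_subtype
  have key : Nat.card (S × Fin m) ≤ Nat.card (T × ι) := by
    refine Nat.card_le_card_of_injective
      (fun p => (⟨f p.1 p.2, hf _ p.1.2 _ p.2.2⟩, g p.1)) ?_
    rintro ⟨⟨x, hx⟩, t⟩ ⟨⟨y, hy⟩, u⟩ h
    simp only [Prod.mk.injEq, Subtype.mk.injEq] at h
    obtain ⟨rfl, h'⟩ := hinj x hx y hy t t.2 u u.2 h.1 h.2
    rw [Fin.ext h']
  simpa [Nat.card_prod] using key

lemma exists_large_of_sum_eq {k l c m : ℕ} (hk : 2 ≤ k) (v : Fin k → ℕ) (j : Fin k)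
    (hv : ∑ b, v b = l) (hj : v j = c) (hl : c + k * m ≤ l) : ∃ b, b ≠ j ∧ m ≤ v b := by
  have hs : (Finset.univ.erase j).Nonempty := by
    rw [← Finset.card_pos, Finset.card_erase_of_mem (Finset.mem_univ j), Finset.card_fin]
    omega
  have hsum := Finset.add_sum_erase Finset.univ v (Finset.mem_univ j)
  obtain ⟨b, hb, hmb⟩ := Finset.exists_le_of_sum_le (f := fun _ => m) (g := v) hs (by
    rw [Finset.sum_const, Finset.card_erase_of_mem (Finset.mem_univ j), Finset.card_fin,
      smul_eq_mul]
    have : (k - 1) * m ≤ k * m := Nat.mul_le_mul_right m (Nat.sub_le k 1)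
    omega)
  exact ⟨b, Finset.ne_of_mem_erase hb, hmb⟩

/-- A generic intersection matrix has no entry of prescribed value. -/
lemma negligible_entry_eq {k : ℕ} (hk : 2 ≤ k) (i j : Fin k) (c : ℕ) :
    Negligible k fun N => N i j = c := by
  classical
  refine negligible_of_le_mul (Fintype.card (Fin k × Fin k)) fun m => ?_
  filter_upwards [eventually_ge_atTop (c + k * m)] with l hl
  have hex : ∀ N, ∃ p : Fin k × Fin k, N ∈ interSet k l (fun N => N i j = c) →
      p.1 ≠ i ∧ p.2 ≠ j ∧ m ≤ N i p.2 ∧ m ≤ N p.1 j := by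
    intro N
    by_cases hN : N ∈ interSet k l fun N => N i j = c
    · obtain ⟨j', hj', hmj⟩ := exists_large_of_sum_eq hk (N i) j (hN.1.1 i) hN.2 hl
      obtain ⟨i', hi', hmi⟩ := exists_large_of_sum_eq hk (fun a => N a j) i (hN.1.2 j) hN.2 hl
      exact ⟨(i', j'), fun _ => ⟨hi', hj', hmj, hmi⟩⟩
    · exact ⟨(i, j), fun h => absurd h hN⟩
  choose g hg using hex
  refine ncard_mul_le (allInter_finite k l) m
    (fun N t => switch i (g N).1 j (g N).2 t N) g (fun N hN t ht => ?_) ?_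
  · obtain ⟨-, -, h₁, h₂⟩ := hg N hN
    exact isInterMatrix_switch hN.1 (ht.le.trans h₁) (ht.le.trans h₂)
  · intro N hN N' hN' t ht u hu h hgg
    obtain ⟨hi, hj, h₁, h₂⟩ := hg N hN
    obtain ⟨-, -, h₁', h₂'⟩ := hg N' hN'
    simp only [← hgg] at h h₁' h₂'
    have htu : t = u := by
      have := congrArg (Nat.cast : ℕ → ℤ) (congrFun (congrFun h i) j)
      rw [cast_switch (ht.le.trans h₁) (ht.le.trans h₂),
        cast_switch (hu.le.trans h₁') (hu.le.trans h₂'), hN.2, hN'.2] at this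
      simpa [diffVec, hi.symm, hj.symm] using this
    subst htu
    exact ⟨switch_injective (ht.le.trans h₁) (ht.le.trans h₂) (ht.le.trans h₁')
      (ht.le.trans h₂') h, rfl⟩

lemma negligible_entry_lt {k : ℕ} (hk : 2 ≤ k) (i j : Fin k) (L : ℕ) :
    Negligible k fun N => N i j < L :=
  (Negligible.exists_finset (Finset.range L) fun c _ => negligible_entry_eq hk i j c).mono
    fun _ N _ h => ⟨N i j, Finset.mem_range.2 h, rfl⟩

lemma diffVec_mul_diffVec_ne_one {k : ℕ} {i i' j j' p q : Fin k}
    (h : ¬(p = i ∧ q = j)) (h' : ¬(p = i' ∧ q = j')) : diffVec i i' p * diffVec j j' q ≠ 1 := by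
  simp only [diffVec]
  split_ifs <;> simp_all

/-- Generically, two entries which are distinguished by some switch differ. -/
lemma negligible_entry_eq_entry {k : ℕ} (hk : 2 ≤ k) {i i' j j' p q : Fin k} (hi : i ≠ i')
    (hj : j ≠ j') (h : ¬(p = i ∧ q = j)) (h' : ¬(p = i' ∧ q = j')) :
    Negligible k fun N => N i j = N p q := by
  refine negligible_of_le_mul 2 fun m => ?_
  filter_upwards [((negligible_entry_lt hk i j' m).or (negligible_entry_lt hk i' j m)) m]
    with l hl
  have hbig : (interSet k l fun N => N i j = N p q ∧ m ≤ N i j' ∧ m ≤ N i' j).ncard * m ≤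
      (allInter k l).ncard * Fintype.card Unit := by
    refine ncard_mul_le (allInter_finite k l) m (fun N t => switch i i' j j' t N) (fun _ => ())
      (fun N hN t ht => isInterMatrix_switch hN.1 (ht.le.trans hN.2.2.1)
        (ht.le.trans hN.2.2.2)) ?_
    rintro N ⟨-, hN, h₁, h₂⟩ N' ⟨-, hN', h₁', h₂'⟩ t ht u hu hs -
    have entry (a b : Fin k) := congrArg (Nat.cast : ℕ → ℤ) (congrFun (congrFun hs a) b)
    simp only [cast_switch (ht.le.trans h₁) (ht.le.trans h₂),
      cast_switch (hu.le.trans h₁') (hu.le.trans h₂')] at entry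
    have hij : diffVec i i' i * diffVec j j' j = 1 := by simp [diffVec, hi, hj]
    have htu : t = u := by
      have e₁ := entry i j
      have e₂ := entry p q
      rw [hij, hN, hN'] at e₁
      have e₃ : ((t : ℤ) - u) * (diffVec i i' p * diffVec j j' q - 1) = 0 := by linarith
      rcases mul_eq_zero.1 e₃ with e | e
      · omega
      · exact absurd (sub_eq_zero.1 e) (diffVec_mul_diffVec_ne_one h h')
    subst htu
    exact ⟨switch_injective (ht.le.trans h₁) (ht.le.trans h₂) (ht.le.trans h₁')
      (ht.le.trans h₂') hs, rfl⟩
  have hsplit : (interSet k l fun N => N i j = N p q).ncard ≤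
      (interSet k l fun N => N i j' < m ∨ N i' j < m).ncard +
      (interSet k l fun N => N i j = N p q ∧ m ≤ N i j' ∧ m ≤ N i' j).ncard := by
    refine le_trans (Set.ncard_le_ncard ?_ (interSet_finite k l _))
      (interSet_or_ncard_le k l _ _)
    rintro N ⟨hN, he⟩
    refine ⟨hN, ?_⟩
    by_cases hc : N i j' < m ∨ N i' j < m
    · exact Or.inl hc
    · push Not at hc
      exact Or.inr ⟨he, hc⟩
  have := Nat.mul_le_mul_right m hsplit
  rw [Fintype.card_unit] at hbig
  linarith

lemma Fin.exists_ne_ne {k : ℕ} (hk : 3 ≤ k) (a b : Fin k) : ∃ c, a ≠ c ∧ b ≠ c := by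
  obtain ⟨c, hc⟩ := Finset.exists_mem_notMem_of_card_lt_card (s := {a, b}) (t := Finset.univ)
    (lt_of_le_of_lt Finset.card_le_two (by rw [Finset.card_fin]; omega))
  simp only [Finset.mem_univ, Finset.mem_insert, Finset.mem_singleton, not_or, true_and] at hc
  exact ⟨c, Ne.symm hc.1, Ne.symm hc.2⟩

lemma negligible_fixed {k : ℕ} (hk : 3 ≤ k) {p : Equiv.Perm (Fin k) × Equiv.Perm (Fin k)}
    (hp : p ≠ 1) : Negligible k fun N => ∀ i j, N (p.1 i) (p.2 j) = N i j := by
  have hk2 : 2 ≤ k := by omega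
  obtain ⟨σ, τ⟩ := p
  by_cases hσ : σ = 1
  · have hτ : τ ≠ 1 := fun h => hp (by rw [hσ, h]; rfl)
    obtain ⟨j, hj⟩ : ∃ j, τ j ≠ j := by
      by_contra! hc
      exact hτ (Equiv.ext hc)
    obtain ⟨j', hj₁, hj₂⟩ := Fin.exists_ne_ne hk j (τ j)
    obtain ⟨i', hi', -⟩ := Fin.exists_ne_ne hk j j
    exact (negligible_entry_eq_entry hk2 (p := σ j) (q := τ j) hi' hj₁ (fun h => hj h.2)
      (fun h => hj₂ h.2)).mono fun _ N _ hN => (hN j j).symm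
  · obtain ⟨i, hi⟩ : ∃ i, σ i ≠ i := by
      by_contra! hc
      exact hσ (Equiv.ext hc)
    obtain ⟨i', hi₁, hi₂⟩ := Fin.exists_ne_ne hk i (σ i)
    obtain ⟨j', hj', -⟩ := Fin.exists_ne_ne hk i i
    exact (negligible_entry_eq_entry hk2 (p := σ i) (q := τ i) hi₁ hj' (fun h => hi h.1)
      (fun h => hi₂ h.1)).mono fun _ N _ hN => (hN i i).symm

lemma stabCard_eq_one {k : ℕ} {N : Fin k → Fin k → ℕ}
    (h : ∀ p : Equiv.Perm (Fin k) × Equiv.Perm (Fin k),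
      (∀ i j, N (p.1 i) (p.2 j) = N i j) → p = 1) : stabCard N = 1 := by
  rw [stabCard, Nat.card_eq_one_iff_unique]
  exact ⟨⟨fun p q => Subtype.ext ((h p p.2).trans (h q q.2).symm)⟩, ⟨⟨1, fun _ _ => rfl⟩⟩⟩

lemma stabCard_eq_two {l : ℕ} {N : Fin 2 → Fin 2 → ℕ} (hN : IsInterMatrix 2 l N)
    (h : N 0 0 ≠ N 0 1) : stabCard N = 2 := by
  have hr₀ := hN.1 0
  have hr₁ := hN.1 1
  have hc₀ := hN.2 0
  simp only [Fin.sum_univ_two] at hr₀ hr₁ hc₀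
  have h₁₀ : N 1 0 = N 0 1 := by omega
  have h₁₁ : N 1 1 = N 0 0 := by omega
  have hperm : ∀ σ : Equiv.Perm (Fin 2), σ = 1 ∨ σ = Equiv.swap 0 1 := by decide
  have hset : {p : Equiv.Perm (Fin 2) × Equiv.Perm (Fin 2) |
      ∀ i j, N (p.1 i) (p.2 j) = N i j} = {(1, 1), (Equiv.swap 0 1, Equiv.swap 0 1)} := by
    have hne : (1 : Equiv.Perm (Fin 2)) ≠ Equiv.swap 0 1 := by decide
    ext ⟨σ, τ⟩
    rcases hperm σ with rfl | rfl <;> rcases hperm τ with rfl | rfl <;>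
      simp [Fin.forall_fin_two, h₁₀, h₁₁, h, h.symm, hne, hne.symm]
  change Set.ncard {p : Equiv.Perm (Fin 2) × Equiv.Perm (Fin 2) |
      ∀ i j, N (p.1 i) (p.2 j) = N i j} = 2
  rw [hset]
  exact Set.ncard_pair (by decide)

/-- For `k ≥ 3`, the proportion of `(k,l)`-intersection matrices with nontrivial stabilizer
`K_N` tends to `0` as `l → ∞`; for `k = 2`, the proportion with `|K_N| ≠ 2` tends to `0`. -/
theorem generic_stabilizer (k : ℕ) :
    (3 ≤ k →
      Filter.Tendsto (fun l : ℕ =>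
        (Nat.card {N : Fin k → Fin k → ℕ // IsInterMatrix k l N ∧ stabCard N ≠ 1} : ℝ) /
          (Nat.card {N : Fin k → Fin k → ℕ // IsInterMatrix k l N} : ℝ))
        Filter.atTop (nhds 0)) ∧
    (k = 2 →
      Filter.Tendsto (fun l : ℕ =>
        (Nat.card {N : Fin k → Fin k → ℕ // IsInterMatrix k l N ∧ stabCard N ≠ 2} : ℝ) /
          (Nat.card {N : Fin k → Fin k → ℕ // IsInterMatrix k l N} : ℝ))
        Filter.atTop (nhds 0)) := by
  refine ⟨fun hk => Negligible.tendsto ?_, fun hk => ?_⟩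
  · classical
    refine (Negligible.exists_finset
      (Finset.univ.filter fun p : Equiv.Perm (Fin k) × Equiv.Perm (Fin k) => p ≠ 1)
      fun p hp => negligible_fixed hk (Finset.mem_filter.1 hp).2).mono fun l N _ hs => ?_
    by_contra! hc
    refine hs (stabCard_eq_one fun p hp => ?_)
    by_contra hne
    obtain ⟨i, j, hij⟩ := hc p (by simpa using hne)
    exact hij (hp i j)
  · subst hk
    refine Negligible.tendsto ((negligible_entry_eq_entry le_rfl (i := 0) (i' := 1) (j := 0)
      (j' := 1) (p := 0) (q := 1) (by decide) (by decide) (by decide) (by decide)).mono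
      fun l N hN hs => ?_)
    by_contra hc
    exact hs (stabCard_eq_two hN hc)
end

section
/- Let k and l be positive integers, let P = (P_1, …, P_k) and Q = (Q_1, …, Q_k) be two partitions of {1, …, kl} into k parts each of size l, and let N be the k×k matrix with N_{i,j} = |P_i ∩ Q_j|. Let H be the subgroup of the symmetric group on {1, …, kl} consisting of all permutations that map P to itself and Q to itself (as unordered partitions, i.e. permuting parts among themselves). Then |H| = |K_N| · ∏_{i,j} N_{i,j}!, where K_N is the stabilizer of N under the action of S_k × S_k simultaneously permuting rows and columns. -/
/-- A permutation permutes the fibres of a surjection `p` iff it covers a permutation of the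
codomain of `p`. -/
theorem forall_exists_image_fiber_eq_iff {X I : Type*} [Finite I] [DecidableEq X]
    {P : I → Finset X} {p : X → I} (hp : ∀ x i, x ∈ P i ↔ p x = i)
    (hsurj : Function.Surjective p) (g : Equiv.Perm X) :
    (∀ i, ∃ j, (P i).image g = P j) ↔ ∃ σ : Equiv.Perm I, ∀ x, p (g x) = σ (p x) := by
  constructor
  · intro h
    choose σ hσ using h
    have hcov : ∀ x, p (g x) = σ (p x) := fun x => by
      rw [← hp, ← hσ]
      exact Finset.mem_image_of_mem _ ((hp _ _).2 rfl)
    have hσsurj : Function.Surjective σ := fun i => by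
      obtain ⟨x, rfl⟩ := hsurj i
      exact ⟨p (g.symm x), by rw [← hcov, g.apply_symm_apply]⟩
    exact ⟨Equiv.ofBijective σ (Finite.surjective_iff_bijective.1 hσsurj), hcov⟩
  · rintro ⟨σ, hσ⟩ i
    refine ⟨σ i, Finset.ext fun y => ?_⟩
    obtain ⟨x, rfl⟩ := g.surjective y
    rw [g.injective.mem_finset_image, hp, hp, hσ, σ.injective.eq_iff]

/-- The number of permutations carrying `f` to a map `h` with the same fibre sizes. -/
theorem card_perm_comp_eq {X Y : Type*} [Fintype X] [DecidableEq X] [Fintype Y] [DecidableEq Y]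
    (f h : X → Y) (hfh : ∀ y, Fintype.card {x // h x = y} = Fintype.card {x // f x = y}) :
    Nat.card {g : Equiv.Perm X // f ∘ g = h} =
      ∏ y, (Fintype.card {x // f x = y}).factorial := by
  let e : Equiv.Perm X := Equiv.ofFiberEquiv fun y => Fintype.equivOfCardEq (hfh y)
  have he : ∀ x, f (e x) = h x := fun x => Equiv.ofFiberEquiv_map _ x
  rw [← DomMulAct.stabilizer_card f, ← Nat.card_eq_fintype_card]
  refine Nat.card_congr ((Equiv.mulRight e⁻¹).subtypeEquiv fun g => ?_)
  constructor
  · rintro rfl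
    funext x
    simpa using (he (e⁻¹ x)).symm
  · intro hg
    funext x
    simpa [he] using congrFun hg (e x)

/-- For two `(k,l)`-partitions `P, Q` of `{1, …, kl}` with intersection matrix
`N i j = |Pᵢ ∩ Qⱼ|`, the group of permutations of `{1, …, kl}` stabilising both `P` and `Q`
(as unordered partitions) has order `|K_N| · ∏_{i,j} N_{i,j}!`. -/
theorem stabilizer_order_eq (k l : ℕ) (hk : 0 < k) (hl : 0 < l)
    (P Q : Fin k → Finset (Fin (k * l)))
    (hPcard : ∀ i, (P i).card = l) (hPpart : ∀ x : Fin (k * l), ∃! i, x ∈ P i)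
    (hQcard : ∀ i, (Q i).card = l) (hQpart : ∀ x : Fin (k * l), ∃! i, x ∈ Q i)
    (N : Fin k → Fin k → ℕ) (hN : ∀ i j, N i j = (P i ∩ Q j).card) :
    Nat.card {g : Equiv.Perm (Fin (k * l)) //
        (∀ i, ∃ j, (P i).image g = P j) ∧ ∀ i, ∃ j, (Q i).image g = Q j}
      = stabCard N * ∏ i, ∏ j, (N i j).factorial := by
  choose p hp hp' using hPpart
  choose q hq hq' using hQpart
  have hpP : ∀ x i, x ∈ P i ↔ p x = i := fun x i => ⟨fun h => (hp' x i h).symm, fun h => h ▸ hp x⟩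
  have hqQ : ∀ x i, x ∈ Q i ↔ q x = i := fun x i => ⟨fun h => (hq' x i h).symm, fun h => h ▸ hq x⟩
  have hpsurj : Function.Surjective p := fun i => by
    obtain ⟨x, hx⟩ := Finset.card_pos.1 (hPcard i ▸ hl)
    exact ⟨x, (hpP x i).1 hx⟩
  have hqsurj : Function.Surjective q := fun i => by
    obtain ⟨x, hx⟩ := Finset.card_pos.1 (hQcard i ▸ hl)
    exact ⟨x, (hqQ x i).1 hx⟩
  let f : Fin (k * l) → Fin k × Fin k := fun x => (p x, q x)
  have hf : ∀ y, Fintype.card {x // f x = y} = N y.1 y.2 := fun y => by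
    rw [hN, Fintype.card_subtype]
    congr 1
    ext x
    simp [f, hpP, hqQ, Prod.ext_iff]
  let K := {s : Equiv.Perm (Fin k) × Equiv.Perm (Fin k) // ∀ i j, N (s.1 i) (s.2 j) = N i j}
  let F : K → Type := fun s =>
    {g : Equiv.Perm (Fin (k * l)) // f ∘ g = Equiv.prodCongr s.1.1 s.1.2 ∘ f}
  have hF : ∀ s, Nat.card (F s) = ∏ i, ∏ j, (N i j).factorial := fun s => by
    rw [card_perm_comp_eq, Fintype.prod_prod_type]
    · simp only [hf]
    · intro y
      obtain ⟨y, rfl⟩ := (Equiv.prodCongr s.1.1 s.1.2).surjective y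
      simp only [Function.comp_apply, EmbeddingLike.apply_eq_iff_eq]
      rw [hf, hf]
      exact (s.2 y.1 y.2).symm
  have hcov : ∀ (s : K) (g : F s) x, p (g.1 x) = s.1.1 (p x) ∧ q (g.1 x) = s.1.2 (q x) :=
    fun s g x => Prod.ext_iff.1 (congrFun g.2 x)
  have hsigma : Nat.card (Σ s, F s) = stabCard N * ∏ i, ∏ j, (N i j).factorial := by
    rw [Nat.card_sigma, Finset.sum_congr rfl fun s _ => hF s, Finset.sum_const, stabCard,
      Nat.card_eq_fintype_card, smul_eq_mul, Finset.card_univ]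
  rw [← hsigma]
  symm
  refine Nat.card_eq_of_bijective (fun a : Σ s, F s => ⟨a.2.1,
    (forall_exists_image_fiber_eq_iff hpP hpsurj _).2 ⟨a.1.1.1, fun x => (hcov a.1 a.2 x).1⟩,
    (forall_exists_image_fiber_eq_iff hqQ hqsurj _).2 ⟨a.1.1.2, fun x => (hcov a.1 a.2 x).2⟩⟩)
    ⟨?_, ?_⟩
  · rintro ⟨s, g⟩ ⟨t, g'⟩ h
    have hg : g.1 = g'.1 := congrArg Subtype.val h
    have hst : s = t := by
      refine Subtype.ext (Prod.ext (Equiv.ext fun i => ?_) (Equiv.ext fun i => ?_))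
      · obtain ⟨x, rfl⟩ := hpsurj i
        rw [← (hcov s g x).1, ← (hcov t g' x).1, hg]
      · obtain ⟨x, rfl⟩ := hqsurj i
        rw [← (hcov s g x).2, ← (hcov t g' x).2, hg]
    subst hst
    exact congrArg (Sigma.mk s) (Subtype.ext hg)
  · rintro ⟨g, hgP, hgQ⟩
    obtain ⟨σ, hσ⟩ := (forall_exists_image_fiber_eq_iff hpP hpsurj g).1 hgP
    obtain ⟨τ, hτ⟩ := (forall_exists_image_fiber_eq_iff hqQ hqsurj g).1 hgQ
    have hstab : ∀ i j, N (σ i) (τ j) = N i j := fun i j => by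
      rw [hN, hN, ← Finset.card_image_of_injective (P i ∩ Q j) g.injective]
      congr 1
      ext y
      obtain ⟨x, rfl⟩ := g.surjective y
      rw [g.injective.mem_finset_image]
      simp [hpP, hqQ, hσ, hτ]
    exact ⟨⟨⟨(σ, τ), hstab⟩, g, funext fun x => Prod.ext (hσ x) (hτ x)⟩, rfl⟩
end

section
/- Let s and t be positive integers, let d ≥ 0, and let r_1 > r_2 > … > r_d > ⌈s/t⌉ be integers (the ranks) with positive integer multiplicities m_1, …, m_d satisfying Σ m_i < t and Σ m_i r_i < s. Set x = (s − Σ m_i r_i)/(t − Σ m_i), and let b be a positive integer with b ≤ t − Σ m_i and s − Σ m_i r_i = b⌈x⌉ + (t − Σ m_i − b)⌊x⌋. Let S be the collection of all multisets A of t nonnegative integers with sum s such that for every 1 ≤ i ≤ d, A has at least Σ_{j=1}^i m_j entries that are at least r_i. Then the minimum of ∏_{a∈A} a! over A ∈ S equals (∏_{i=1}^d r_i!^{m_i}) · ⌈x⌉!^b · ⌊x⌋!^{t − (Σ m_i) − b}, and it is attained uniquely by the multiset containing each rank r_i with multiplicity m_i, together with b entries equal to ⌈x⌉ and t − (Σ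 m_i) − b entries equal to ⌊x⌋. -/
open Finset in
/-- The second-difference expansion of `a ↦ log a!` into the hinge functions `a ↦ (a - k)⁺`. -/
theorem log_factorial_eq_sum_hinge {a N : ℕ} (h : a ≤ N) :
    Real.log (a.factorial : ℝ) =
      ∑ k ∈ range N, (Real.log ((k + 1 : ℕ) + 1 : ℝ) - Real.log (k + 1 : ℝ)) *
        ((a - (k + 1) : ℕ) : ℝ) := by
  induction a with
  | zero => simp
  | succ a ih =>
    have hstep : ∀ k, ((a + 1 - (k + 1) : ℕ) : ℝ) =
        ((a - (k + 1) : ℕ) : ℝ) + if k < a then 1 else 0 := by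
      intro k
      split_ifs with hk
      · have : a + 1 - (k + 1) = (a - (k + 1)) + 1 := by omega
        rw [this]; push_cast; ring
      · have : a + 1 - (k + 1) = a - (k + 1) := by omega
        rw [this]; simp
    have hfilter : (range N).filter (fun k => k < a) = range a := by
      ext k; simp only [mem_filter, mem_range]; omega
    have htel := sum_range_sub (fun k : ℕ => Real.log ((k : ℝ) + 1)) a
    simp only [hstep, mul_add, sum_add_distrib, mul_ite, mul_one, mul_zero]
    rw [← ih (by omega), ← sum_filter, hfilter, htel, Nat.factorial_succ, Nat.cast_mul,
      Real.log_mul (by positivity) (by positivity)]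
    simp [add_comm]

theorem hinge_weight_pos (k : ℕ) :
    0 < Real.log ((k + 1 : ℕ) + 1 : ℝ) - Real.log (k + 1 : ℝ) := by
  have : Real.log (k + 1 : ℝ) < Real.log ((k + 1 : ℕ) + 1 : ℝ) :=
    Real.log_lt_log (by positivity) (by push_cast; linarith)
  linarith

theorem log_prod_factorial_eq_sum_hinge (A : Multiset ℕ) {N : ℕ} (h : ∀ a ∈ A, a ≤ N) :
    Real.log ((A.map Nat.factorial).prod : ℝ) =
      ∑ k ∈ Finset.range N, (Real.log ((k + 1 : ℕ) + 1 : ℝ) - Real.log (k + 1 : ℝ)) *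
        (((A.map fun a => a - (k + 1)).sum : ℕ) : ℝ) := by
  induction A using Multiset.induction_on with
  | empty => simp
  | cons a A ih =>
    have hprod : ((A.map Nat.factorial).prod : ℝ) ≠ 0 := by
      simp [Multiset.prod_eq_zero_iff, Nat.factorial_ne_zero]
    simp only [Multiset.map_cons, Multiset.prod_cons, Multiset.sum_cons, Nat.cast_mul,
      Nat.cast_add (R := ℝ) (a - _), mul_add, Finset.sum_add_distrib]
    rw [Real.log_mul (by positivity) hprod,
      ih fun b hb => h b (Multiset.mem_cons_of_mem hb),
      log_factorial_eq_sum_hinge (h a (Multiset.mem_cons_self a A))]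

theorem prod_factorial_pos (A : Multiset ℕ) : 0 < (A.map Nat.factorial).prod := by
  refine Nat.pos_of_ne_zero ?_
  simp [Multiset.prod_eq_zero_iff, Nat.factorial_ne_zero]

theorem prod_factorial_le_of_hinge_le {A B : Multiset ℕ}
    (h : ∀ k, (B.map fun b => b - k).sum ≤ (A.map fun a => a - k).sum) :
    (B.map Nat.factorial).prod ≤ (A.map Nat.factorial).prod := by
  have hA : ∀ a ∈ A, a ≤ A.sum + B.sum := fun a ha =>
    (Multiset.le_sum_of_mem ha).trans (Nat.le_add_right _ _)
  have hB : ∀ b ∈ B, b ≤ A.sum + B.sum := fun b hb =>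
    (Multiset.le_sum_of_mem hb).trans (Nat.le_add_left _ _)
  have hlog : Real.log ((B.map Nat.factorial).prod : ℝ) ≤
      Real.log ((A.map Nat.factorial).prod : ℝ) := by
    rw [log_prod_factorial_eq_sum_hinge A hA, log_prod_factorial_eq_sum_hinge B hB]
    refine Finset.sum_le_sum fun k _ => ?_
    exact mul_le_mul_of_nonneg_left (by exact_mod_cast h (k + 1)) (hinge_weight_pos k).le
  rw [Real.log_le_log_iff (by exact_mod_cast prod_factorial_pos B)
    (by exact_mod_cast prod_factorial_pos A)] at hlog
  exact_mod_cast hlog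

theorem sum_hinge_eq_zero {A : Multiset ℕ} {k : ℕ} (h : A.sum ≤ k) :
    (A.map fun a => a - k).sum = 0 := by
  rw [Multiset.sum_eq_zero_iff]
  intro y hy
  obtain ⟨a, ha, rfl⟩ := Multiset.mem_map.1 hy
  have := Multiset.le_sum_of_mem ha
  omega

theorem hinge_eq_of_prod_factorial_eq {A B : Multiset ℕ}
    (h : ∀ k, (B.map fun b => b - k).sum ≤ (A.map fun a => a - k).sum)
    (hprod : (A.map Nat.factorial).prod = (B.map Nat.factorial).prod) (k : ℕ) :
    (B.map fun b => b - (k + 1)).sum = (A.map fun a => a - (k + 1)).sum := by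
  have hA : ∀ a ∈ A, a ≤ A.sum + B.sum := fun a ha =>
    (Multiset.le_sum_of_mem ha).trans (Nat.le_add_right _ _)
  have hB : ∀ b ∈ B, b ≤ A.sum + B.sum := fun b hb =>
    (Multiset.le_sum_of_mem hb).trans (Nat.le_add_left _ _)
  by_cases hk : k < A.sum + B.sum
  · have hlog := log_prod_factorial_eq_sum_hinge A hA
    rw [hprod, log_prod_factorial_eq_sum_hinge B hB] at hlog
    have hterm := (Finset.sum_eq_sum_iff_of_le fun i _ =>
      mul_le_mul_of_nonneg_left (by exact_mod_cast h (i + 1)) (hinge_weight_pos i).le).1 hlog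
        k (Finset.mem_range.2 hk)
    exact_mod_cast mul_left_cancel₀ (hinge_weight_pos k).ne' hterm
  · rw [sum_hinge_eq_zero (by omega), sum_hinge_eq_zero (by omega)]

theorem sum_hinge_eq_succ_add_card (A : Multiset ℕ) (k : ℕ) :
    (A.map fun a => a - k).sum =
      (A.map fun a => a - (k + 1)).sum + A.countP fun a => k < a := by
  induction A using Multiset.induction_on with
  | empty => simp
  | cons a A ih =>
    simp only [Multiset.map_cons, Multiset.sum_cons, Multiset.countP_cons, ih]
    split_ifs <;> omega

theorem countP_lt_eq_succ_add_count (A : Multiset ℕ) (k : ℕ) :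
    (A.countP fun a => k < a) = (A.countP fun a => k + 1 < a) + A.count (k + 1) := by
  induction A using Multiset.induction_on with
  | empty => simp
  | cons a A ih =>
    simp only [Multiset.countP_cons, Multiset.count_cons, ih]
    split_ifs <;> omega

theorem card_eq_countP_pos_add_count_zero (A : Multiset ℕ) :
    Multiset.card A = (A.countP fun a => 0 < a) + A.count 0 := by
  induction A using Multiset.induction_on with
  | empty => simp
  | cons a A ih =>
    simp only [Multiset.card_cons, Multiset.countP_cons, Multiset.count_cons, ih]
    split_ifs <;> omega

theorem eq_of_hinge_eq {A B : Multiset ℕ} (hcard : Multiset.card A = Multiset.card B)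
    (h : ∀ k, (B.map fun b => b - k).sum = (A.map fun a => a - k).sum) : A = B := by
  have hcount : ∀ k, (A.countP fun a => k < a) = B.countP fun a => k < a := by
    intro k
    have := sum_hinge_eq_succ_add_card A k
    have := sum_hinge_eq_succ_add_card B k
    have := h k
    have := h (k + 1)
    omega
  ext k
  cases k with
  | zero =>
    have := card_eq_countP_pos_add_count_zero A
    have := card_eq_countP_pos_add_count_zero B
    have := hcount 0
    omega
  | succ k =>
    have := countP_lt_eq_succ_add_count A k
    have := countP_lt_eq_succ_add_count B k
    have := hcount k
    have := hcount (k + 1)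
    omega

theorem hinge_le_of_countP_le {A B : Multiset ℕ} {c : ℕ}
    (h : ∀ j, c ≤ j → (B.countP fun b => j < b) ≤ A.countP fun a => j < a) {k : ℕ}
    (hk : c ≤ k) : (B.map fun b => b - k).sum ≤ (A.map fun a => a - k).sum := by
  obtain hkB | hkB := le_total B.sum k
  · rw [sum_hinge_eq_zero hkB]; exact Nat.zero_le _
  · induction hkB using Nat.decreasingInduction with
    | of_succ k _ ih =>
      rw [sum_hinge_eq_succ_add_card A, sum_hinge_eq_succ_add_card B]
      exact add_le_add (ih (by omega)) (h k hk)
    | self => rw [sum_hinge_eq_zero le_rfl]; exact Nat.zero_le _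

theorem sum_le_hinge_add (A : Multiset ℕ) (k : ℕ) :
    A.sum ≤ (A.map fun a => a - k).sum + Multiset.card A * k := by
  induction A using Multiset.induction_on with
  | empty => simp
  | cons a A ih =>
    simp only [Multiset.map_cons, Multiset.sum_cons, Multiset.card_cons, add_mul]
    omega

theorem sum_eq_hinge_add {A : Multiset ℕ} {k : ℕ} (h : ∀ a ∈ A, k ≤ a) :
    A.sum = (A.map fun a => a - k).sum + Multiset.card A * k := by
  induction A using Multiset.induction_on with
  | empty => simp
  | cons a A ih =>
    have := h a (Multiset.mem_cons_self a A)
    have := ih fun b hb => h b (Multiset.mem_cons_of_mem hb)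
    simp only [Multiset.map_cons, Multiset.sum_cons, Multiset.card_cons, add_mul]
    omega

theorem countP_replicate_eq_ite (n a : ℕ) (p : ℕ → Prop) [DecidablePred p] :
    (Multiset.replicate n a).countP p = if p a then n else 0 := by
  induction n with
  | zero => simp
  | succ n ih =>
    rw [Multiset.replicate_succ, Multiset.countP_cons, ih]
    split_ifs <;> rfl

theorem countP_sum_replicate {d : ℕ} (r m : Fin d → ℕ) (p : ℕ → Prop) [DecidablePred p] :
    (∑ i, Multiset.replicate (m i) (r i)).countP p = ∑ i, if p (r i) then m i else 0 := by
  have := map_sum (Multiset.countPAddMonoidHom p) (fun i => Multiset.replicate (m i) (r i))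
    Finset.univ
  simp only [Multiset.coe_countPAddMonoidHom] at this
  rw [this]
  exact Finset.sum_congr rfl fun i _ => countP_replicate_eq_ite (m i) (r i) p

theorem countP_ranks_le {d : ℕ} {r m : Fin d → ℕ} {A : Multiset ℕ}
    (hA : ∀ i : Fin d, (∑ j ∈ Finset.Iic i, m j) ≤
      Multiset.card (A.filter fun a => r i ≤ a)) (k : ℕ) :
    (∑ i, if k < r i then m i else 0) ≤ A.countP fun a => k < a := by
  rw [← Finset.sum_filter]
  obtain hempty | hne := (Finset.univ.filter fun i => k < r i).eq_empty_or_nonempty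
  · simp [hempty]
  · obtain ⟨i, hi, hmax⟩ := Finset.exists_max_image _ id hne
    have hki := (Finset.mem_filter.1 hi).2
    calc _ ≤ ∑ j ∈ Finset.Iic i, m j :=
          Finset.sum_le_sum_of_subset fun j hj => Finset.mem_Iic.2 (hmax j hj)
      _ ≤ Multiset.card (A.filter fun a => r i ≤ a) := hA i
      _ ≤ A.countP fun a => k < a := by
          rw [Multiset.countP_eq_card_filter]
          exact Multiset.card_le_card
            (Multiset.monotone_filter_right A fun a ha => lt_of_lt_of_le hki ha)

/-- Removing entries that are at least the mean does not raise the mean. -/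
theorem mean_sub_ranks_le {s t d : ℕ} (ht : 0 < t) {r m : Fin d → ℕ}
    (hr : ∀ i, (s : ℚ) / t ≤ r i) (hmt : ∑ i, m i < t) :
    ((s : ℚ) - ((∑ i, m i * r i : ℕ) : ℚ)) / ((t : ℚ) - ((∑ i, m i : ℕ) : ℚ)) ≤
      (s : ℚ) / t := by
  have htpos : (0 : ℚ) < t := by exact_mod_cast ht
  have hmt' : ((∑ i, m i : ℕ) : ℚ) < t := by exact_mod_cast hmt
  have hsum : (s : ℚ) / t * ((∑ i, m i : ℕ) : ℚ) ≤ ((∑ i, m i * r i : ℕ) : ℚ) := by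
    push_cast
    rw [Finset.mul_sum]
    refine Finset.sum_le_sum fun i _ => ?_
    rw [mul_comm]
    exact mul_le_mul_of_nonneg_left (hr i) (by positivity)
  rw [div_le_iff₀ (by linarith), mul_sub, div_mul_cancel₀ _ htpos.ne']
  linarith

/-- Minimising the product of factorials of a multiset of `t` nonnegative integers with sum
`s`, subject to containing prescribed large "ranks" `r₁ > r₂ > ⋯ > r_d > ⌈s/t⌉` with
multiplicities `m₁, …, m_d`: the minimum is `(∏ rᵢ!^{mᵢ}) · ⌈x⌉!^b · ⌊x⌋!^{t−Σmᵢ−b}` and is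
attained uniquely by the multiset consisting of each rank with its multiplicity together
with `b` entries `⌈x⌉` and `t − Σmᵢ − b` entries `⌊x⌋`. -/
theorem min_prod_factorials (s t d : ℕ) (hs : 0 < s) (ht : 0 < t)
    (r m : Fin d → ℕ) (hm : ∀ i, 0 < m i)
    (hr : StrictAnti r) (hrbig : ∀ i, ⌈(s : ℚ) / (t : ℚ)⌉₊ < r i)
    (hmt : ∑ i, m i < t) (hms : ∑ i, m i * r i < s)
    (x : ℚ)
    (hx : x = ((s : ℚ) - ((∑ i, m i * r i : ℕ) : ℚ)) / ((t : ℚ) - ((∑ i, m i : ℕ) : ℚ)))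
    (b : ℕ) (hb0 : 0 < b) (hbt : b ≤ t - ∑ i, m i)
    (hbx : s - ∑ i, m i * r i = b * ⌈x⌉₊ + (t - (∑ i, m i) - b) * ⌊x⌋₊) :
    IsLeast {p | ∃ A : Multiset ℕ, Multiset.card A = t ∧ A.sum = s ∧
        (∀ i : Fin d, (∑ j ∈ Finset.Iic i, m j) ≤
          Multiset.card (A.filter fun a => r i ≤ a)) ∧
        p = (A.map Nat.factorial).prod}
      ((∏ i, (r i).factorial ^ m i) * ⌈x⌉₊.factorial ^ b *
        ⌊x⌋₊.factorial ^ (t - (∑ i, m i) - b)) ∧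
    ∀ A : Multiset ℕ, Multiset.card A = t → A.sum = s →
      (∀ i : Fin d, (∑ j ∈ Finset.Iic i, m j) ≤
        Multiset.card (A.filter fun a => r i ≤ a)) →
      (A.map Nat.factorial).prod =
        (∏ i, (r i).factorial ^ m i) * ⌈x⌉₊.factorial ^ b *
          ⌊x⌋₊.factorial ^ (t - (∑ i, m i) - b) →
      A = (∑ i, Multiset.replicate (m i) (r i)) + Multiset.replicate b ⌈x⌉₊ +
        Multiset.replicate (t - (∑ i, m i) - b) ⌊x⌋₊ := by
  have hceil : ∀ i, ⌈x⌉₊ ≤ r i := fun i => by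
    refine (Nat.ceil_mono ?_).trans (hrbig i).le
    rw [hx]
    exact mean_sub_ranks_le ht (fun i => Nat.ceil_le.1 (hrbig i).le) hmt
  have hfloor : ⌊x⌋₊ ≤ ⌈x⌉₊ := Nat.floor_le_ceil x
  set B : Multiset ℕ := (∑ i, Multiset.replicate (m i) (r i)) + Multiset.replicate b ⌈x⌉₊ +
    Multiset.replicate (t - (∑ i, m i) - b) ⌊x⌋₊ with hB
  have hBcard : Multiset.card B = t := by
    simp only [hB, Multiset.card_add, Multiset.card_sum, Multiset.card_replicate]
    omega
  have hBsum : B.sum = s := by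
    simp only [hB, Multiset.sum_add, Multiset.sum_sum, Multiset.sum_replicate, smul_eq_mul]
    omega
  have hBprod : (B.map Nat.factorial).prod = (∏ i, (r i).factorial ^ m i) *
      ⌈x⌉₊.factorial ^ b * ⌊x⌋₊.factorial ^ (t - (∑ i, m i) - b) := by
    have hmap := map_sum (Multiset.mapAddMonoidHom Nat.factorial)
      (fun i => Multiset.replicate (m i) (r i)) Finset.univ
    simp only [Multiset.coe_mapAddMonoidHom, Multiset.map_replicate] at hmap
    simp only [hB, Multiset.map_add, Multiset.prod_add, Multiset.map_replicate,
      Multiset.prod_replicate, hmap, Multiset.prod_sum]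
  have hBranks : ∀ i : Fin d, (∑ j ∈ Finset.Iic i, m j) ≤
      Multiset.card (B.filter fun a => r i ≤ a) := by
    intro i
    rw [← Multiset.countP_eq_card_filter, hB, Multiset.countP_add, Multiset.countP_add,
      countP_sum_replicate, ← Finset.sum_filter, add_assoc]
    refine (Finset.sum_le_sum_of_subset fun j hj => ?_).trans (Nat.le_add_right _ _)
    exact Finset.mem_filter.2 ⟨Finset.mem_univ j, hr.antitone (Finset.mem_Iic.1 hj)⟩
  have hBmin : ∀ a ∈ B, ⌊x⌋₊ ≤ a := by
    intro a ha
    simp only [hB, Multiset.mem_add, Multiset.mem_sum, Multiset.mem_replicate] at ha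
    rcases ha with (⟨i, -, -, rfl⟩ | ⟨-, rfl⟩) | ⟨-, rfl⟩
    · exact hfloor.trans (hceil i)
    · exact hfloor
    · exact le_rfl
  have hBtail : ∀ j, ⌈x⌉₊ ≤ j →
      (B.countP fun a => j < a) = ∑ i, if j < r i then m i else 0 := by
    intro j hj
    rw [hB, Multiset.countP_add, Multiset.countP_add, countP_sum_replicate,
      countP_replicate_eq_ite, countP_replicate_eq_ite, if_neg (by omega),
      if_neg (by omega), add_zero, add_zero]
  have hinge : ∀ A : Multiset ℕ, Multiset.card A = t → A.sum = s →
      (∀ i : Fin d, (∑ j ∈ Finset.Iic i, m j) ≤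
        Multiset.card (A.filter fun a => r i ≤ a)) →
      ∀ k, (B.map fun b => b - k).sum ≤ (A.map fun a => a - k).sum := by
    intro A hAcard hAsum hA k
    obtain hk | hk := le_or_gt ⌈x⌉₊ k
    · exact hinge_le_of_countP_le
        (fun j hj => (hBtail j hj).trans_le (countP_ranks_le hA j)) hk
    · have hkfloor : k ≤ ⌊x⌋₊ := Nat.le_floor (Nat.lt_ceil.1 hk).le
      have h₁ := sum_le_hinge_add A k
      have h₂ := sum_eq_hinge_add (A := B) fun a ha => hkfloor.trans (hBmin a ha)
      rw [hAcard] at h₁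
      rw [hBcard] at h₂
      omega
  rw [← hBprod]
  refine ⟨⟨⟨B, hBcard, hBsum, hBranks, rfl⟩, ?_⟩, ?_⟩
  · rintro p ⟨A, hAcard, hAsum, hA, rfl⟩
    exact prod_factorial_le_of_hinge_le (hinge A hAcard hAsum hA)
  · intro A hAcard hAsum hA hprod
    refine eq_of_hinge_eq (hAcard.trans hBcard.symm) fun k => ?_
    cases k with
    | zero => simp [hAsum, hBsum]
    | succ k => exact hinge_eq_of_prod_factorial_eq (hinge A hAcard hAsum hA) hprod k
end

section
/- Let k > t ≥ 2 be integers and let N be a t×k truncated staircase, i.e. N consists of the first t rows of the cyclic-shift matrix θ(v) where v = (x, y, z, z, …, z) ∈ ℤ_{≥0}^k with x ≠ z and y ≠ z; N is weak if x = y and strong if x ≠ y. Let K_N be the stabilizer of N in S_t × S_k acting by simultaneously permuting rows and columns. (i) If N is weak, then for every (ρ, γ) ∈ K_N, either ρ = 1, or γ moves every j ∈ {1, …, t+1} except possibly j = (t+2)/2; moreover the set {1,…,t} × {1,…,t+1} of positions is a union of K_N-orbits on which K_N induces exactly the group of order 2 generated by the map (i,j) ↦ (t+1−i, t+2−j). (ii)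 If N is strong, then every (ρ, γ) ∈ K_N has ρ = 1. -/
/-- Entries of a truncated staircase: `x` on the diagonal, `y` just right of it, `z` elsewhere. -/
theorem staircase_entry {t k : ℕ} (htk : t < k) {x y z : ℕ} {v : Fin k → ℕ}
    {hk0 : 0 < k} {hk1 : 1 < k} (hv0 : v ⟨0, hk0⟩ = x) (hv1 : v ⟨1, hk1⟩ = y)
    (hv2 : ∀ j : Fin k, 2 ≤ (j : ℕ) → v j = z) (i : Fin t) (j : Fin k) :
    v (j - Fin.castLE htk.le i) =
      if (j : ℕ) = i then x else if (j : ℕ) = i + 1 then y else z := by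
  have hi := i.isLt
  have hj := j.isLt
  have hsub : ((j - Fin.castLE htk.le i : Fin k) : ℕ) =
      if (i : ℕ) ≤ j then (j : ℕ) - i else k - i + j := by
    rw [Fin.val_sub, Fin.val_castLE]
    split_ifs with h
    · rw [show k - (i : ℕ) + j = (j - i) + k by omega, Nat.add_mod_right,
        Nat.mod_eq_of_lt (by omega)]
    · exact Nat.mod_eq_of_lt (by omega)
  split_ifs with h0 h1
  · rw [← hv0]
    congr 1
    ext
    rw [hsub, if_pos (by omega)]
    simp only
    omega
  · rw [← hv1]
    congr 1
    ext
    rw [hsub, if_pos (by omega)]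
    simp only
    omega
  · apply hv2
    rw [hsub]
    split_ifs <;> omega

/-- The pair `(ρ, γ)` preserves the path graph `0 – 0 – 1 – 1 – ⋯ – (t - 1) – t` alternating between
columns and rows, in which row `i` is adjacent to the columns `i` and `i + 1`. -/
def PreservesPath {t k : ℕ} (ρ : Equiv.Perm (Fin t)) (γ : Equiv.Perm (Fin k)) : Prop :=
  ∀ i j, ((γ j : ℕ) = ρ i ∨ (γ j : ℕ) = ρ i + 1) ↔ ((j : ℕ) = i ∨ (j : ℕ) = i + 1)

namespace PreservesPath

variable {t k : ℕ} {ρ : Equiv.Perm (Fin t)} {γ : Equiv.Perm (Fin k)}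

theorem col_le (H : PreservesPath ρ γ) (ht : 0 < t) (j : Fin k) (hj : (j : ℕ) ≤ t) :
    (γ j : ℕ) ≤ t := by
  have h := (H ⟨j - 1, by omega⟩ j).2 (by simp only; omega)
  have := (ρ ⟨j - 1, by omega⟩).isLt
  omega

theorem col_zero (H : PreservesPath ρ γ) (ht : 0 < t) (htk : t < k) :
    (γ ⟨0, by omega⟩ : ℕ) = 0 ∨ (γ ⟨0, by omega⟩ : ℕ) = t := by
  by_contra! hne
  have hle := H.col_le ht ⟨0, by omega⟩ (Nat.zero_le _)
  set c : ℕ := (γ ⟨0, by omega⟩ : ℕ) with hc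
  have h1 := (H (ρ.symm ⟨c - 1, by omega⟩) ⟨0, by omega⟩).1 (by
    rw [Equiv.apply_symm_apply]; simp only; omega)
  have h2 := (H (ρ.symm ⟨c, by omega⟩) ⟨0, by omega⟩).1 (by
    rw [Equiv.apply_symm_apply]; simp only; omega)
  have h3 : ρ.symm ⟨c - 1, by omega⟩ = ρ.symm ⟨c, by omega⟩ := by
    ext
    simp only at h1 h2
    omega
  have h4 := congrArg Fin.val (ρ.symm.injective h3)
  simp only at h4
  omega

theorem eq_id (H : PreservesPath ρ γ) (htk : t < k)
    (h0 : (γ ⟨0, by omega⟩ : ℕ) = 0) (i : ℕ) (hi : i < t) :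
    (γ ⟨i, by omega⟩ : ℕ) = i ∧ (ρ ⟨i, hi⟩ : ℕ) = i ∧ (γ ⟨i + 1, by omega⟩ : ℕ) = i + 1 := by
  have col : ∀ (a : ℕ) (ha : a < t), (γ ⟨a, by omega⟩ : ℕ) = a → (ρ ⟨a, ha⟩ : ℕ) = a →
      (γ ⟨a + 1, by omega⟩ : ℕ) = a + 1 := by
    intro a ha hγ hρ
    have h := (H ⟨a, ha⟩ ⟨a + 1, by omega⟩).2 (Or.inr rfl)
    have hne : (γ ⟨a + 1, by omega⟩ : ℕ) ≠ γ ⟨a, by omega⟩ := by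
      simp [Fin.val_inj]
    omega
  induction i with
  | zero =>
    have h := (H ⟨0, hi⟩ ⟨0, by omega⟩).2 (Or.inl rfl)
    have hρ : (ρ ⟨0, hi⟩ : ℕ) = 0 := by omega
    exact ⟨h0, hρ, col 0 hi h0 hρ⟩
  | succ a ih =>
    obtain ⟨-, hρ, hγ⟩ := ih (by omega) col
    have h := (H ⟨a + 1, hi⟩ ⟨a + 1, by omega⟩).2 (Or.inl rfl)
    have hne : (ρ ⟨a + 1, hi⟩ : ℕ) ≠ ρ ⟨a, by omega⟩ := by
      simp [Fin.val_inj]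
    have hρ' : (ρ ⟨a + 1, hi⟩ : ℕ) = a + 1 := by omega
    exact ⟨hγ, hρ', col (a + 1) hi hγ hρ'⟩

theorem mul {ρ' : Equiv.Perm (Fin t)} {γ' : Equiv.Perm (Fin k)} (H' : PreservesPath ρ' γ')
    (H : PreservesPath ρ γ) : PreservesPath (ρ' * ρ) (γ' * γ) :=
  fun i j => (H' (ρ i) (γ j)).trans (H i j)

end PreservesPath

/-- The permutation of the columns reversing the block `{0, …, t}` and fixing all others. -/
def blockRev {t k : ℕ} (htk : t < k) : Equiv.Perm (Fin k) :=
  Function.Involutive.toPerm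
    (fun j => if (j : ℕ) ≤ t then ⟨t - j, by omega⟩ else j) (fun j => by
      by_cases h : (j : ℕ) ≤ t
      · ext
        simp only [h, if_true, Nat.sub_le]
        omega
      · simp only [h, if_false])

theorem blockRev_val {t k : ℕ} (htk : t < k) (j : Fin k) :
    (blockRev htk j : ℕ) = if (j : ℕ) ≤ t then t - j else (j : ℕ) := by
  change ((if (j : ℕ) ≤ t then (⟨t - j, by omega⟩ : Fin k) else j : Fin k) : ℕ) = _
  split_ifs <;> rfl

theorem preservesPath_rev {t k : ℕ} (htk : t < k) :
    PreservesPath (Fin.revPerm : Equiv.Perm (Fin t)) (blockRev htk) := by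
  intro i j
  have hi := i.isLt
  rw [blockRev_val, Fin.revPerm_apply, Fin.val_rev]
  split_ifs <;> omega

theorem PreservesPath.eq_id_or_rev {t k : ℕ} {ρ : Equiv.Perm (Fin t)} {γ : Equiv.Perm (Fin k)}
    (H : PreservesPath ρ γ) (ht : 0 < t) (htk : t < k) :
    ((∀ i : Fin t, ρ i = i) ∧ ∀ j : Fin k, (j : ℕ) ≤ t → γ j = j) ∨
      ((∀ i : Fin t, (ρ i : ℕ) = t - 1 - (i : ℕ)) ∧
        ∀ j : Fin k, (j : ℕ) ≤ t → (γ j : ℕ) = t - (j : ℕ)) := by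
  have fixes : ∀ {ρ : Equiv.Perm (Fin t)} {γ : Equiv.Perm (Fin k)}, PreservesPath ρ γ →
      (γ ⟨0, by omega⟩ : ℕ) = 0 →
      (∀ i : Fin t, (ρ i : ℕ) = i) ∧ ∀ j : Fin k, (j : ℕ) ≤ t → (γ j : ℕ) = j := by
    intro ρ γ H h0
    refine ⟨fun i => (H.eq_id htk h0 i i.isLt).2.1, fun j hj => ?_⟩
    rcases hj.lt_or_eq with hlt | heq
    · exact (H.eq_id htk h0 j hlt).1
    · have h := (H.eq_id htk h0 (t - 1) (by omega)).2.2
      have hj' : j = ⟨t - 1 + 1, by omega⟩ := by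
        ext
        simp only
        omega
      rw [hj', h]
  rcases H.col_zero ht htk with h0 | h0
  · left
    obtain ⟨hρ, hγ⟩ := fixes H h0
    exact ⟨fun i => Fin.ext (hρ i), fun j hj => Fin.ext (hγ j hj)⟩
  · right
    obtain ⟨hρ, hγ⟩ := fixes ((preservesPath_rev htk).mul H) (by
      rw [Equiv.Perm.mul_apply, blockRev_val, h0]
      simp)
    refine ⟨fun i => ?_, fun j hj => ?_⟩
    · have h := hρ i
      rw [Equiv.Perm.mul_apply, Fin.revPerm_apply, Fin.val_rev] at h
      have := (ρ i).isLt
      omega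
    · have h := hγ j hj
      have hle := H.col_le ht j hj
      rw [Equiv.Perm.mul_apply, blockRev_val, if_pos hle] at h
      omega

/-- A permutation of `Fin t` commuting with the successor is the identity. -/
theorem perm_eq_one_of_succ {t : ℕ} (ρ : Equiv.Perm (Fin t))
    (h : ∀ (a : ℕ) (ha : a + 1 < t), (ρ ⟨a + 1, ha⟩ : ℕ) = ρ ⟨a, by omega⟩ + 1) : ρ = 1 := by
  have hadd : ∀ (a : ℕ) (ha : a < t), (ρ ⟨a, ha⟩ : ℕ) = ρ ⟨0, by omega⟩ + a := by
    intro a ha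
    induction a with
    | zero => rfl
    | succ a ih => rw [h a ha, ih (by omega), Nat.add_assoc]
  ext i
  have hi := i.isLt
  have hlast := hadd (t - 1) (by omega)
  have := (ρ ⟨t - 1, by omega⟩).isLt
  have : (ρ i : ℕ) = _ := hadd i hi
  simp only [Equiv.Perm.one_apply]
  omega

/-- Stabilizers of truncated staircases.  `N` is the `t × k` matrix consisting of the first
`t` rows of the cyclic-shift matrix of `v = (x, y, z, …, z)` with `x ≠ z ≠ y`.
(i) If `x = y` (weak case): the column block `{0, …, t}` (1-based `{1, …, t+1}`) is preserved
by the stabilizer; every stabilizing pair restricts on `{0,…,t−1} × {0,…,t}` either to the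
identity or to `(i,j) ↦ (t−1−i, t−j)` (1-based `(t+1−i, t+2−j)`), and the latter is attained;
moreover for every stabilizing pair `(ρ, γ)`, either `ρ = 1` or `γ` moves every column
`j ∈ {0, …, t}` except possibly `2j = t` (1-based `j = (t+2)/2`).
(ii) If `x ≠ y` (strong case): every stabilizing pair `(ρ, γ)` has `ρ = 1`. -/
theorem truncated_staircase (t k : ℕ) (ht : 2 ≤ t) (htk : t < k)
    (x y z : ℕ) (hxz : x ≠ z) (hyz : y ≠ z)
    (v : Fin k → ℕ)
    (hv0 : v ⟨0, by omega⟩ = x) (hv1 : v ⟨1, by omega⟩ = y)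
    (hv2 : ∀ j : Fin k, 2 ≤ (j : ℕ) → v j = z)
    (N : Fin t → Fin k → ℕ)
    (hN : ∀ (i : Fin t) (j : Fin k), N i j = v (j - Fin.castLE htk.le i)) :
    (x = y →
      (∀ (ρ : Equiv.Perm (Fin t)) (γ : Equiv.Perm (Fin k)),
        (∀ i j, N (ρ i) (γ j) = N i j) →
        ∀ j : Fin k, (j : ℕ) ≤ t → (γ j : ℕ) ≤ t) ∧
      (∀ (ρ : Equiv.Perm (Fin t)) (γ : Equiv.Perm (Fin k)),
        (∀ i j, N (ρ i) (γ j) = N i j) →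
        ((∀ i : Fin t, ρ i = i) ∧ ∀ j : Fin k, (j : ℕ) ≤ t → γ j = j) ∨
        ((∀ i : Fin t, (ρ i : ℕ) = t - 1 - (i : ℕ)) ∧
          ∀ j : Fin k, (j : ℕ) ≤ t → (γ j : ℕ) = t - (j : ℕ))) ∧
      (∃ (ρ : Equiv.Perm (Fin t)) (γ : Equiv.Perm (Fin k)),
        (∀ i j, N (ρ i) (γ j) = N i j) ∧
        (∀ i : Fin t, (ρ i : ℕ) = t - 1 - (i : ℕ)) ∧
        ∀ j : Fin k, (j : ℕ) ≤ t → (γ j : ℕ) = t - (j : ℕ)) ∧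
      (∀ (ρ : Equiv.Perm (Fin t)) (γ : Equiv.Perm (Fin k)),
        (∀ i j, N (ρ i) (γ j) = N i j) →
        ρ = 1 ∨ ∀ j : Fin k, (j : ℕ) ≤ t → 2 * (j : ℕ) ≠ t → γ j ≠ j)) ∧
    (x ≠ y →
      ∀ (ρ : Equiv.Perm (Fin t)) (γ : Equiv.Perm (Fin k)),
        (∀ i j, N (ρ i) (γ j) = N i j) → ρ = 1) := by
  have hE : ∀ i j, N i j = if (j : ℕ) = i then x else if (j : ℕ) = i + 1 then y else z :=
    fun i j => (hN i j).trans (staircase_entry htk hv0 hv1 hv2 i j)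
  refine ⟨fun hxy => ?_, fun hxy ρ γ H => ?_⟩
  · subst hxy
    have hpath : ∀ (ρ : Equiv.Perm (Fin t)) (γ : Equiv.Perm (Fin k)),
        (∀ i j, N (ρ i) (γ j) = N i j) ↔ PreservesPath ρ γ := by
      intro ρ γ
      refine forall_congr' fun i => forall_congr' fun j => ?_
      rw [hE, hE]
      split_ifs <;> simp_all [eq_comm]
    refine ⟨fun ρ γ H => ((hpath ρ γ).1 H).col_le (by omega),
      fun ρ γ H => ((hpath ρ γ).1 H).eq_id_or_rev (by omega) htk,
      ⟨Fin.revPerm, blockRev htk, (hpath _ _).2 (preservesPath_rev htk), fun i => ?_,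
        fun j hj => ?_⟩, fun ρ γ H => ?_⟩
    · rw [Fin.revPerm_apply, Fin.val_rev]
      omega
    · rw [blockRev_val, if_pos hj]
    · rcases ((hpath ρ γ).1 H).eq_id_or_rev (by omega) htk with ⟨hρ, -⟩ | ⟨-, hγ⟩
      · exact Or.inl (Equiv.ext hρ)
      · refine Or.inr fun j hj hne heq => hne ?_
        have h := hγ j hj
        rw [heq] at h
        omega
  · have hdiag : ∀ (a : ℕ) (ha : a < t), (γ ⟨a, by omega⟩ : ℕ) = ρ ⟨a, ha⟩ := by
      intro a ha
      have h := H ⟨a, ha⟩ ⟨a, by omega⟩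
      rw [hE, hE] at h
      by_contra hne
      rw [if_neg hne, if_pos rfl] at h
      split_ifs at h <;> omega
    apply perm_eq_one_of_succ
    intro a ha
    have h := H ⟨a, by omega⟩ ⟨a + 1, by omega⟩
    rw [hE, hE, hdiag (a + 1) ha] at h
    rw [if_neg (show ¬ a + 1 = a by omega), if_pos rfl] at h
    split_ifs at h <;> omega
end

section
/- Let k ≥ 3 and q be positive integers, and let N be a (k, qk)-intersection matrix whose largest entry equals q+1 and occurs exactly once in each row and exactly once in each column. Then |K_N| ≥ 3, and consequently |K_N| · ∏_{i,j} N_{i,j}! ≥ 3 · (q+1)!^k · q!^{k²−2k} · (q−1)!^k. -/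
/-- A vector of naturals with mean `q` whose maximum `q + 1` is attained once takes the value
`q - 1` exactly once and the value `q` everywhere else. -/
theorem exists_unique_deficient {ι : Type*} [Fintype ι] [DecidableEq ι] (q : ℕ)
    (f : ι → ℕ) (hsum : ∑ j, f j = q * Fintype.card ι) (hle : ∀ j, f j ≤ q + 1)
    (hmax : ∃! j, f j = q + 1) :
    ∃ a b, a ≠ b ∧ f a = q + 1 ∧ f b + 1 = q ∧ ∀ j, j ≠ a → j ≠ b → f j = q := by
  obtain ⟨a, ha, hau⟩ := hmax
  have hlt : ∀ j, j ≠ a → f j ≤ q := fun j hj => by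
    have h1 := hle j
    have h2 : f j ≠ q + 1 := fun h => hj (hau j h)
    omega
  have hdef : ∑ j ∈ Finset.univ.erase a, (q - f j) = 1 := by
    have h1 : ∑ j ∈ Finset.univ.erase a, ((q - f j) + f j) =
        ∑ j ∈ Finset.univ.erase a, q :=
      Finset.sum_congr rfl fun j hj => Nat.sub_add_cancel (hlt j (Finset.ne_of_mem_erase hj))
    have h2 := Finset.add_sum_erase Finset.univ f (Finset.mem_univ a)
    have h3 := Finset.add_sum_erase Finset.univ (fun _ : ι => q) (Finset.mem_univ a)
    rw [Finset.sum_add_distrib] at h1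
    rw [Finset.sum_const (s := Finset.univ), Finset.card_univ, smul_eq_mul, mul_comm] at h3
    omega
  obtain ⟨b, hb, hb1⟩ : ∃ b ∈ Finset.univ.erase a, q - f b ≠ 0 :=
    Finset.exists_ne_zero_of_sum_ne_zero (by omega)
  have hrest := Finset.add_sum_erase (Finset.univ.erase a) (fun j => q - f j) hb
  simp only [hdef] at hrest
  have hzero : ∑ j ∈ (Finset.univ.erase a).erase b, (q - f j) = 0 := by omega
  refine ⟨a, b, (Finset.ne_of_mem_erase hb).symm, ha, by omega, fun j hja hjb => ?_⟩
  have h1 := Finset.sum_eq_zero_iff.mp hzero j (by simp [hja, hjb])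
  have h2 := hlt j hja
  omega

/-- A fixed-point-free permutation of a set with at least three elements commutes with some
permutation other than itself and the identity. -/
theorem exists_commute_ne_one_ne_self {ι : Type*} [Fintype ι] [DecidableEq ι]
    (hcard : 3 ≤ Fintype.card ι) (c : Equiv.Perm ι) (hc : ∀ i, c i ≠ i) :
    ∃ d : Equiv.Perm ι, Commute d c ∧ d ≠ 1 ∧ d ≠ c := by
  have : Nonempty ι := Fintype.card_pos_iff.mp (by omega)
  obtain ⟨i⟩ := this
  by_cases h : c * c = 1
  · have hcc : ∀ x, c (c x) = x := fun x => by
      rw [← Equiv.Perm.mul_apply, h, Equiv.Perm.one_apply]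
    refine ⟨Equiv.swap i (c i), ?_, ?_, ?_⟩
    · have := Equiv.mul_swap_eq_swap_mul c i (c i)
      rw [hcc, Equiv.swap_comm (c i) i] at this
      exact this.symm
    · rw [Ne, Equiv.swap_eq_one_iff]
      exact (hc i).symm
    · obtain ⟨j, hj⟩ : ∃ j, j ∉ ({i, c i} : Finset ι) := by
        by_contra! hall
        have h1 := Finset.card_le_two (a := i) (b := c i)
        rw [Finset.eq_univ_of_forall hall, Finset.card_univ] at h1
        omega
      simp only [Finset.mem_insert, Finset.mem_singleton, not_or] at hj
      intro heq
      refine hc j ?_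
      rw [← heq, Equiv.swap_apply_of_ne_of_ne hj.1 hj.2]
  · refine ⟨c * c, (Commute.refl c).mul_left (Commute.refl c), h, fun heq => hc i ?_⟩
    rw [mul_eq_left.mp heq, Equiv.Perm.one_apply]

/-- The deviation of `N` from the constant matrix `q` is a difference of two permutation
matrices with disjoint supports. -/
theorem exists_perms_of_max_once {k q : ℕ} {N : Fin k → Fin k → ℕ}
    (hN : IsInterMatrix k (q * k) N) (hle : ∀ i j, N i j ≤ q + 1)
    (hrow : ∀ i, ∃! j, N i j = q + 1) (hcol : ∀ j, ∃! i, N i j = q + 1) :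
    ∃ a b : Equiv.Perm (Fin k), (∀ i, a i ≠ b i) ∧
      ∀ i j, N i j = if j = a i then q + 1 else if j = b i then q - 1 else q := by
  choose a b hab ha hb hr using fun i =>
    exists_unique_deficient q (N i) (by simpa using hN.1 i) (hle i) (hrow i)
  have hainj : Function.Injective a := fun i i' h =>
    (hcol (a i)).unique (ha i) (h ▸ ha i')
  have hbinj : Function.Injective b := fun i i' h => by
    obtain ⟨u, v, -, hu, -, hrest⟩ := exists_unique_deficient q (fun x => N x (b i))
      (by simpa using hN.2 (b i)) (fun x => hle x _) (hcol _)
    have key : ∀ x, N x (b i) + 1 = q → x = v := fun x hx => by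
      by_contra hxv
      have hxu : x ≠ u := by rintro rfl; omega
      have := hrest x hxu hxv
      omega
    rw [key i (hb i), key i' (h ▸ hb i')]
  refine ⟨Equiv.ofBijective a (Finite.injective_iff_bijective.mp hainj),
    Equiv.ofBijective b (Finite.injective_iff_bijective.mp hbinj), hab, fun i j => ?_⟩
  simp only [Equiv.ofBijective_apply]
  split_ifs with h1 h2
  · exact h1 ▸ ha i
  · have := hb i
    subst h2
    omega
  · exact hr i j h1 h2

/-- `stabCard` is at least the size of the centralizer of `b⁻¹ * a`, hence at least three. -/
theorem three_le_stabCard_of_perms {k q : ℕ} (hk : 3 ≤ k) {N : Fin k → Fin k → ℕ}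
    {a b : Equiv.Perm (Fin k)} (hab : ∀ i, a i ≠ b i)
    (hN : ∀ i j, N i j = if j = a i then q + 1 else if j = b i then q - 1 else q) :
    3 ≤ stabCard N := by
  have hc : ∀ i, (b⁻¹ * a) i ≠ i := fun i h =>
    hab i (by rwa [Equiv.Perm.mul_apply, Equiv.Perm.inv_eq_iff_eq] at h)
  obtain ⟨d, hd, hd1, hdc⟩ := exists_commute_ne_one_ne_self (by simpa using hk) (b⁻¹ * a) hc
  have hstab : ∀ σ : Equiv.Perm (Fin k), Commute σ (b⁻¹ * a) →
      ∀ i j, N (σ i) ((a * σ * a⁻¹) j) = N i j := fun σ hσ i j => by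
    have hb : a * σ * a⁻¹ * b = b * σ := by
      have h := hσ.inv_right.eq
      rw [mul_inv_rev, inv_inv] at h
      rw [mul_assoc, mul_assoc, h]
      group
    have h1 : (a * σ * a⁻¹) j = a (σ i) ↔ j = a i := by
      simp [Equiv.symm_apply_eq]
    have h2 : (a * σ * a⁻¹) j = b (σ i) ↔ j = b i := by
      rw [← Equiv.Perm.mul_apply b, ← hb, Equiv.Perm.mul_apply _ b, Equiv.apply_eq_iff_eq]
    simp only [hN, h1, h2]
  let φ : {σ : Equiv.Perm (Fin k) // Commute σ (b⁻¹ * a)} →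
      {p : Equiv.Perm (Fin k) × Equiv.Perm (Fin k) // ∀ i j, N (p.1 i) (p.2 j) = N i j} :=
    fun σ => ⟨(σ.1, a * σ.1 * a⁻¹), hstab σ.1 σ.2⟩
  have hφ : Function.Injective φ := fun σ σ' h =>
    Subtype.ext (congrArg (fun p => p.1.1) h)
  refine le_trans ?_ (Nat.card_le_card_of_injective φ hφ)
  have h1c : (1 : Equiv.Perm (Fin k)) ≠ b⁻¹ * a := fun h =>
    hc ⟨0, by omega⟩ (by rw [← h, Equiv.Perm.one_apply])
  have hsub : (({1, b⁻¹ * a, d} : Finset (Equiv.Perm (Fin k))) : Set _) ⊆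
      {σ | Commute σ (b⁻¹ * a)} := by
    intro σ hσ
    simp only [Finset.coe_insert, Finset.coe_singleton, Set.mem_insert_iff,
      Set.mem_singleton_iff] at hσ
    rcases hσ with rfl | rfl | rfl
    · exact Commute.one_left _
    · exact Commute.refl _
    · exact hd
  have hle := Set.ncard_le_ncard hsub (Set.toFinite _)
  rw [Set.ncard_coe_finset, Finset.card_eq_three.mpr
    ⟨1, b⁻¹ * a, d, h1c, hd1.symm, hdc.symm, rfl⟩] at hle
  exact hle

theorem prod_factorial_of_perms {k q : ℕ} {N : Fin k → Fin k → ℕ}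
    {a b : Equiv.Perm (Fin k)} (hab : ∀ i, a i ≠ b i)
    (hN : ∀ i j, N i j = if j = a i then q + 1 else if j = b i then q - 1 else q) :
    ∏ i, ∏ j, (N i j).factorial =
      (q + 1).factorial ^ k * q.factorial ^ (k ^ 2 - 2 * k) * (q - 1).factorial ^ k := by
  have hrow : ∀ i, ∏ j, (N i j).factorial =
      (q + 1).factorial * q.factorial ^ (k - 2) * (q - 1).factorial := fun i => by
    have hmem : b i ∈ Finset.univ.erase (a i) := by simp [(hab i).symm]
    have hrest : ∏ j ∈ (Finset.univ.erase (a i)).erase (b i), (N i j).factorial =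
        q.factorial ^ (k - 2) := by
      rw [Finset.prod_congr rfl (g := fun _ => q.factorial), Finset.prod_const,
        Finset.card_erase_of_mem hmem, Finset.card_erase_of_mem (Finset.mem_univ _),
        Finset.card_univ, Fintype.card_fin, Nat.sub_sub]
      intro j hj
      simp only [Finset.mem_erase] at hj
      rw [hN, if_neg hj.2.1, if_neg hj.1]
    rw [← Finset.mul_prod_erase _ _ (Finset.mem_univ (a i)),
      ← Finset.mul_prod_erase _ _ hmem, hrest, hN i (a i), hN i (b i), if_pos rfl,
      if_neg (hab i).symm, if_pos rfl]
    ring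
  have hexp : k ^ 2 - 2 * k = (k - 2) * k := by rw [Nat.sub_mul, sq]
  rw [Finset.prod_congr rfl fun i _ => hrow i, Finset.prod_const, Finset.card_univ,
    Fintype.card_fin, mul_pow, mul_pow, ← pow_mul, hexp]


/-- If `N` is a `(k, qk)`-intersection matrix whose largest entry is `q + 1`, occurring
exactly once in each row and each column, then `|K_N| ≥ 3` and hence
`|K_N| · ∏ N_{i,j}! ≥ 3 · (q+1)!^k · q!^{k²−2k} · (q−1)!^k`. -/
theorem stab_ge_three (k q : ℕ) (hk : 3 ≤ k) (hq : 1 ≤ q)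
    (N : Fin k → Fin k → ℕ) (hN : IsInterMatrix k (q * k) N)
    (hle : ∀ i j, N i j ≤ q + 1)
    (hrow : ∀ i, ∃! j, N i j = q + 1)
    (hcol : ∀ j, ∃! i, N i j = q + 1) :
    3 ≤ stabCard N ∧
      (q + 1).factorial ^ k * q.factorial ^ (k ^ 2 - 2 * k) * (q - 1).factorial ^ k * 3 ≤
        autCard N := by
  obtain ⟨a, b, hab, hperm⟩ := exists_perms_of_max_once hN hle hrow hcol
  have hthree := three_le_stabCard_of_perms hk hab hperm
  refine ⟨hthree, ?_⟩
  rw [autCard, prod_factorial_of_perms hab hperm, mul_comm]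
  exact Nat.mul_le_mul_right _ hthree
end

section
/- Let k ≥ 7 and q ≥ 1 be integers, let v = (q+1, q−1, q, q, …, q) ∈ ℤ^k, and define the k×k matrix N = θ(v) + E(k−3, k) − E(k−3, 1) − E(k, k) + E(k, 1), where E(i,j) denotes the k×k matrix with (i,j) entry 1 and all other entries 0. Then N is a (k, qk)-intersection matrix whose stabilizer K_N under the simultaneous row-and-column permutation action of S_k × S_k is trivial. -/
/-- A pair of permutations preserving the positions of the entries `q + 1` (relation `P`) and
`q - 1` (relation `M`) of the matrix is trivial: the columns, read as arcs from their `q + 1` row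
to their `q - 1` row, form two directed cycles of lengths `3` and `k - 3` through row `k - 4`. -/
theorem perm_pair_eq_one {k : ℕ} (hk : 7 ≤ k) {P M : Fin k → Fin k → Prop}
    (hP : ∀ i j, P i j ↔ ((i : ℕ) = j ∧ (i : ℕ) ≠ k - 1) ∨ ((i : ℕ) = k - 4 ∧ (j : ℕ) = k - 1))
    (hM : ∀ i j, M i j ↔ (j : ℕ) = i + 1 ∨ ((i : ℕ) = k - 4 ∧ (j : ℕ) = 0))
    (p r : Equiv.Perm (Fin k)) (hp : ∀ i j, P i j → P (p i) (r j))
    (hm : ∀ i j, M i j → M (p i) (r j)) : p = 1 ∧ r = 1 := by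
  simp only [hP, hM] at hp hm
  have hinj : ∀ i j, (r i : ℕ) = r j → (i : ℕ) = j := fun i j h => by
    rw [r.injective (Fin.ext h)]
  have hk4 := hp ⟨k - 4, by omega⟩ ⟨k - 4, by omega⟩ (by simp; omega)
  have hk1 := hp ⟨k - 4, by omega⟩ ⟨k - 1, by omega⟩ (by simp)
  have hne := mt (hinj ⟨k - 4, by omega⟩ ⟨k - 1, by omega⟩) (by simp; omega)
  have hm4 := hm ⟨k - 4, by omega⟩ ⟨k - 3, by omega⟩ (by simp; omega)
  have hm3 := hm ⟨k - 3, by omega⟩ ⟨k - 2, by omega⟩ (by simp; omega)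
  have hm2 := hm ⟨k - 2, by omega⟩ ⟨k - 1, by omega⟩ (by simp; omega)
  have hp3 := hp ⟨k - 3, by omega⟩ ⟨k - 3, by omega⟩ (by simp; omega)
  have hp2 := hp ⟨k - 2, by omega⟩ ⟨k - 2, by omega⟩ (by simp; omega)
  have hr1 : (r ⟨k - 1, by omega⟩ : ℕ) = k - 1 := by omega
  have hr4 : (r ⟨k - 4, by omega⟩ : ℕ) = k - 4 := by omega
  have hr : ∀ d j : ℕ, ∀ hj : j < k, j + d = k - 1 → (r ⟨j, hj⟩ : ℕ) = j := by
    intro d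
    induction d with
    | zero =>
      rintro j hj h
      obtain rfl : j = k - 1 := by omega
      exact hr1
    | succ d ih =>
      intro j hj h
      by_cases h4 : j = k - 4
      · subst h4
        exact hr4
      have h1 := ih (j + 1) (by omega) (by omega)
      have h2 := hm ⟨j, hj⟩ ⟨j + 1, by omega⟩ (by simp)
      have h3 := hp ⟨j, hj⟩ ⟨j, hj⟩ (by simp; omega)
      omega
  have hr' : ∀ j : Fin k, (r j : ℕ) = j := fun j => hr (k - 1 - j) j j.2 (by omega)
  have hpne : ∀ i : Fin k, (i : ℕ) ≠ k - 1 → p i = i := by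
    intro i hi
    have h1 := hr' ⟨i + 1, by omega⟩
    have h2 := hm i ⟨i + 1, by omega⟩ (by simp)
    simp only at h1
    ext
    omega
  refine ⟨Equiv.ext fun i => ?_, Equiv.ext fun j => Fin.ext (hr' j)⟩
  by_cases hi : (i : ℕ) = k - 1
  · by_contra hne
    refine hne (p.injective (hpne (p i) fun h => hne (Fin.ext ?_)))
    simp [h, hi]
  · exact hpne i hi

/-- The matrix `N = θ(v) + E(k−3,k) − E(k−3,1) − E(k,k) + E(k,1)` (1-based indexing), where
`v = (q+1, q−1, q, …, q)` and `θ(v)` is the cyclic-shift matrix of `v`, is a partwise fixed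
`(k, qk)`-intersection matrix: its stabilizer under the simultaneous row-and-column
permutation action of `S_k × S_k` is trivial.  Here indices are 0-based, so the modified
positions are `(k−4, k−1)`, `(k−4, 0)`, `(k−1, k−1)`, `(k−1, 0)`. -/
theorem bestmat_zero (k q : ℕ) (hk : 7 ≤ k) (hq : 1 ≤ q)
    (v : Fin k → ℕ)
    (hv0 : v ⟨0, by omega⟩ = q + 1) (hv1 : v ⟨1, by omega⟩ = q - 1)
    (hv2 : ∀ j : Fin k, 2 ≤ (j : ℕ) → v j = q)
    (N : Fin k → Fin k → ℕ)
    (hN : ∀ i j : Fin k, (N i j : ℤ) = (v (j - i) : ℤ)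
        + (if i = (⟨k - 4, by omega⟩ : Fin k) ∧ j = (⟨k - 1, by omega⟩ : Fin k) then 1 else 0)
        - (if i = (⟨k - 4, by omega⟩ : Fin k) ∧ j = (⟨0, by omega⟩ : Fin k) then 1 else 0)
        - (if i = (⟨k - 1, by omega⟩ : Fin k) ∧ j = (⟨k - 1, by omega⟩ : Fin k) then 1 else 0)
        + (if i = (⟨k - 1, by omega⟩ : Fin k) ∧ j = (⟨0, by omega⟩ : Fin k) then 1 else 0)) :
    IsInterMatrix k (q * k) N ∧ stabCard N = 1 := by
  have : NeZero k := ⟨by omega⟩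
  have hv (x : Fin k) : (v x : ℤ) = q + (if x = (⟨0, by omega⟩ : Fin k) then 1 else 0)
      - (if x = (⟨1, by omega⟩ : Fin k) then 1 else 0) := by
    by_cases h0 : x = ⟨0, by omega⟩
    · subst h0
      rw [hv0]
      simp
    by_cases h1 : x = ⟨1, by omega⟩
    · subst h1
      simp [hv1, hq]
    have hx : 2 ≤ (x : ℕ) := by
      simp only [Fin.ext_iff] at h0 h1
      omega
    rw [hv2 x hx, if_neg h0, if_neg h1, add_zero, sub_zero]
  have hone (a : Fin k) : ∑ x, (if x = a then (1 : ℤ) else 0) = 1 := by simp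
  have hsum : ∑ x, (v x : ℤ) = q * k := by
    simp only [hv, Finset.sum_add_distrib, Finset.sum_sub_distrib, hone]
    simp [mul_comm]
  have hrow (i a b : Fin k) :
      ∑ j, (if i = a ∧ j = b then (1 : ℤ) else 0) = if i = a then 1 else 0 := by
    by_cases h : i = a <;> simp [h]
  have hcol (j a b : Fin k) :
      ∑ i, (if i = a ∧ j = b then (1 : ℤ) else 0) = if j = b then 1 else 0 := by
    by_cases h : j = b <;> simp [h]
  refine ⟨⟨fun i => ?_, fun j => ?_⟩, ?_⟩
  · have hs : ∑ j, (v (j - i) : ℤ) = q * k :=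
      ((Equiv.subRight i).sum_comp fun x => (v x : ℤ)).trans hsum
    zify
    simp only [hN, Finset.sum_add_distrib, Finset.sum_sub_distrib, hs, hrow]
    ring
  · have hs : ∑ i, (v (j - i) : ℤ) = q * k :=
      ((Equiv.subLeft j).sum_comp fun x => (v x : ℤ)).trans hsum
    zify
    simp only [hN, Finset.sum_add_distrib, Finset.sum_sub_distrib, hs, hcol]
    ring
  · have hsub0 (i j : Fin k) : j - i = (⟨0, by omega⟩ : Fin k) ↔ (j : ℕ) = i := by
      rw [Fin.ext_iff, Fin.val_sub]
      rcases le_or_gt (i : ℕ) j with h | h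
      · rw [show k - (i : ℕ) + j = (j - i) + k by omega, Nat.add_mod_right,
          Nat.mod_eq_of_lt (by omega)]
        simp only
        omega
      · rw [Nat.mod_eq_of_lt (by omega)]
        simp only
        omega
    have hsub1 (i j : Fin k) : j - i = (⟨1, by omega⟩ : Fin k) ↔
        (j : ℕ) = i + 1 ∨ ((i : ℕ) = k - 1 ∧ (j : ℕ) = 0) := by
      rw [Fin.ext_iff, Fin.val_sub]
      rcases le_or_gt (i : ℕ) j with h | h
      · rw [show k - (i : ℕ) + j = (j - i) + k by omega, Nat.add_mod_right,
          Nat.mod_eq_of_lt (by omega)]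
        simp only
        omega
      · rw [Nat.mod_eq_of_lt (by omega)]
        simp only
        omega
    simp only [hv, hsub0, hsub1, Fin.ext_iff] at hN
    have hP (i j : Fin k) : N i j = q + 1 ↔
        ((i : ℕ) = j ∧ (i : ℕ) ≠ k - 1) ∨ ((i : ℕ) = k - 4 ∧ (j : ℕ) = k - 1) := by
      have := hN i j
      split_ifs at this <;> omega
    have hM (i j : Fin k) : N i j + 1 = q ↔
        (j : ℕ) = i + 1 ∨ ((i : ℕ) = k - 4 ∧ (j : ℕ) = 0) := by
      have := hN i j
      split_ifs at this <;> omega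
    rw [stabCard, Nat.card_eq_one_iff_unique]
    refine ⟨⟨?_⟩, ⟨1, fun _ _ => rfl⟩⟩
    have htriv (x : {p : Equiv.Perm (Fin k) × Equiv.Perm (Fin k) //
        ∀ i j, N (p.1 i) (p.2 j) = N i j}) : x.1 = 1 := by
      obtain ⟨⟨p, r⟩, h⟩ := x
      obtain ⟨hp, hr⟩ := perm_pair_eq_one hk hP hM p r
        (fun i j hij => (h i j).trans hij) (fun i j hij => by rw [h i j, hij])
      exact Prod.ext hp hr
    exact fun x y => Subtype.ext ((htriv x).trans (htriv y).symm)
end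

section
/- Let f : ℕ → ℕ be a function. Set b_0 = 1 and, for each positive integer n, define b_n = Σ_{λ ⊢ n} ∏_j f(λ_j), where the sum is over all integer partitions λ = (λ_1, …, λ_t) of n and the product is over the parts of λ. Then for every positive integer n, n · b_n = Σ_{t=1}^{n} b_{n−t} · ( Σ_{d | t} d · f(d)^{t/d} ), where the inner sum is over the positive divisors d of t. -/
namespace Nat.Partition

open Finset

variable {R : Type*} [CommSemiring R]

/-- Removing `k` copies of `d` identifies the partitions of `n` in which `d` occurs at least `k`
times with the partitions of `n - d * k`. -/
theorem sum_filter_le_count_prod_map (f : ℕ → R) {n d k : ℕ} (hd : 1 ≤ d) (hdk : d * k ≤ n) :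
    ∑ p : n.Partition with k ≤ p.parts.count d, (p.parts.map f).prod =
      f d ^ k * ∑ q : (n - d * k).Partition, (q.parts.map f).prod := by
  rw [mul_sum]
  symm
  refine sum_bij
    (fun q _ ↦ ⟨Multiset.replicate k d + q.parts, ?_, ?_⟩) ?_ ?_ ?_ ?_
  · intro i hi
    rcases Multiset.mem_add.mp hi with h | h
    · rw [Multiset.eq_of_mem_replicate h]
      exact hd
    · exact q.parts_pos h
  · rw [Multiset.sum_add, q.parts_sum, Multiset.sum_replicate, smul_eq_mul, mul_comm k d]
    omega
  · intro q _
    simp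
  · intro q _ q' _ h
    ext1
    simpa using h
  · intro p hp
    have hle : Multiset.replicate k d ≤ p.parts :=
      Multiset.le_count_iff_replicate_le.mp (by simpa using hp)
    refine ⟨⟨p.parts - Multiset.replicate k d,
      fun hi ↦ p.parts_pos (Multiset.mem_of_le (Multiset.sub_le_self _ _) hi), ?_⟩,
      mem_univ _, ?_⟩
    · have h := congrArg Multiset.sum (add_tsub_cancel_of_le hle)
      rw [Multiset.sum_add, p.parts_sum, Multiset.sum_replicate, smul_eq_mul, mul_comm k d] at h
      omega
    · ext1
      exact add_tsub_cancel_of_le hle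
  · intro q _
    simp

theorem sum_mul_count_parts {n : ℕ} (p : n.Partition) :
    ∑ d ∈ Icc 1 n, d * p.parts.count d = n := by
  have hsub : p.parts.toFinset ⊆ Icc 1 n := fun d hd ↦ by
    rw [Multiset.mem_toFinset] at hd
    exact mem_Icc.mpr ⟨p.parts_pos hd, le_of_mem_parts hd⟩
  conv_rhs => rw [← p.parts_sum, sum_multiset_count_of_subset _ _ hsub]
  exact sum_congr rfl fun d _ ↦ by rw [smul_eq_mul, mul_comm]

/-- The number `n` counts, with weight `d`, the pairs `(d, k)` such that `d` occurs at least `k`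
times in a given partition of `n`. -/
theorem sum_ite_le_count_parts {n : ℕ} (p : n.Partition) :
    ∑ x ∈ Icc 1 n ×ˢ Icc 1 n with x.1 * x.2 ≤ n,
      (if x.2 ≤ p.parts.count x.1 then x.1 else 0) = n := by
  conv_rhs => rw [← p.sum_mul_count_parts]
  rw [sum_filter, sum_product]
  refine sum_congr rfl fun d hd ↦ ?_
  have hcount : d * p.parts.count d ≤ n :=
    (single_le_sum_of_canonicallyOrdered (f := fun d ↦ d * p.parts.count d) hd).trans_eq
      p.sum_mul_count_parts
  have hd1 : 1 ≤ d := (mem_Icc.mp hd).1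
  have hset : {k ∈ Icc 1 n | d * k ≤ n ∧ k ≤ p.parts.count d} = Icc 1 (p.parts.count d) := by
    ext k
    simp only [mem_filter, mem_Icc]
    constructor
    · tauto
    · rintro ⟨h1, h2⟩
      have h3 : d * k ≤ n := (Nat.mul_le_mul_left d h2).trans hcount
      exact ⟨⟨h1, (Nat.le_mul_of_pos_left k hd1).trans h3⟩, h3, h2⟩
  simp_rw [← ite_and]
  rw [← sum_filter, hset, sum_const, Nat.card_Icc, smul_eq_mul, mul_comm, Nat.add_sub_cancel]

theorem natCast_mul_sum_prod_map (f : ℕ → R) (n : ℕ) :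
    n * ∑ p : n.Partition, (p.parts.map f).prod =
      ∑ x ∈ Icc 1 n ×ˢ Icc 1 n with x.1 * x.2 ≤ n,
        x.1 * (f x.1 ^ x.2 * ∑ q : (n - x.1 * x.2).Partition, (q.parts.map f).prod) := by
  calc
    _ = ∑ p : n.Partition, ∑ x ∈ Icc 1 n ×ˢ Icc 1 n with x.1 * x.2 ≤ n,
          if x.2 ≤ p.parts.count x.1 then x.1 * (p.parts.map f).prod else 0 := by
      rw [mul_sum]
      refine sum_congr rfl fun p _ ↦ ?_
      rw [← congrArg (Nat.cast (R := R)) p.sum_ite_le_count_parts, Nat.cast_sum, sum_mul]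
      exact sum_congr rfl fun x _ ↦ by split_ifs <;> simp
    _ = _ := by
      rw [sum_comm]
      refine sum_congr rfl fun x hx ↦ ?_
      simp only [mem_filter, mem_product, mem_Icc] at hx
      rw [← sum_filter, ← mul_sum, sum_filter_le_count_prod_map f hx.1.1.1 hx.2]

end Nat.Partition

/-- Summing over pairs with product at most `n` amounts to summing over the value `t` of the
product and the divisors of `t`. -/
theorem Nat.sum_filter_mul_le_eq_sum_divisors {M : Type*} [AddCommMonoid M] (g : ℕ → ℕ → M)
    (n : ℕ) :
    ∑ x ∈ Finset.Icc 1 n ×ˢ Finset.Icc 1 n with x.1 * x.2 ≤ n, g x.1 x.2 =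
      ∑ t ∈ Finset.Icc 1 n, ∑ d ∈ t.divisors, g d (t / d) := by
  simp_rw [← Nat.sum_divisorsAntidiagonal g]
  rw [← Finset.sum_fiberwise_of_maps_to (t := Finset.Icc 1 n) (g := fun x ↦ x.1 * x.2)]
  · refine Finset.sum_congr rfl fun t ht ↦ Finset.sum_congr ?_ fun _ _ ↦ rfl
    ext ⟨d, k⟩
    simp only [Finset.mem_filter, Finset.mem_product, Finset.mem_Icc,
      Nat.mem_divisorsAntidiagonal] at ht ⊢
    constructor
    · rintro ⟨-, h⟩
      exact ⟨h, by omega⟩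
    · rintro ⟨rfl, -⟩
      have hd : 1 ≤ d := Nat.pos_of_mul_pos_right ht.1
      have hk : 1 ≤ k := Nat.pos_of_mul_pos_left ht.1
      exact ⟨⟨⟨⟨hd, (Nat.le_mul_of_pos_right d hk).trans ht.2⟩,
        hk, (Nat.le_mul_of_pos_left k hd).trans ht.2⟩, ht.2⟩, rfl⟩
  · intro x hx
    simp only [Finset.mem_filter, Finset.mem_product, Finset.mem_Icc] at hx ⊢
    exact ⟨Nat.mul_pos hx.1.1.1 hx.1.2.1, hx.2⟩

/-- The recurrence for `b_n = Σ_{λ ⊢ n} ∏_j f(λ_j)`: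
`n · b_n = Σ_{t=1}^{n} b_{n−t} · Σ_{d ∣ t} d · f(d)^{t/d}`. -/
theorem partition_product_recurrence (f : ℕ → ℕ) (b : ℕ → ℕ)
    (hb : ∀ n, b n = ∑ lam : Nat.Partition n, (lam.parts.map f).prod) :
    ∀ n : ℕ, 1 ≤ n →
      n * b n = ∑ t ∈ Finset.Icc 1 n, b (n - t) * ∑ d ∈ t.divisors, d * f d ^ (t / d) := by
  intro n _
  have h := Nat.Partition.natCast_mul_sum_prod_map f n
  simp_rw [← hb, Nat.cast_id] at h
  rw [h, Nat.sum_filter_mul_le_eq_sum_divisors fun d k ↦ d * (f d ^ k * b (n - d * k))]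
  refine Finset.sum_congr rfl fun t _ ↦ ?_
  rw [Finset.mul_sum]
  refine Finset.sum_congr rfl fun d hd ↦ ?_
  rw [Nat.mul_div_cancel' (Nat.dvd_of_mem_divisors hd)]
  ring
end

section
/- For every integer n ≥ 1, the quantity b_n = Σ_{λ ⊢ n} ∏_j (λ_j)!, where the sum is over all integer partitions λ = (λ_1, …, λ_t) of n and the product of factorials is over the parts of λ, satisfies b_n ≤ n! · (1 + 4/n); equivalently, n · b_n ≤ (n + 4) · n!. -/
/-- The sum over the partitions of `n` of the product of the factorials of the parts. -/
def sumPartitionFactorials (n : ℕ) : ℕ :=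
  ∑ lam : Nat.Partition n, (lam.parts.map Nat.factorial).prod

/-- Adjoin a positive part `k` to a partition of `n - k`. -/
def Nat.Partition.consPart {n k : ℕ} (hk : 0 < k) (hkn : k ≤ n) (mu : Nat.Partition (n - k)) :
    Nat.Partition n where
  parts := k ::ₘ mu.parts
  parts_pos := by
    intro i hi
    rcases Multiset.mem_cons.1 hi with rfl | hi
    · exact hk
    · exact mu.parts_pos hi
  parts_sum := by
    rw [Multiset.sum_cons, mu.parts_sum]
    omega

theorem Nat.Partition.consPart_injective {n k : ℕ} (hk : 0 < k) (hkn : k ≤ n) :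
    Function.Injective (Nat.Partition.consPart hk hkn) := by
  intro mu nu h
  have h' := congrArg Nat.Partition.parts h
  exact Nat.Partition.ext ((Multiset.cons_inj_right k).1 h')

theorem Nat.Partition.exists_consPart_eq {n k : ℕ} (hk : 0 < k) (hkn : k ≤ n)
    (lam : Nat.Partition n) (hmem : k ∈ lam.parts) :
    ∃ mu, Nat.Partition.consPart hk hkn mu = lam := by
  have hcons := Multiset.cons_erase hmem
  refine ⟨⟨lam.parts.erase k, fun hi => lam.parts_pos (Multiset.mem_of_mem_erase hi), ?_⟩,
    Nat.Partition.ext hcons⟩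
  have hsum := congrArg Multiset.sum hcons
  rw [Multiset.sum_cons, lam.parts_sum] at hsum
  omega

theorem sum_partition_factorials_of_mem {n k : ℕ} (hk : 0 < k) (hkn : k ≤ n) :
    ∑ lam : Nat.Partition n with k ∈ lam.parts, (lam.parts.map Nat.factorial).prod =
      k.factorial * sumPartitionFactorials (n - k) := by
  have himage : (Finset.univ.filter fun lam : Nat.Partition n => k ∈ lam.parts) =
      Finset.univ.image (Nat.Partition.consPart hk hkn) := by
    ext lam
    simp only [Finset.mem_filter, Finset.mem_univ, true_and, Finset.mem_image]
    constructor
    · exact lam.exists_consPart_eq hk hkn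
    · rintro ⟨mu, rfl⟩
      exact Multiset.mem_cons_self k mu.parts
  rw [himage, Finset.sum_image (Nat.Partition.consPart_injective hk hkn).injOn,
    sumPartitionFactorials, Finset.mul_sum]
  simp [Nat.Partition.consPart]

/-- A partition of a positive integer `n` other than `(n)` has a part at most `n / 2`. -/
theorem Nat.Partition.exists_part_le_half {n : ℕ} (hn : 0 < n) (lam : Nat.Partition n)
    (hlam : lam.parts ≠ {n}) : ∃ k ∈ Finset.Icc 1 (n / 2), k ∈ lam.parts := by
  have hsum := lam.parts_sum
  obtain ⟨a, ha⟩ : ∃ a, a ∈ lam.parts := by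
    apply Multiset.exists_mem_of_ne_zero
    intro h
    simp [h] at hsum
    omega
  obtain ⟨s, hs⟩ := Multiset.exists_cons_of_mem ha
  obtain ⟨b, hb⟩ : ∃ b, b ∈ s := by
    apply Multiset.exists_mem_of_ne_zero
    rintro rfl
    apply hlam
    rw [hs] at hsum ⊢
    simp at hsum
    simp [hsum]
  obtain ⟨t, rfl⟩ := Multiset.exists_cons_of_mem hb
  have hb' : b ∈ lam.parts := by simp [hs]
  have ha0 := lam.parts_pos ha
  have hb0 := lam.parts_pos hb'
  simp only [hs, Multiset.sum_cons] at hsum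
  rcases le_total a b with h | h
  · exact ⟨a, Finset.mem_Icc.2 (by omega), ha⟩
  · exact ⟨b, Finset.mem_Icc.2 (by omega), hb'⟩

theorem sumPartitionFactorials_le_recursion {n : ℕ} (hn : 0 < n) :
    sumPartitionFactorials n ≤
      n.factorial +
        ∑ k ∈ Finset.Icc 1 (n / 2), k.factorial * sumPartitionFactorials (n - k) := by
  have hterm : ∀ lam : Nat.Partition n, (lam.parts.map Nat.factorial).prod ≤
      (if lam = Nat.Partition.indiscrete n then n.factorial else 0) +
        ∑ k ∈ Finset.Icc 1 (n / 2),
          if k ∈ lam.parts then (lam.parts.map Nat.factorial).prod else 0 := by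
    intro lam
    by_cases hlam : lam.parts = {n}
    · have heq : lam = Nat.Partition.indiscrete n :=
        Nat.Partition.ext (by rw [hlam, Nat.Partition.indiscrete_parts hn.ne'])
      rw [if_pos heq]
      simp [hlam]
    · obtain ⟨k, hk, hmem⟩ := lam.exists_part_le_half hn hlam
      have hle := Finset.single_le_sum_of_canonicallyOrdered
        (f := fun k => if k ∈ lam.parts then (lam.parts.map Nat.factorial).prod else 0) hk
      rw [if_pos hmem] at hle
      exact le_add_left hle
  have hparts : ∀ k ∈ Finset.Icc 1 (n / 2),
      ∑ lam : Nat.Partition n with k ∈ lam.parts, (lam.parts.map Nat.factorial).prod =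
        k.factorial * sumPartitionFactorials (n - k) := by
    intro k hk
    rw [Finset.mem_Icc] at hk
    exact sum_partition_factorials_of_mem (by omega) (by omega)
  rw [← Finset.sum_congr rfl hparts]
  refine (Finset.sum_le_sum fun lam _ => hterm lam).trans_eq ?_
  rw [Finset.sum_add_distrib, Finset.sum_comm]
  simp [Finset.sum_filter]

theorem factorial_mul_factorial_sub_le {n k : ℕ} (hk : 2 ≤ k) (hkn : k ≤ n / 2) :
    k.factorial * (n - k).factorial ≤ 2 * (n - 2).factorial := by
  induction k, hk using Nat.le_induction with
  | base => simp
  | succ k hk ih =>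
    refine le_trans ?_ (ih (by omega))
    obtain ⟨m, rfl⟩ : ∃ m, n = k + 1 + m := ⟨n - (k + 1), by omega⟩
    rw [show k + 1 + m - (k + 1) = m by omega, show k + 1 + m - k = m + 1 by omega,
      Nat.factorial_succ, Nat.factorial_succ, mul_assoc, mul_left_comm k.factorial]
    exact Nat.mul_le_mul_right _ (by omega)

theorem sum_factorial_mul_factorial_sub_le {n : ℕ} (hn : 0 < n) :
    ∑ k ∈ Finset.Icc 1 (n / 2), k.factorial * (n - k).factorial ≤ 2 * (n - 1).factorial := by
  rcases Nat.lt_or_ge n 2 with h | h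
  · obtain rfl : n = 1 := by omega
    simp
  · rw [← Finset.add_sum_Ioc_eq_sum_Icc (by omega : 1 ≤ n / 2)]
    have hsum : ∑ k ∈ Finset.Ioc 1 (n / 2), k.factorial * (n - k).factorial ≤
        (n / 2 - 1) * (2 * (n - 2).factorial) := by
      have hle := Finset.sum_le_card_nsmul (Finset.Ioc 1 (n / 2))
        (fun k => k.factorial * (n - k).factorial) (2 * (n - 2).factorial) (by
          intro k hk
          rw [Finset.mem_Ioc] at hk
          exact factorial_mul_factorial_sub_le hk.1 hk.2)
      simpa using hle
    have hfact : (n - 1).factorial = (n - 1) * (n - 2).factorial := by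
      obtain ⟨m, rfl⟩ : ∃ m, n = m + 2 := ⟨n - 2, by omega⟩
      exact Nat.factorial_succ m
    have hmul : (n / 2 - 1) * (2 * (n - 2).factorial) ≤ (n - 1) * (n - 2).factorial := by
      rw [← mul_assoc]
      exact Nat.mul_le_mul_right _ (by omega)
    rw [Nat.factorial_one, one_mul]
    omega

theorem sumPartitionFactorials_le_of_le_two_mul {n : ℕ} (hn : 0 < n)
    (h : ∀ m < n, sumPartitionFactorials m ≤ 2 * m.factorial) :
    sumPartitionFactorials n ≤ n.factorial + 4 * (n - 1).factorial := by
  have hsum : ∑ k ∈ Finset.Icc 1 (n / 2), k.factorial * sumPartitionFactorials (n - k) ≤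
      2 * ∑ k ∈ Finset.Icc 1 (n / 2), k.factorial * (n - k).factorial := by
    rw [Finset.mul_sum]
    refine Finset.sum_le_sum fun k hk => ?_
    rw [Finset.mem_Icc] at hk
    rw [mul_left_comm]
    exact Nat.mul_le_mul_left _ (h _ (by omega))
  have hrec := sumPartitionFactorials_le_recursion hn
  have hfact := sum_factorial_mul_factorial_sub_le hn
  omega

theorem sumPartitionFactorials_le_two_mul (n : ℕ) :
    sumPartitionFactorials n ≤ 2 * n.factorial := by
  have h0 : sumPartitionFactorials 0 = 1 := by
    simp [sumPartitionFactorials]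
  have h1 : sumPartitionFactorials 1 ≤ 1 := by
    simpa using sumPartitionFactorials_le_recursion one_pos
  have h2 : sumPartitionFactorials 2 ≤ 3 := by
    have hrec := sumPartitionFactorials_le_recursion two_pos
    simp [Nat.factorial] at hrec
    omega
  have h3 : sumPartitionFactorials 3 ≤ 9 := by
    have hrec := sumPartitionFactorials_le_recursion three_pos
    simp [Nat.factorial] at hrec
    omega
  induction n using Nat.strong_induction_on with
  | _ n ih =>
    rcases Nat.lt_or_ge n 4 with hn | hn
    · interval_cases n <;> simp [Nat.factorial] <;> omega
    · have hle := sumPartitionFactorials_le_of_le_two_mul (by omega) ih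
      have hfact := Nat.mul_factorial_pred (by omega : n ≠ 0)
      have hmul : 4 * (n - 1).factorial ≤ n * (n - 1).factorial := Nat.mul_le_mul_right _ hn
      omega

/-- `b_n = Σ_{λ ⊢ n} ∏_j (λ_j)! ≤ n! · (1 + 4/n)`, i.e. `n · b_n ≤ (n + 4) · n!`. -/
theorem sum_partition_factorials_le (n : ℕ) (hn : 1 ≤ n) :
    n * ∑ lam : Nat.Partition n, (lam.parts.map Nat.factorial).prod ≤
      (n + 4) * n.factorial := by
  have hle := sumPartitionFactorials_le_of_le_two_mul hn
    fun m _ => sumPartitionFactorials_le_two_mul m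
  calc
    n * sumPartitionFactorials n ≤ n * (n.factorial + 4 * (n - 1).factorial) :=
      Nat.mul_le_mul_left n hle
    _ = n * n.factorial + 4 * (n * (n - 1).factorial) := by ring
    _ = (n + 4) * n.factorial := by
      rw [Nat.mul_factorial_pred (by omega)]
      ring
end
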